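/- Let a ≥ 1 and b ≥ 1 be integers and let F ∈ ℝ[x₀,x₁,y₀,y₁] be a nonzero bihomogeneous polynomial of bidegree (2a, 2b), squarefree over ℂ, such that every singular point of the complex curve C = {F = 0} ⊂ ℙ¹(ℂ)×ℙ¹(ℂ) is a node, and let δ be the total number of singular points of C. If ℝZ(F) = {([x],[y]) ∈ ℙ¹(ℝ)×ℙ¹(ℝ) : F(x,y) = 0} is finite, then |ℝZ(F)| ≤ 2ab + ((2a−1)(2b−1) − δ) + 1. (This is the bound |ℝC| ≤ 2ab + g(C) + 1 for finite real curves of bidegree (2a,2b) in ℙ¹×ℙ¹, written for nodal curves, whose geometric genus is g = (2a−1)(2b−1) − δ.) -/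

import Mathlib

open MvPolynomial

/-- `F ∈ R[x₀,x₁,y₀,y₁]` is bihomogeneous of bidegree `(d₁, d₂)`: every monomial of `F`
has degree `d₁` in `(x₀,x₁)` and degree `d₂` in `(y₀,y₁)`. -/
def Bihomogeneous {R : Type*} [CommSemiring R]
    (F : MvPolynomial (Fin 4) R) (d₁ d₂ : ℕ) : Prop :=
  ∀ d ∈ F.support, d 0 + d 1 = d₁ ∧ d 2 + d 3 = d₂

/-- The real zero set of a bihomogeneous polynomial in `ℙ¹(ℝ) × ℙ¹(ℝ)`. -/
noncomputable def RZ2 (F : MvPolynomial (Fin 4) ℝ) :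
    Set (Projectivization ℝ (Fin 2 → ℝ) × Projectivization ℝ (Fin 2 → ℝ)) :=
  {p | MvPolynomial.eval ![p.1.rep 0, p.1.rep 1, p.2.rep 0, p.2.rep 1] F = 0}

/-- The set of singular points of the curve `{Q = 0} ⊂ ℙ¹(ℂ) × ℙ¹(ℂ)`: points at which
all four partial derivatives of `Q` vanish. -/
noncomputable def SingSet2 (Q : MvPolynomial (Fin 4) ℂ) :
    Set (Projectivization ℂ (Fin 2 → ℂ) × Projectivization ℂ (Fin 2 → ℂ)) :=
  {p | ∀ i : Fin 4,
    MvPolynomial.eval ![p.1.rep 0, p.1.rep 1, p.2.rep 0, p.2.rep 1] (pderiv i Q) = 0}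

/-- The point `p` is a node of the curve `{Q = 0} ⊂ ℙ¹(ℂ) × ℙ¹(ℂ)`: the `4×4` complex
Hessian matrix of `Q` at (representatives of) `p` has rank `2`. -/
noncomputable def IsNodeAt2 (Q : MvPolynomial (Fin 4) ℂ)
    (p : Projectivization ℂ (Fin 2 → ℂ) × Projectivization ℂ (Fin 2 → ℂ)) : Prop :=
  (Matrix.of fun i j : Fin 4 =>
    MvPolynomial.eval ![p.1.rep 0, p.1.rep 1, p.2.rep 0, p.2.rep 1]
      (pderiv i (pderiv j Q))).rank = 2



/-! ### Bezoutians -/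
section Bez
variable {R : Type*} [CommRing R]

/-- Bezoutian coefficients of two coefficient sequences. -/
def bz (u v : ℕ → R) (j l : ℕ) : R :=
  ∑ t ∈ Finset.range (l + 1), (u (j + 1 + t) * v (l - t) - v (j + 1 + t) * u (l - t))

theorem bz_zero (u v : ℕ → R) (j : ℕ) : bz u v j 0 = u (j + 1) * v 0 - v (j + 1) * u 0 := by
  simp [bz]

theorem bz_succ (u v : ℕ → R) (j l : ℕ) :
    bz u v j (l + 1) = bz u v (j + 1) l + (u (j + 1) * v (l + 1) - v (j + 1) * u (l + 1)) := by
  unfold bz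
  rw [Finset.sum_range_succ']
  congr 1
  apply Finset.sum_congr rfl
  intro t ht
  have : j + 1 + (t + 1) = j + 1 + 1 + t := by ring
  rw [this, Nat.add_sub_add_right]

theorem bz_symm [NoZeroDivisors R] [CharZero R] (u v : ℕ → R) (j l : ℕ) :
    bz u v j l = bz u v l j := by
  have key : ∀ l j, bz u v j l - bz u v l j = bz u v (j + l) 0 - bz u v 0 (j + l) := by
    intro l
    induction l with
    | zero => intro j; simp
    | succ l ih =>
      intro j
      have h1 := bz_succ u v j l
      have h2 := bz_succ u v l j
      have h3 := ih (j + 1)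
      have : j + 1 + l = j + (l + 1) := by ring
      rw [this] at h3
      rw [← h3]
      linear_combination h1 + h2
  have h0 : ∀ n, bz u v n 0 - bz u v 0 n = 0 := by
    intro n
    have := key n 0
    rw [zero_add] at this
    have h2 : (2 : R) * (bz u v n 0 - bz u v 0 n) = 0 := by linear_combination -this
    rcases mul_eq_zero.mp h2 with h | h
    · exact absurd h two_ne_zero
    · exact h
  have := key l j
  rw [h0] at this
  exact sub_eq_zero.mp this

theorem bz_eq_zero_left (u v : ℕ → R) (m : ℕ) (hu : ∀ n, m < n → u n = 0)
    (hv : ∀ n, m < n → v n = 0) (j l : ℕ) (hj : m ≤ j) : bz u v j l = 0 := by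
  unfold bz
  apply Finset.sum_eq_zero
  intro t _
  rw [hu (j + 1 + t) (by omega), hv (j + 1 + t) (by omega)]; ring

theorem bz_eq_zero_right [NoZeroDivisors R] [CharZero R] (u v : ℕ → R) (m : ℕ)
    (hu : ∀ n, m < n → u n = 0)
    (hv : ∀ n, m < n → v n = 0) (j l : ℕ) (hj : m ≤ l) : bz u v j l = 0 := by
  rw [bz_symm, bz_eq_zero_left u v m hu hv _ _ hj]

theorem bz_map {S : Type*} [CommRing S] (φ : R →+* S) (u v : ℕ → R) (j l : ℕ) :
    φ (bz u v j l) = bz (fun n => φ (u n)) (fun n => φ (v n)) j l := by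
  simp [bz]

/-- rows of the Bezoutian as polynomials -/
noncomputable def bzP (m : ℕ) (U V : Polynomial R) (j : ℕ) : Polynomial R :=
  ∑ l ∈ Finset.range m, Polynomial.monomial l (bz U.coeff V.coeff j l)

variable [NoZeroDivisors R] [CharZero R]

theorem bzP_coeff (m : ℕ) (U V : Polynomial R) (hU : U.natDegree ≤ m) (hV : V.natDegree ≤ m)
    (j l : ℕ) : (bzP m U V j).coeff l = bz U.coeff V.coeff j l := by
  unfold bzP
  rw [Polynomial.finsetSum_coeff]
  simp only [Polynomial.coeff_monomial]
  rw [Finset.sum_ite_eq']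
  split_ifs with h
  · rfl
  · rw [bz_eq_zero_right _ _ m _ _ _ _ (by simpa using h)]
    · exact fun n hn => Polynomial.coeff_eq_zero_of_natDegree_lt (by omega)
    · exact fun n hn => Polynomial.coeff_eq_zero_of_natDegree_lt (by omega)

theorem bzP_rec (m : ℕ) (U V : Polynomial R) (hU : U.natDegree ≤ m) (hV : V.natDegree ≤ m)
    (j : ℕ) : Polynomial.X * bzP m U V (j + 1) - bzP m U V j =
      Polynomial.C (V.coeff (j + 1)) * U - Polynomial.C (U.coeff (j + 1)) * V := by
  ext l
  cases l with
  | zero =>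
    simp [bzP_coeff m U V hU hV, bz_zero]
  | succ l =>
    simp [bzP_coeff m U V hU hV, bz_succ, Polynomial.coeff_X_mul]

theorem bzP_zero (m : ℕ) (U V : Polynomial R) (hU : U.natDegree ≤ m) (hV : V.natDegree ≤ m) :
    Polynomial.X * bzP m U V 0 =
      Polynomial.C (V.coeff 0) * U - Polynomial.C (U.coeff 0) * V := by
  ext l
  cases l with
  | zero =>
    simp; ring
  | succ l =>
    simp [bzP_coeff m U V hU hV, Polynomial.coeff_X_mul]
    rw [bz_symm, bz_zero]; ring

theorem bzP_top (m : ℕ) (U V : Polynomial R) (hU : U.natDegree ≤ m) (hV : V.natDegree ≤ m)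
    (j : ℕ) (hj : m ≤ j) : bzP m U V j = 0 := by
  ext l
  rw [bzP_coeff m U V hU hV, bz_eq_zero_left _ _ m _ _ _ _ hj]
  · simp
  · exact fun n hn => Polynomial.coeff_eq_zero_of_natDegree_lt (by omega)
  · exact fun n hn => Polynomial.coeff_eq_zero_of_natDegree_lt (by omega)

theorem bzP_mem (m : ℕ) (U V : Polynomial R) (hU : U.natDegree ≤ m) (hV : V.natDegree ≤ m)
    (j : ℕ) : ∃ p q : Polynomial R, bzP m U V j = p * U + q * V ∧
      (∀ n, p.coeff n = - V.coeff (j + 1 + n)) ∧ (∀ n, q.coeff n = U.coeff (j + 1 + n)) := by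
  have : ∀ k j, m ≤ j + k → ∃ p q : Polynomial R, bzP m U V j = p * U + q * V ∧
      (∀ n, p.coeff n = - V.coeff (j + 1 + n)) ∧ (∀ n, q.coeff n = U.coeff (j + 1 + n)) := by
    intro k
    induction k with
    | zero =>
      intro j hj
      refine ⟨0, 0, by simp [bzP_top m U V hU hV j hj], ?_, ?_⟩
      · intro n; rw [Polynomial.coeff_eq_zero_of_natDegree_lt (p := V) (by omega)]; simp
      · intro n; rw [Polynomial.coeff_eq_zero_of_natDegree_lt (p := U) (by omega)]; simp
    | succ k ih =>
      intro j hj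
      obtain ⟨p, q, h1, h2, h3⟩ := ih (j + 1) (by omega)
      have := bzP_rec m U V hU hV j
      refine ⟨Polynomial.X * p - Polynomial.C (V.coeff (j + 1)),
        Polynomial.X * q + Polynomial.C (U.coeff (j + 1)), ?_, ?_, ?_⟩
      · rw [h1] at this
        linear_combination -this
      · intro n
        cases n with
        | zero => simp
        | succ n => simp [h2, Polynomial.coeff_X_mul]; congr 1; ring
      · intro n
        cases n with
        | zero => simp
        | succ n => simp [h3, Polynomial.coeff_X_mul]; congr 1; ring
  exact this m j (by omega)

/-- generating identity -/
theorem bzP_eval₂ {E : Type*} [CommRing E] (φ : R →+* E) (m : ℕ) (U V : Polynomial R)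
    (hU : U.natDegree ≤ m) (hV : V.natDegree ≤ m) (y y' : E) :
    (y - y') * ∑ j ∈ Finset.range m, (bzP m U V j).eval₂ φ y * y' ^ j =
      V.eval₂ φ y' * U.eval₂ φ y - U.eval₂ φ y' * V.eval₂ φ y := by
  have h1 : ∀ n, ∑ j ∈ Finset.range n, (y - y') * ((bzP m U V j).eval₂ φ y * y' ^ j)  =
      (∑ j ∈ Finset.range n, φ (V.coeff j) * y' ^ j) * U.eval₂ φ y
      - (∑ j ∈ Finset.range n, φ (U.coeff j) * y' ^ j) * V.eval₂ φ y
      - (if n = 0 then 0 else (bzP m U V (n - 1)).eval₂ φ y * y' ^ n) := by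
    intro n
    induction n with
    | zero => simp
    | succ n ih =>
      rw [Finset.sum_range_succ, ih, Finset.sum_range_succ, Finset.sum_range_succ]
      cases n with
      | zero =>
        have := congrArg (Polynomial.eval₂ φ y) (bzP_zero m U V hU hV)
        simp [Polynomial.eval₂_mul, Polynomial.eval₂_sub] at this
        simp
        linear_combination this
      | succ n =>
        have := congrArg (Polynomial.eval₂ φ y) (bzP_rec m U V hU hV n)
        simp [Polynomial.eval₂_mul, Polynomial.eval₂_sub] at this
        simp
        linear_combination y' ^ (n+1) * this
  have h2 := h1 (m + 1)
  rw [Finset.sum_range_succ, bzP_top m U V hU hV m le_rfl] at h2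
  simp [bzP_top m U V hU hV m le_rfl] at h2
  rw [Finset.mul_sum, h2, Polynomial.eval₂_eq_sum_range' φ (Nat.lt_succ_of_le hU) y',
    Polynomial.eval₂_eq_sum_range' φ (Nat.lt_succ_of_le hV) y']

end Bez

section Cop
variable {k : Type*} [Field k] [CharZero k]

theorem cop_aux (m : ℕ) (u v p q : Polynomial k) (hc : IsCoprime u v)
    (htop : u.coeff m ≠ 0 ∨ v.coeff m ≠ 0) (hu : u.natDegree ≤ m) (hv : v.natDegree ≤ m)
    (hp : ∀ n, m ≤ n → p.coeff n = 0) (hq : ∀ n, m ≤ n → q.coeff n = 0)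
    (h : p * u + q * v = 0) : p = 0 ∧ q = 0 := by
  have hdu : u ∣ q := by
    have : u ∣ q * v := ⟨-p, by linear_combination h⟩
    exact hc.dvd_of_dvd_mul_right this
  have hdv : v ∣ p := by
    have : v ∣ p * u := ⟨-q, by linear_combination h⟩
    exact hc.symm.dvd_of_dvd_mul_right this
  have small : ∀ w r : Polynomial k, w.coeff m ≠ 0 → (∀ n, m ≤ n → r.coeff n = 0) → w ∣ r →
      r = 0 := by
    intro w r hw hr hd
    by_contra hne
    have h1 := Polynomial.natDegree_le_of_dvd hd hne
    have h2 : m ≤ w.natDegree := Polynomial.le_natDegree_of_ne_zero hw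
    have h3 : r.leadingCoeff = 0 := hr _ (h2.trans h1)
    exact hne (Polynomial.leadingCoeff_eq_zero.mp h3)
  rcases htop with ht | ht
  · have hq0 := small u q ht hq hdu
    refine ⟨?_, hq0⟩
    have : u ≠ 0 := by rintro rfl; simp at ht
    rw [hq0] at h
    simpa [this] using h
  · have hp0 := small v p ht hp hdv
    refine ⟨hp0, ?_⟩
    have : v ≠ 0 := by rintro rfl; simp at ht
    rw [hp0] at h
    simpa [this] using h

/-- nondegeneracy of the Bezoutian -/
theorem bz_nondeg (m : ℕ) (u v : Polynomial k) (hc : IsCoprime u v)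
    (htop : u.coeff m ≠ 0 ∨ v.coeff m ≠ 0) (hu : u.natDegree ≤ m) (hv : v.natDegree ≤ m)
    (c : ℕ → k) (h : ∀ l < m, ∑ j ∈ Finset.range m, c j * bz u.coeff v.coeff j l = 0) :
    ∀ j < m, c j = 0 := by
  choose p q h1 h2 h3 using bzP_mem m u v hu hv
  have hs : ∑ j ∈ Finset.range m, Polynomial.C (c j) * bzP m u v j = 0 := by
    ext l
    simp only [Polynomial.finsetSum_coeff, Polynomial.coeff_C_mul, bzP_coeff m u v hu hv,
      Polynomial.coeff_zero]
    by_cases hl : l < m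
    · exact h l hl
    · apply Finset.sum_eq_zero
      intro j _
      rw [bz_eq_zero_right _ _ m _ _ _ _ (by omega)]
      · simp
      · exact fun n hn => Polynomial.coeff_eq_zero_of_natDegree_lt (by omega)
      · exact fun n hn => Polynomial.coeff_eq_zero_of_natDegree_lt (by omega)
  have hpq := cop_aux m u v (∑ j ∈ Finset.range m, Polynomial.C (c j) * p j)
    (∑ j ∈ Finset.range m, Polynomial.C (c j) * q j) hc htop hu hv ?_ ?_ ?_
  · have hP : ∀ n, ∑ j ∈ Finset.range m, c j * v.coeff (j + 1 + n) = 0 := by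
      intro n
      have := congrArg (fun r => r.coeff n) hpq.1
      simp only [Polynomial.finsetSum_coeff, Polynomial.coeff_C_mul, h2,
        Polynomial.coeff_zero] at this
      simpa using this
    have hQ : ∀ n, ∑ j ∈ Finset.range m, c j * u.coeff (j + 1 + n) = 0 := by
      intro n
      have := congrArg (fun r => r.coeff n) hpq.2
      simp only [Polynomial.finsetSum_coeff, Polynomial.coeff_C_mul, h3,
        Polynomial.coeff_zero] at this
      simpa using this
    have gen : ∀ w : Polynomial k, w.natDegree ≤ m → w.coeff m ≠ 0 →
        (∀ n, ∑ j ∈ Finset.range m, c j * w.coeff (j + 1 + n) = 0) → ∀ j < m, c j = 0 := by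
      intro w hw ht hs j
      induction j using Nat.strong_induction_on with
      | _ j ih =>
        intro hj
        have := hs (m - 1 - j)
        rw [Finset.sum_eq_single j] at this
        · have e : j + 1 + (m - 1 - j) = m := by omega
          rw [e] at this
          simpa [ht] using this
        · intro i hi hne
          rcases lt_or_gt_of_ne hne with hlt | hgt
          · rw [ih i hlt (by omega)]; simp
          · rw [Polynomial.coeff_eq_zero_of_natDegree_lt (by omega)]; simp
        · intro hh; simp at hh; omega
    rcases htop with ht | ht
    · exact gen u hu ht hQ
    · exact gen v hv ht hP
  · intro n hn
    simp only [Polynomial.finsetSum_coeff, Polynomial.coeff_C_mul, h2]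
    apply Finset.sum_eq_zero; intro j _
    rw [Polynomial.coeff_eq_zero_of_natDegree_lt (by omega)]; simp
  · intro n hn
    simp only [Polynomial.finsetSum_coeff, Polynomial.coeff_C_mul, h3]
    apply Finset.sum_eq_zero; intro j _
    rw [Polynomial.coeff_eq_zero_of_natDegree_lt (by omega)]; simp
  · rw [← hs, Finset.sum_mul, Finset.sum_mul, ← Finset.sum_add_distrib]
    apply Finset.sum_congr rfl
    intro j _
    rw [h1]; ring

end Cop


/-! ### Bivariate polynomials -/

/-- apply an additive map to the coefficients -/
noncomputable def cm {R S : Type*} [Semiring R] [Semiring S] (φ : R →+ S) (g : Polynomial R) :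
    Polynomial S :=
  ∑ l ∈ g.support, Polynomial.monomial l (φ (g.coeff l))

@[simp] theorem cm_coeff {R S : Type*} [Semiring R] [Semiring S] (φ : R →+ S) (g : Polynomial R)
    (l : ℕ) : (cm φ g).coeff l = φ (g.coeff l) := by
  unfold cm
  rw [Polynomial.finsetSum_coeff]
  simp only [Polynomial.coeff_monomial, Finset.sum_ite_eq']
  split_ifs with h
  · rfl
  · rw [Polynomial.notMem_support_iff.mp h, map_zero]

theorem cm_natDegree {R S : Type*} [Semiring R] [Semiring S] (φ : R →+ S) (g : Polynomial R)
    (m : ℕ) (h : g.natDegree ≤ m) : (cm φ g).natDegree ≤ m := by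
  rw [Polynomial.natDegree_le_iff_coeff_eq_zero] at *
  intro n hn
  rw [cm_coeff, h n hn, map_zero]

/-- bivariate real polynomials, `(g.coeff l).coeff k` is the coefficient of `x^k y^l` -/
abbrev BP : Type := Polynomial (Polynomial ℝ)

/-- evaluation of bivariate polynomials -/
noncomputable def ev {E : Type*} [CommRing E] [Algebra ℝ E] (x y : E) : BP →ₐ[ℝ] E :=
  Polynomial.eval₂AlgHom (Polynomial.aeval x) y (fun _ => Commute.all _ _)

section ev
variable {E : Type*} [CommRing E] [Algebra ℝ E]

theorem ev_eq (x y : E) (g : BP) :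
    ev x y g = g.eval₂ ((Polynomial.aeval x : Polynomial ℝ →ₐ[ℝ] E) : Polynomial ℝ →+* E) y := rfl

@[simp] theorem ev_Y (x y : E) : ev x y (Polynomial.X : BP) = y := by
  simp [ev_eq]

@[simp] theorem ev_C (x y : E) (q : Polynomial ℝ) :
    ev x y (Polynomial.C q : BP) = Polynomial.aeval x q := by
  simp [ev_eq]

theorem ev_X (x y : E) : ev x y (Polynomial.C Polynomial.X : BP) = x := by
  simp

theorem algHom_eq_ev (φ : BP →ₐ[ℝ] E) :
    φ = ev (φ (Polynomial.C Polynomial.X)) (φ Polynomial.X) := by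
  apply Polynomial.algHom_ext'
  · apply Polynomial.algHom_ext
    simp
  · simp

theorem ev_comp {E' : Type*} [CommRing E'] [Algebra ℝ E'] (χ : E →ₐ[ℝ] E') (x y : E) (g : BP) :
    χ (ev x y g) = ev (χ x) (χ y) g := by
  have := algHom_eq_ev (χ.comp (ev x y))
  have h2 := congrArg (fun φ : BP →ₐ[ℝ] E' => φ g) this
  simpa using h2

end ev

/-- monomial `x^k y^l` -/
noncomputable def mon (k l : ℕ) : BP := Polynomial.monomial l (Polynomial.X ^ k)

theorem mon_coeff (k l k' l' : ℕ) :
    ((mon k l).coeff l').coeff k' = if l = l' ∧ k = k' then 1 else 0 := by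
  unfold mon
  rw [Polynomial.coeff_monomial]
  by_cases h : l = l'
  · simp [h, Polynomial.coeff_X_pow, eq_comm]
  · simp [h]

theorem ev_mon {E : Type*} [CommRing E] [Algebra ℝ E] (x y : E) (k l : ℕ) :
    ev x y (mon k l) = x ^ k * y ^ l := by
  simp [ev_eq, mon]

theorem mon_mul (k l k' l' : ℕ) : mon k l * mon k' l' = mon (k + k') (l + l') := by
  simp [mon, Polynomial.monomial_mul_monomial, pow_add]

/-- polynomials of bidegree at most `(r,s)` -/
def BD (r s : ℕ) : Submodule ℝ BP where
  carrier := {g | ∀ k l, (r < k ∨ s < l) → (g.coeff l).coeff k = 0}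
  add_mem' := by
    intro g h hg hh k l hkl
    simp [hg k l hkl, hh k l hkl]
  zero_mem' := by intro k l _; simp
  smul_mem' := by
    intro c g hg k l hkl
    simp [hg k l hkl]

theorem mem_BD {r s : ℕ} {g : BP} :
    g ∈ BD r s ↔ ∀ k l, (r < k ∨ s < l) → (g.coeff l).coeff k = 0 := Iff.rfl

theorem BD_natDegree {r s : ℕ} {g : BP} (hg : g ∈ BD r s) : g.natDegree ≤ s := by
  rw [Polynomial.natDegree_le_iff_coeff_eq_zero]
  intro n hn
  ext k
  simpa using hg k n (Or.inr hn)

theorem BD_coeff_natDegree {r s : ℕ} {g : BP} (hg : g ∈ BD r s) (l : ℕ) :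
    (g.coeff l).natDegree ≤ r := by
  rw [Polynomial.natDegree_le_iff_coeff_eq_zero]
  intro n hn
  exact hg n l (Or.inl hn)

theorem mem_BD_of {r s : ℕ} {g : BP} (h1 : g.natDegree ≤ s)
    (h2 : ∀ l, (g.coeff l).natDegree ≤ r) : g ∈ BD r s := by
  intro k l h
  rcases h with h | h
  · exact Polynomial.coeff_eq_zero_of_natDegree_lt (lt_of_le_of_lt (h2 l) h)
  · rw [Polynomial.coeff_eq_zero_of_natDegree_lt (lt_of_le_of_lt h1 h)]; simp

theorem BD_mono {r s r' s' : ℕ} (hr : r ≤ r') (hs : s ≤ s') : BD r s ≤ BD r' s' := by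
  intro g hg k l h
  exact hg k l (by omega)

theorem BD_mul {r s r' s' : ℕ} {g h : BP} (hg : g ∈ BD r s) (hh : h ∈ BD r' s') :
    g * h ∈ BD (r + r') (s + s') := by
  apply mem_BD_of
  · exact Polynomial.natDegree_mul_le.trans (add_le_add (BD_natDegree hg) (BD_natDegree hh))
  · intro l
    rw [Polynomial.coeff_mul]
    apply Polynomial.natDegree_sum_le_of_forall_le
    intro i _
    exact Polynomial.natDegree_mul_le.trans
      (add_le_add (BD_coeff_natDegree hg _) (BD_coeff_natDegree hh _))

theorem mon_mem_BD (k l : ℕ) : mon k l ∈ BD k l := by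
  intro k' l' h
  rw [mon_coeff, if_neg]
  omega

theorem BD_eq_sum {r s : ℕ} {g : BP} (hg : g ∈ BD r s) :
    g = ∑ l ∈ Finset.range (s + 1), ∑ k ∈ Finset.range (r + 1),
      ((g.coeff l).coeff k) • mon k l := by
  ext l' k'
  simp only [Polynomial.finsetSum_coeff, Polynomial.coeff_smul, mon_coeff, smul_eq_mul]
  by_cases h : l' < s + 1 ∧ k' < r + 1
  · rw [Finset.sum_eq_single l', Finset.sum_eq_single k']
    · simp
    · intro b _ hb; simp [hb]
    · intro hk; simp at hk; omega
    · intro b _ hb; simp [hb]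
    · intro hk; simp at hk; omega
  · rw [hg k' l' (by omega)]
    symm
    apply Finset.sum_eq_zero
    intro l hl
    apply Finset.sum_eq_zero
    intro k hk
    rw [if_neg]; simp
    rintro ⟨rfl, rfl⟩
    simp at hl hk
    omega

theorem BD_ev {E : Type*} [CommRing E] [Algebra ℝ E] {r s : ℕ} {g : BP} (hg : g ∈ BD r s)
    (x y : E) : ev x y g = ∑ l ∈ Finset.range (s + 1), ∑ k ∈ Finset.range (r + 1),
      ((g.coeff l).coeff k) • (x ^ k * y ^ l) := by
  conv_lhs => rw [BD_eq_sum hg]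
  simp [map_sum, ev_mon]

/-- linear functional vanishing on monomials vanishes on `BD` -/
theorem BD_lin {M : Type*} [AddCommGroup M] [Module ℝ M] {r s : ℕ} {g : BP} (hg : g ∈ BD r s)
    (T : BP →ₗ[ℝ] M) (hT : ∀ k l, k ≤ r → l ≤ s → T (mon k l) = 0) : T g = 0 := by
  rw [BD_eq_sum hg]
  simp only [map_sum, map_smul]
  apply Finset.sum_eq_zero
  intro l hl
  apply Finset.sum_eq_zero
  intro k hk
  rw [hT k l (by simp at hk; omega) (by simp at hl; omega), smul_zero]

/-- coordinates on `BD` -/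
noncomputable def BDequiv (r s : ℕ) : BD r s ≃ₗ[ℝ] (Fin (s + 1) × Fin (r + 1) → ℝ) where
  toFun g := fun i => (g.1.coeff i.1).coeff i.2
  map_add' := by intro g h; ext i; simp
  map_smul' := by intro c g; ext i; simp
  invFun c := ⟨∑ i, c i • mon i.2 i.1, by
    apply Submodule.sum_mem
    intro i _
    apply Submodule.smul_mem
    exact BD_mono (by omega) (by omega) (mon_mem_BD _ _)⟩
  left_inv := by
    intro g
    apply Subtype.ext
    have := BD_eq_sum g.2
    conv_rhs => rw [this]
    change ∑ i : Fin (s + 1) × Fin (r + 1), (g.1.coeff i.1).coeff i.2 • mon i.2 i.1 = _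
    rw [Fintype.sum_prod_type]
    simp only [Finset.sum_range]
  right_inv := by
    intro c
    ext i
    simp only [Polynomial.finsetSum_coeff, Polynomial.coeff_smul, mon_coeff, smul_eq_mul]
    rw [Finset.sum_eq_single i]
    · simp
    · intro j _ hj
      rw [if_neg]; simp
      rintro ⟨h1, h2⟩
      exact hj (Prod.ext (Fin.ext h1) (Fin.ext h2))
    · simp

instance (r s : ℕ) : Module.Finite ℝ (BD r s) := Module.Finite.equiv (BDequiv r s).symm

theorem BD_finrank (r s : ℕ) : Module.finrank ℝ (BD r s) = (r + 1) * (s + 1) := by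
  rw [(BDequiv r s).finrank_eq, Module.finrank_fintype_fun_eq_card, Fintype.card_prod]
  simp [mul_comm]

/-- derivative in `x` -/
noncomputable def dX (g : BP) : BP := cm (Polynomial.derivative.toAddMonoidHom) g

/-- derivative in `y` -/
noncomputable def dY (g : BP) : BP := Polynomial.derivative g

@[simp] theorem dX_coeff (g : BP) (l : ℕ) :
    (dX g).coeff l = Polynomial.derivative (g.coeff l) := by
  simp [dX]

theorem dX_add (g h : BP) : dX (g + h) = dX g + dX h := by
  apply Polynomial.ext; intro l; simp

theorem dX_mul (g h : BP) : dX (g * h) = dX g * h + g * dX h := by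
  apply Polynomial.ext; intro l
  simp [Polynomial.coeff_mul, Polynomial.derivative_mul, Finset.sum_add_distrib]

theorem dX_C (q : Polynomial ℝ) : dX (Polynomial.C q) = Polynomial.C (Polynomial.derivative q) := by
  apply Polynomial.ext; intro l
  simp [Polynomial.coeff_C]
  split_ifs <;> simp

theorem dX_Y : dX (Polynomial.X : BP) = 0 := by
  apply Polynomial.ext; intro l
  simp [Polynomial.coeff_X]
  split_ifs <;> simp

theorem dX_sub (g h : BP) : dX (g - h) = dX g - dX h := by
  apply Polynomial.ext; intro l; simp

theorem dX_dY (g : BP) : dX (dY g) = dY (dX g) := by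
  apply Polynomial.ext; intro l
  simp [dY, Polynomial.coeff_derivative, Polynomial.derivative_mul]

theorem dY_add (g h : BP) : dY (g + h) = dY g + dY h := by simp [dY]
theorem dY_sub (g h : BP) : dY (g - h) = dY g - dY h := by simp [dY]
theorem dY_mul (g h : BP) : dY (g * h) = dY g * h + g * dY h := by simp [dY, Polynomial.derivative_mul]
theorem dY_C (q : Polynomial ℝ) : dY (Polynomial.C q) = 0 := by simp [dY]
theorem dY_Y : dY (Polynomial.X : BP) = 1 := by simp [dY]

theorem dX_mem_BD {r s : ℕ} {g : BP} (hg : g ∈ BD (r + 1) s) : dX g ∈ BD r s := by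
  intro k l h
  rw [dX_coeff, Polynomial.coeff_derivative, hg (k+1) l (by omega), zero_mul]

theorem dY_mem_BD {r s : ℕ} {g : BP} (hg : g ∈ BD r (s + 1)) : dY g ∈ BD r s := by
  intro k l h
  have := hg k (l+1) (by omega)
  rw [dY, Polynomial.coeff_derivative]
  have e : ((l : Polynomial ℝ) + 1) = Polynomial.C ((l:ℝ)+1) := by simp
  rw [e, Polynomial.coeff_mul_C, this, zero_mul]


/-- coefficient of `x^p`, a polynomial in `y` -/
noncomputable def xc (p : ℕ) (g : BP) : Polynomial ℝ :=
  cm (Polynomial.lcoeff ℝ p).toAddMonoidHom g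

@[simp] theorem xc_coeff (p : ℕ) (g : BP) (l : ℕ) : (xc p g).coeff l = (g.coeff l).coeff p := by
  simp [xc]

theorem xc_natDegree {p r m : ℕ} {g : BP} (hg : g ∈ BD r m) : (xc p g).natDegree ≤ m :=
  cm_natDegree _ _ _ (BD_natDegree hg)

/-- no common zeros at infinity -/
structure BoxHyp (p m : ℕ) (U V : BP) : Prop where
  hp : 1 ≤ p
  hm : 1 ≤ m
  hU : U ∈ BD p m
  hV : V ∈ BD p m
  hcx : IsCoprime (xc p U) (xc p V)
  htop : (xc p U).coeff m ≠ 0 ∨ (xc p V).coeff m ≠ 0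
  hcy : IsCoprime (U.coeff m) (V.coeff m)

theorem bz_solve {k : Type*} [Field k] [CharZero k] (m : ℕ) (u v : Polynomial k)
    (hc : IsCoprime u v)
    (htop : u.coeff m ≠ 0 ∨ v.coeff m ≠ 0) (hu : u.natDegree ≤ m) (hv : v.natDegree ≤ m)
    (γ : ℕ → k) : ∃ c : ℕ → k,
      ∀ l < m, ∑ j ∈ Finset.range m, c j * bz u.coeff v.coeff j l = γ l := by
  let φ : (Fin m → k) →ₗ[k] (Fin m → k) :=
    { toFun := fun c l => ∑ j : Fin m, c j * bz u.coeff v.coeff j l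
      map_add' := by intro c d; ext l; simp [add_mul, Finset.sum_add_distrib]
      map_smul' := by intro c d; ext l; simp [Finset.mul_sum, mul_assoc] }
  have hinj : Function.Injective φ := by
    rw [← LinearMap.ker_eq_bot, LinearMap.ker_eq_bot']
    intro c hcz
    have := bz_nondeg m u v hc htop hu hv (fun j => if h : j < m then c ⟨j, h⟩ else 0) (by
      intro l hl
      have := congrFun hcz ⟨l, hl⟩
      rw [Finset.sum_range]
      simpa [φ] using this)
    ext j
    simpa using this j j.2
  obtain ⟨c, hc⟩ := (LinearMap.injective_iff_surjective.mp hinj) (fun l => γ l)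
  refine ⟨fun j => if h : j < m then c ⟨j, h⟩ else 0, ?_⟩
  intro l hl
  have := congrFun hc ⟨l, hl⟩
  rw [Finset.sum_range]
  simpa [φ] using this

/-- entries of the Bezout matrix -/
noncomputable def MM (U V : BP) (j l : ℕ) : Polynomial ℝ := bz V.coeff U.coeff j l

theorem MM_natDegree {p m : ℕ} {U V : BP} (hU : U ∈ BD p m) (hV : V ∈ BD p m) (j l : ℕ) :
    (MM U V j l).natDegree ≤ 2 * p := by
  unfold MM bz
  apply Polynomial.natDegree_sum_le_of_forall_le
  intro t _
  apply (Polynomial.natDegree_sub_le _ _).trans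
  apply max_le
  all_goals
    apply Polynomial.natDegree_mul_le.trans
    rw [two_mul]
    apply add_le_add <;> apply BD_coeff_natDegree <;> assumption

theorem MM_top {p m : ℕ} {U V : BP} (hU : U ∈ BD p m) (hV : V ∈ BD p m) (j l : ℕ) :
    (MM U V j l).coeff (2 * p) = bz (xc p V).coeff (xc p U).coeff j l := by
  unfold MM bz
  rw [Polynomial.finsetSum_coeff]
  apply Finset.sum_congr rfl
  intro t _
  simp only [xc_coeff, Polynomial.coeff_sub]
  rw [two_mul]
  rw [Polynomial.coeff_mul_add_eq_of_natDegree_le, Polynomial.coeff_mul_add_eq_of_natDegree_le]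
  all_goals apply BD_coeff_natDegree; assumption

theorem exists_J (B : ℕ → BP) (W : BP) (m : ℕ) : ∃ J : Submodule (Polynomial ℝ) BP, ∀ g, g ∈ J ↔
      ∃ (c : ℕ → Polynomial ℝ) (q : BP),
        g = ∑ j ∈ Finset.range m, Polynomial.C (c j) * B j + W * q := by
  let J : Submodule (Polynomial ℝ) BP :=
    Submodule.span (Polynomial ℝ) (Set.range (fun j : Fin m => B j)) ⊔
      LinearMap.range (LinearMap.mulLeft (Polynomial ℝ) W)
  refine ⟨J, fun g => ?_⟩
  rw [Submodule.mem_sup]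
  constructor
  · rintro ⟨s, hs, t, ⟨q, rfl⟩, rfl⟩
    obtain ⟨c, rfl⟩ := (Submodule.mem_span_range_iff_exists_fun _).mp hs
    refine ⟨fun j => if h : j < m then c ⟨j, h⟩ else 0, q, ?_⟩
    rw [Finset.sum_range]
    simp [Polynomial.smul_eq_C_mul]
  · rintro ⟨c, q, rfl⟩
    refine ⟨_, ?_, _, ⟨q, rfl⟩, rfl⟩
    apply Submodule.sum_mem
    intro j hj
    rw [← Polynomial.smul_eq_C_mul]
    apply Submodule.smul_mem
    exact Submodule.subset_span ⟨⟨j, by simpa using hj⟩, rfl⟩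

section box
variable {p m : ℕ} {U V : BP} (H : BoxHyp p m U V)
include H

theorem box_sol (γ : ℕ → ℝ) : ∃ c : ℕ → ℝ,
    ∀ l < m, ∑ j ∈ Finset.range m, c j * (MM U V j l).coeff (2 * p) = γ l := by
  simp only [MM_top H.hU H.hV]
  exact bz_solve m _ _ H.hcx.symm H.htop.symm (xc_natDegree H.hV) (xc_natDegree H.hU) γ

theorem box_inj (c : ℕ → ℝ)
    (h : ∀ l < m, ∑ j ∈ Finset.range m, c j * (MM U V j l).coeff (2 * p) = 0) :
    ∀ j < m, c j = 0 := by
  simp only [MM_top H.hU H.hV] at h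
  exact bz_nondeg m _ _ H.hcx.symm H.htop.symm (xc_natDegree H.hV) (xc_natDegree H.hU) c h

theorem BB_coeff (j l : ℕ) : (bzP m V U j).coeff l = MM U V j l :=
  bzP_coeff m V U (BD_natDegree H.hV) (BD_natDegree H.hU) j l

theorem BB_mem (j : ℕ) : bzP m V U j ∈ Ideal.span {U, V} := by
  obtain ⟨p, q, h, -, -⟩ := bzP_mem m V U (BD_natDegree H.hV) (BD_natDegree H.hU) j
  rw [h, add_comm]
  rw [Ideal.mem_span_pair]
  exact ⟨q, p, rfl⟩

theorem exists_W : ∃ W : BP, W.Monic ∧ W.natDegree = m ∧ W ∈ Ideal.span {U, V} ∧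
    ∃ r s : Polynomial ℝ, U = Polynomial.C (U.coeff m) * W
        - Polynomial.C s * (Polynomial.C (U.coeff m) * V - Polynomial.C (V.coeff m) * U) ∧
      V = Polynomial.C (V.coeff m) * W
        + Polynomial.C r * (Polynomial.C (U.coeff m) * V - Polynomial.C (V.coeff m) * U) := by
  obtain ⟨r, s, hrs⟩ := H.hcy
  have hdeg : (Polynomial.C r * U + Polynomial.C s * V).natDegree ≤ m := by
    apply (Polynomial.natDegree_add_le _ _).trans
    apply max_le
    · exact (Polynomial.natDegree_C_mul_le _ _).trans (BD_natDegree H.hU)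
    · exact (Polynomial.natDegree_C_mul_le _ _).trans (BD_natDegree H.hV)
  have hco : (Polynomial.C r * U + Polynomial.C s * V).coeff m = 1 := by
    simpa using hrs
  have hmon : (Polynomial.C r * U + Polynomial.C s * V).Monic :=
    Polynomial.monic_of_natDegree_le_of_coeff_eq_one m hdeg hco
  have hrs' : (Polynomial.C r * Polynomial.C (U.coeff m)
      + Polynomial.C s * Polynomial.C (V.coeff m) : BP) = 1 := by
    rw [← Polynomial.C_mul, ← Polynomial.C_mul, ← Polynomial.C_add, hrs, Polynomial.C_1]
  refine ⟨Polynomial.C r * U + Polynomial.C s * V, hmon, ?_, ?_, r, s, ?_, ?_⟩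
  · apply le_antisymm hdeg
    apply Polynomial.le_natDegree_of_ne_zero
    rw [hco]; exact one_ne_zero
  · rw [Ideal.mem_span_pair]; exact ⟨_, _, rfl⟩
  · linear_combination (-U) * hrs'
  · linear_combination (-V) * hrs'

theorem BB_last : bzP m V U (m - 1) =
    Polynomial.C (V.coeff m) * U - Polynomial.C (U.coeff m) * V := by
  have := bzP_rec m V U (BD_natDegree H.hV) (BD_natDegree H.hU) (m - 1)
  have e : m - 1 + 1 = m := Nat.sub_add_cancel H.hm
  rw [e, bzP_top m V U (BD_natDegree H.hV) (BD_natDegree H.hU) m le_rfl] at this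
  linear_combination -this

theorem span_rep (W : BP) (r s : Polynomial ℝ)
    (hWU : U = Polynomial.C (U.coeff m) * W
        - Polynomial.C s * (Polynomial.C (U.coeff m) * V - Polynomial.C (V.coeff m) * U))
    (hWV : V = Polynomial.C (V.coeff m) * W
        + Polynomial.C r * (Polynomial.C (U.coeff m) * V - Polynomial.C (V.coeff m) * U))
    (g : BP) (hg : g ∈ Ideal.span {U, V}) :
    ∃ (c : ℕ → Polynomial ℝ) (q : BP),
      g = ∑ j ∈ Finset.range m, Polynomial.C (c j) * bzP m V U j + W * q := by
  obtain ⟨J, hJ⟩ := exists_J (fun j => bzP m V U j) W m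
  have hWJ : ∀ q, W * q ∈ J := fun q => (hJ _).mpr ⟨fun _ => 0, q, by simp⟩
  have hBJ : ∀ j, bzP m V U j ∈ J := by
    intro j
    by_cases hj : j < m
    · refine (hJ _).mpr ⟨fun i => if i = j then 1 else 0, 0, ?_⟩
      rw [Finset.sum_eq_single j]
      · simp
      · intro i _ hi; simp [hi]
      · intro h; simp at h; omega
    · rw [bzP_top m V U (BD_natDegree H.hV) (BD_natDegree H.hU) j (by omega)]
      exact J.zero_mem
  have hCJ : ∀ a g, g ∈ J → Polynomial.C a * g ∈ J := by
    intro a g hg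
    rw [← Polynomial.smul_eq_C_mul]; exact J.smul_mem _ hg
  have hlast := BB_last H
  have hUJ : U ∈ J := by
    have : U = Polynomial.C (U.coeff m) * (W * 1) + Polynomial.C s * bzP m V U (m - 1) := by
      rw [hlast]; linear_combination hWU
    rw [this]
    exact J.add_mem (hCJ _ _ (hWJ _)) (hCJ _ _ (hBJ _))
  have hVJ : V ∈ J := by
    have : V = Polynomial.C (V.coeff m) * (W * 1) - Polynomial.C r * bzP m V U (m - 1) := by
      rw [hlast]; linear_combination hWV
    rw [this]
    exact J.sub_mem (hCJ _ _ (hWJ _)) (hCJ _ _ (hBJ _))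
  have hYB : ∀ j, Polynomial.X * bzP m V U j ∈ J := by
    intro j
    cases j with
    | zero =>
      rw [bzP_zero m V U (BD_natDegree H.hV) (BD_natDegree H.hU)]
      exact J.sub_mem (hCJ _ _ hVJ) (hCJ _ _ hUJ)
    | succ j =>
      have := bzP_rec m V U (BD_natDegree H.hV) (BD_natDegree H.hU) j
      rw [sub_eq_iff_eq_add] at this
      rw [this]
      exact J.add_mem (J.sub_mem (hCJ _ _ hVJ) (hCJ _ _ hUJ)) (hBJ _)
  have hYJ : ∀ g ∈ J, Polynomial.X * g ∈ J := by
    intro g hg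
    obtain ⟨c, q, rfl⟩ := (hJ _).mp hg
    rw [mul_add, Finset.mul_sum]
    apply J.add_mem
    · apply J.sum_mem
      intro j _
      rw [mul_left_comm]
      exact hCJ _ _ (hYB j)
    · rw [mul_left_comm]; exact hWJ _
  have hall : ∀ h g : BP, g ∈ J → h * g ∈ J := by
    intro h
    induction h using Polynomial.induction_on' with
    | add h1 h2 ih1 ih2 =>
      intro g hg
      rw [add_mul]; exact J.add_mem (ih1 g hg) (ih2 g hg)
    | monomial n a =>
      induction n with
      | zero => intro g hg; exact hCJ _ _ hg
      | succ n ih =>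
        intro g hg
        have : (Polynomial.monomial (n+1) a : BP) * g = Polynomial.monomial n a * (Polynomial.X * g) := by
          rw [← mul_assoc, Polynomial.monomial_mul_X]
        rw [this]
        exact ih _ (hYJ g hg)
  obtain ⟨h1, h2, rfl⟩ := Ideal.mem_span_pair.mp hg
  exact (hJ _).mp (J.add_mem (hall _ _ hUJ) (hall _ _ hVJ))

theorem box_indep (g : BP) (hg : g ∈ Ideal.span {U, V}) (hb : g ∈ BD (2 * p - 1) (m - 1)) :
    g = 0 := by
  obtain ⟨W, hmon, hdeg, hWI, r, s, hWU, hWV⟩ := exists_W H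
  obtain ⟨c, q, hcq⟩ := span_rep H W r s hWU hWV g hg
  have hp := H.hp
  have hm := H.hm
  set S := ∑ j ∈ Finset.range m, Polynomial.C (c j) * bzP m V U j with hS
  have hSco : ∀ l, S.coeff l = ∑ j ∈ Finset.range m, c j * MM U V j l := by
    intro l
    simp [hS, Polynomial.finsetSum_coeff, BB_coeff H]
  have hq : q = 0 := by
    by_contra hq
    have h1 : W * q = g - S := by rw [hcq]; ring
    have h2 : (W * q).natDegree = m + q.natDegree := by
      rw [hmon.natDegree_mul' hq, hdeg]
    have h3 : (g - S).natDegree ≤ m - 1 := by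
      rw [Polynomial.natDegree_le_iff_coeff_eq_zero]
      intro n hn
      rw [Polynomial.coeff_sub, hSco,
        Polynomial.coeff_eq_zero_of_natDegree_lt (lt_of_le_of_lt (BD_natDegree hb) hn)]
      rw [Finset.sum_eq_zero]; simp
      intro j _
      rw [← BB_coeff H, bzP]
      rw [Polynomial.finsetSum_coeff, Finset.sum_eq_zero]; simp
      intro i hi
      rw [Polynomial.coeff_monomial, if_neg]
      simp at hi; omega
    rw [← h1, h2] at h3
    omega
  have hgS : g = S := by rw [hcq, hq]; ring
  have key : ∀ n, (∀ j < m, ∀ k, n ≤ k → (c j).coeff k = 0) → ∀ j < m, ∀ k, (c j).coeff k = 0 := by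
    intro n
    induction n with
    | zero => intro h j hj k; exact h j hj k (Nat.zero_le _)
    | succ n ih =>
      intro h
      apply ih
      have hz := box_inj H (fun j => (c j).coeff n) (by
        intro l hl
        have h1 : (g.coeff l).coeff (n + 2 * p) = 0 := hb _ _ (by omega)
        rw [hgS, hSco, Polynomial.finsetSum_coeff] at h1
        rw [← h1]
        apply Finset.sum_congr rfl
        intro j hj
        rw [Polynomial.coeff_mul_add_eq_of_natDegree_le _ (MM_natDegree H.hU H.hV j l)]
        rw [Polynomial.natDegree_le_iff_coeff_eq_zero]
        intro k hk
        exact h j (by simpa using hj) k hk)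
      intro j hj k hk
      rcases Nat.eq_or_lt_of_le hk with h' | h'
      · rw [← h']; exact hz j hj
      · exact h j hj k h'
  have hc0 : ∀ j < m, c j = 0 := by
    intro j hj
    ext k
    rw [Polynomial.coeff_zero]
    refine key (∑ j ∈ Finset.range m, (c j).natDegree + 1) ?_ j hj k
    intro i hi k hk
    apply Polynomial.coeff_eq_zero_of_natDegree_lt
    have := Finset.single_le_sum (f := fun j => (c j).natDegree) (fun _ _ => Nat.zero_le _)
      (Finset.mem_range.mpr hi)
    omega
  rw [hgS, hS]
  apply Finset.sum_eq_zero
  intro j hj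
  rw [hc0 j (by simpa using hj)]; simp

theorem box_span (g : BP) : ∃ h ∈ BD (2 * p - 1) (m - 1), g - h ∈ Ideal.span {U, V} := by
  obtain ⟨W, hmon, hdeg, hWI, -⟩ := exists_W H
  have hp := H.hp
  have hm := H.hm
  have step : ∀ n, ∀ g ∈ BD (2 * p - 1 + n) (m - 1),
      ∃ h ∈ BD (2 * p - 1) (m - 1), g - h ∈ Ideal.span {U, V} := by
    intro n
    induction n with
    | zero => intro g hg; exact ⟨g, hg, by simp⟩
    | succ n ih =>
      intro g hg
      obtain ⟨c, hc⟩ := box_sol H (fun l => (g.coeff l).coeff (n + 2 * p))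
      set S := ∑ j ∈ Finset.range m, Polynomial.C (Polynomial.monomial n (c j)) * bzP m V U j with hS
      have hSI : S ∈ Ideal.span {U, V} :=
        Ideal.sum_mem _ (fun j _ => Ideal.mul_mem_left _ _ (BB_mem H j))
      have hSco : ∀ l k, (S.coeff l).coeff k =
          ∑ j ∈ Finset.range m, (Polynomial.monomial n (c j) * MM U V j l).coeff k := by
        intro l k
        simp [hS, Polynomial.finsetSum_coeff, BB_coeff H]
      obtain ⟨h, hh, hI⟩ := ih (g - S) (by
        intro k l hkl
        rw [Polynomial.coeff_sub, Polynomial.coeff_sub, hSco]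
        by_cases hl : m - 1 < l
        · rw [hg k l (Or.inr hl), Finset.sum_eq_zero]; simp
          intro j _
          have : MM U V j l = 0 := by
            apply bz_eq_zero_right _ _ m
            · exact fun n hn => Polynomial.coeff_eq_zero_of_natDegree_lt (lt_of_le_of_lt (BD_natDegree H.hV) hn)
            · exact fun n hn => Polynomial.coeff_eq_zero_of_natDegree_lt (lt_of_le_of_lt (BD_natDegree H.hU) hn)
            · omega
          rw [this]; simp
        · rcases hkl with hk | hl'
          · rcases Nat.eq_or_lt_of_le (Nat.succ_le_of_lt hk) with h' | h'
            · have e : k = n + 2 * p := by omega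
              rw [e, ← hc l (by omega), sub_eq_zero]
              apply Finset.sum_congr rfl
              intro j _
              rw [Polynomial.coeff_mul_add_eq_of_natDegree_le
                (Polynomial.natDegree_monomial_le _) (MM_natDegree H.hU H.hV j l)]
              simp
            · rw [hg k l (by omega), Finset.sum_eq_zero]; simp
              intro j _
              apply Polynomial.coeff_eq_zero_of_natDegree_lt
              have h1 := Polynomial.natDegree_mul_le (p := Polynomial.monomial n (c j)) (q := MM U V j l)
              have h2 := MM_natDegree H.hU H.hV j l
              have h3 : (Polynomial.monomial n (c j)).natDegree ≤ n := Polynomial.natDegree_monomial_le _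
              omega
          · omega)
      refine ⟨h, hh, ?_⟩
      have : g - h = (g - S - h) + S := by ring
      rw [this]
      exact Ideal.add_mem _ hI hSI
  have hmod : g - g %ₘ W ∈ Ideal.span {U, V} := by
    have := Polynomial.modByMonic_add_div g W
    have e : g - g %ₘ W = (g /ₘ W) * W := by linear_combination -this
    rw [e]
    exact Ideal.mul_mem_left _ _ hWI
  have hdm : (g %ₘ W).natDegree ≤ m - 1 := by
    have := Polynomial.natDegree_modByMonic_lt g hmon (by
      intro h; rw [h] at hdeg; simp at hdeg; omega)
    omega
  obtain ⟨h, hh, hI⟩ := step (∑ l ∈ Finset.range m, ((g %ₘ W).coeff l).natDegree) (g %ₘ W) (by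
    apply mem_BD_of hdm
    intro l
    by_cases hl : l < m
    · have := Finset.single_le_sum (f := fun l => ((g %ₘ W).coeff l).natDegree) (fun _ _ => Nat.zero_le _)
        (Finset.mem_range.mpr hl)
      omega
    · rw [Polynomial.coeff_eq_zero_of_natDegree_lt (by omega)]; simp)
  refine ⟨h, hh, ?_⟩
  have : g - h = (g - g %ₘ W) + (g %ₘ W - h) := by ring
  rw [this]
  exact Ideal.add_mem _ hmod hI

end box


/-! ### divided differences -/
section dd
variable {E : Type*} [CommRing E]

/-- divided difference of powers -/
def tt (x x' : E) : ℕ → E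
  | 0 => 0
  | k + 1 => x * tt x x' k + x' ^ k

theorem tt_add (x x' : E) (a b : ℕ) :
    tt x x' (a + b) = x ^ a * tt x x' b + x' ^ b * tt x x' a := by
  induction a with
  | zero => simp [tt]
  | succ a ih =>
    have : a + 1 + b = (a + b) + 1 := by ring
    rw [this, tt, ih, tt]; ring

theorem tt_sub (x x' : E) (k : ℕ) : (x - x') * tt x x' k = x ^ k - x' ^ k := by
  induction k with
  | zero => simp [tt]
  | succ k ih => rw [tt, mul_add, mul_left_comm, ih]; ring

theorem tt_diag (x : E) (k : ℕ) : tt x x (k + 1) = (k + 1) * x ^ k := by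
  induction k with
  | zero => simp [tt]
  | succ k ih => rw [tt, ih]; push_cast; ring

theorem tt_sum (x x' : E) (k : ℕ) :
    tt x x' (k + 1) = ∑ i ∈ Finset.range (k + 1), x ^ i * x' ^ (k - i) := by
  induction k with
  | zero => simp [tt]
  | succ k ih =>
    rw [tt, ih, Finset.sum_range_succ' _ (k + 1), Finset.mul_sum]
    congr 1
    · apply Finset.sum_congr rfl
      intro i _
      rw [Nat.add_sub_add_right]; ring
    · simp

/-- divided difference of a polynomial -/
noncomputable def dd (x x' : E) (q : Polynomial E) : E := q.sum fun k c => c * tt x x' k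

theorem dd_add (x x' : E) (q r : Polynomial E) : dd x x' (q + r) = dd x x' q + dd x x' r := by
  unfold dd
  rw [Polynomial.sum_add_index]
  · simp
  · intro i a b; ring

theorem dd_monomial (x x' : E) (k : ℕ) (c : E) :
    dd x x' (Polynomial.monomial k c) = c * tt x x' k := by
  unfold dd
  rw [Polynomial.sum_monomial_index]; simp

theorem dd_mul (x x' : E) (q r : Polynomial E) :
    dd x x' (q * r) = q.eval x * dd x x' r + r.eval x' * dd x x' q := by
  induction q using Polynomial.induction_on' with
  | add q1 q2 h1 h2 =>
    rw [add_mul, dd_add, h1, h2, dd_add, Polynomial.eval_add]; ring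
  | monomial n a =>
    induction r using Polynomial.induction_on' with
    | add q1 q2 h1 h2 =>
      rw [mul_add, dd_add, h1, h2, dd_add, Polynomial.eval_add]; ring
    | monomial k b =>
      rw [Polynomial.monomial_mul_monomial, dd_monomial, dd_monomial, dd_monomial, tt_add]
      simp; ring

/-- `dd` as an additive map -/
noncomputable def ddA (x x' : E) : Polynomial E →+ E :=
  ⟨⟨dd x x', by simp [dd]⟩, dd_add x x'⟩

theorem dd_C (x x' : E) (c : E) : dd x x' (Polynomial.C c) = 0 := by
  rw [← Polynomial.monomial_zero_left, dd_monomial]; simp [tt]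

theorem dd_C_mul (x x' : E) (c : E) (q : Polynomial E) :
    dd x x' (Polynomial.C c * q) = c * dd x x' q := by
  rw [dd_mul, dd_C]; simp

theorem dd_sub_mul (x x' : E) (q : Polynomial E) :
    (x - x') * dd x x' q = q.eval x - q.eval x' := by
  induction q using Polynomial.induction_on' with
  | add q1 q2 h1 h2 => rw [dd_add, mul_add, h1, h2]; simp; ring
  | monomial n a => rw [dd_monomial, mul_left_comm, tt_sub]; simp; ring

theorem dd_diag (x : E) (q : Polynomial E) : dd x x q = (Polynomial.derivative q).eval x := by
  induction q using Polynomial.induction_on' with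
  | add q1 q2 h1 h2 => rw [dd_add, h1, h2]; simp
  | monomial n a =>
    rw [dd_monomial, Polynomial.derivative_monomial]
    cases n with
    | zero => simp [tt]
    | succ n => rw [tt_diag]; simp; ring

variable [Algebra ℝ E]

/-- divided difference of a real polynomial -/
noncomputable def ddr (x x' : E) (q : Polynomial ℝ) : E := dd x x' (q.map (algebraMap ℝ E))

theorem ddr_eq (x x' : E) (q : Polynomial ℝ) (n : ℕ) (hq : q.natDegree ≤ n) :
    ddr x x' q = ∑ i ∈ Finset.range n, ∑ i' ∈ Finset.range n,
      q.coeff (i + i' + 1) • (x ^ i * x' ^ i') := by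
  have h1 : ddr x x' q = ∑ k ∈ Finset.range n,
      ∑ i ∈ Finset.range (k + 1), q.coeff (i + (k - i) + 1) • (x ^ i * x' ^ (k - i)) := by
    unfold ddr dd
    rw [Polynomial.sum_over_range' _ _ (n + 1)]
    · rw [Finset.sum_range_succ']
      simp only [tt, mul_zero, add_zero]
      apply Finset.sum_congr rfl
      intro k _
      have := tt_sum x x' k
      rw [tt] at this
      rw [this, Finset.mul_sum]
      apply Finset.sum_congr rfl
      intro i hi
      have e : i + (k - i) = k := by simp at hi; omega
      rw [e, Polynomial.coeff_map, Algebra.smul_def]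
    · exact Nat.lt_succ_of_le (Polynomial.natDegree_map_le.trans hq)
    · intro k; simp
  rw [h1, Finset.sum_range_diag_flip n (fun i i' => q.coeff (i + i' + 1) • (x ^ i * x' ^ i'))]
  apply Finset.sum_congr rfl
  intro i hi
  apply Finset.sum_subset
  · intro j hj; simp at hj ⊢; omega
  · intro j hj hj'
    rw [Polynomial.coeff_eq_zero_of_natDegree_lt, zero_smul]
    simp at hj hj'; omega

theorem ddr_sub_mul (x x' : E) (q : Polynomial ℝ) :
    (x - x') * ddr x x' q = Polynomial.aeval x q - Polynomial.aeval x' q := by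
  unfold ddr
  rw [dd_sub_mul, Polynomial.eval_map_algebraMap, Polynomial.eval_map_algebraMap]

theorem ddr_diag (x : E) (q : Polynomial ℝ) :
    ddr x x q = Polynomial.aeval x (Polynomial.derivative q) := by
  unfold ddr
  rw [dd_diag, Polynomial.derivative_map, Polynomial.eval_map_algebraMap]

end dd

theorem bzP_diag {R : Type*} [CommRing R] [NoZeroDivisors R] [CharZero R]
    (m : ℕ) (U V : Polynomial R) (hU : U.natDegree ≤ m) (hV : V.natDegree ≤ m) :
    ∑ j ∈ Finset.range m, Polynomial.X ^ j * bzP m U V j =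
      Polynomial.derivative U * V - Polynomial.derivative V * U := by
  choose p q h1 h2 h3 using bzP_mem m U V hU hV
  have aux : ∀ (W : Polynomial R) (r : ℕ → Polynomial R), W.natDegree ≤ m →
      (∀ j n, (r j).coeff n = W.coeff (j + 1 + n)) →
      ∑ j ∈ Finset.range m, Polynomial.X ^ j * r j = Polynomial.derivative W := by
    intro W r hW hr
    ext k
    simp only [Polynomial.finsetSum_coeff, Polynomial.coeff_X_pow_mul', hr,
      Polynomial.coeff_derivative]
    by_cases hk : k < m
    · rw [← Finset.sum_filter]
      have : (Finset.range m).filter (fun j => j ≤ k) = Finset.range (k + 1) := by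
        ext j; simp; omega
      rw [this]
      rw [Finset.sum_congr rfl (g := fun _ => W.coeff (k + 1))]
      · simp; ring
      · intro j hj
        congr 1
        simp at hj; omega
    · rw [Polynomial.coeff_eq_zero_of_natDegree_lt (p := W) (by omega), zero_mul]
      apply Finset.sum_eq_zero
      intro j hj
      split_ifs with h
      · apply Polynomial.coeff_eq_zero_of_natDegree_lt
        omega
      · rfl
  have e1 := aux U q hU h3
  have e2 := aux V (fun j => - p j) hV (by intro j n; simp [h2])
  rw [← e1, ← e2, Finset.sum_mul, Finset.sum_mul, ← Finset.sum_sub_distrib]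
  apply Finset.sum_congr rfl
  intro j _
  rw [h1]; ring

/-! ### The Bezoutian kernel -/
section kernel
variable {p m : ℕ} {U V : BP} (H : BoxHyp p m U V)
variable {E : Type*} [CommRing E] [Algebra ℝ E]

/-- coefficients of the kernel -/
noncomputable def KB (U V : BP) (i j i' j' : ℕ) : ℝ := (MM U V j j').coeff (i + i' + 1)

noncomputable def Del (m : ℕ) (U V : BP) (x y x' y' : E) : E :=
  ∑ j ∈ Finset.range m, ∑ j' ∈ Finset.range m, ddr x x' (MM U V j j') * (y ^ j * y' ^ j')

theorem KB_symm (i j i' j' : ℕ) : KB U V i j i' j' = KB U V i' j' i j := by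
  unfold KB MM
  rw [bz_symm, add_comm i i']

include H

theorem KB_zero (i j i' j' : ℕ) (h : 2 * p ≤ i + i') : KB U V i j i' j' = 0 := by
  unfold KB
  apply Polynomial.coeff_eq_zero_of_natDegree_lt
  have := MM_natDegree H.hU H.hV j j'
  omega

theorem Del_eq (x y x' y' : E) : Del m U V x y x' y' =
    ∑ j ∈ Finset.range m, ∑ j' ∈ Finset.range m,
      ∑ i ∈ Finset.range (2 * p), ∑ i' ∈ Finset.range (2 * p),
        KB U V i j i' j' • ((x ^ i * y ^ j) * (x' ^ i' * y' ^ j')) := by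
  unfold Del
  apply Finset.sum_congr rfl; intro j _
  apply Finset.sum_congr rfl; intro j' _
  rw [ddr_eq x x' _ (2 * p) (MM_natDegree H.hU H.hV j j'), Finset.sum_mul]
  apply Finset.sum_congr rfl; intro i _
  rw [Finset.sum_mul]
  apply Finset.sum_congr rfl; intro i' _
  rw [KB, Algebra.smul_mul_assoc]
  congr 1; ring

theorem Bez_eval_zero (x y y' : E) (hU : ev x y U = 0) (hV : ev x y V = 0) :
    ∑ j ∈ Finset.range m, ∑ j' ∈ Finset.range m,
      Polynomial.aeval x (MM U V j j') * (y ^ j * y' ^ j') = 0 := by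
  rw [Finset.sum_comm]
  apply Finset.sum_eq_zero
  intro j' _
  have h1 : ev x y (bzP m V U j') = 0 := by
    obtain ⟨r, s, hrs⟩ := Ideal.mem_span_pair.mp (BB_mem H j')
    rw [← hrs]; simp [hU, hV]
  have h2 : ev x y (bzP m V U j') = ∑ j ∈ Finset.range m, Polynomial.aeval x (MM U V j' j) * y ^ j := by
    unfold bzP
    rw [map_sum]
    apply Finset.sum_congr rfl
    intro j _
    simp [ev_eq, MM]
  rw [h2] at h1
  have : ∀ j ∈ Finset.range m, Polynomial.aeval x (MM U V j j') * (y ^ j * y' ^ j') =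
    (Polynomial.aeval x (MM U V j' j) * y ^ j) * y' ^ j' := by
    intro j _
    have : MM U V j j' = MM U V j' j := by unfold MM; rw [bz_symm]
    rw [this]; ring
  rw [Finset.sum_congr rfl this, ← Finset.sum_mul, h1, zero_mul]

theorem Del_x (x y x' y' : E) (hU : ev x y U = 0) (hV : ev x y V = 0)
    (hU' : ev x' y' U = 0) (hV' : ev x' y' V = 0) :
    (x - x') * Del m U V x y x' y' = 0 := by
  have h1 := Bez_eval_zero H x y y' hU hV
  have h2 := Bez_eval_zero H x' y' y hU' hV'
  have h3 : ∑ j ∈ Finset.range m, ∑ j' ∈ Finset.range m,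
      Polynomial.aeval x' (MM U V j j') * (y ^ j * y' ^ j') = 0 := by
    rw [← h2, Finset.sum_comm]
    apply Finset.sum_congr rfl; intro j _
    apply Finset.sum_congr rfl; intro j' _
    have : MM U V j j' = MM U V j' j := by unfold MM; rw [bz_symm]
    rw [this]; ring
  unfold Del
  simp only [Finset.mul_sum]
  rw [← sub_zero (0 : E)]
  nth_rewrite 1 [← h1]
  rw [← h3, ← Finset.sum_sub_distrib]
  apply Finset.sum_congr rfl; intro j _
  rw [← Finset.sum_sub_distrib]
  apply Finset.sum_congr rfl; intro j' _
  rw [← mul_assoc, ddr_sub_mul]; ring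

theorem Del_y (x y x' y' : E) (hU : ev x y U = 0) (hV : ev x y V = 0)
    (hU' : ev x' y' U = 0) (hV' : ev x' y' V = 0) :
    (y - y') * Del m U V x y x' y' = 0 := by
  let φ : Polynomial ℝ →+* Polynomial E := Polynomial.mapRingHom (algebraMap ℝ E)
  have key := bzP_eval₂ φ m V U (BD_natDegree H.hV) (BD_natDegree H.hU)
    (Polynomial.C y) (Polynomial.C y')
  have hev : ∀ (x y : E) (g : BP), (g.eval₂ φ (Polynomial.C y)).eval x = ev x y g := by
    intro x y g
    have := Polynomial.hom_eval₂ g φ (Polynomial.evalRingHom x) (Polynomial.C y)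
    rw [Polynomial.coe_evalRingHom] at this
    rw [this, ev_eq]
    simp only [Polynomial.eval_C]
    congr 1
    ext q
    · simp [φ]
    · simp [φ]
  have h2 := congrArg (dd x x') key
  have hsub : ∀ q r, dd x x' (q - r) = dd x x' q - dd x x' r := fun q r => map_sub (ddA x x') q r
  rw [hsub, ← Polynomial.C_sub, dd_C_mul] at h2
  rw [mul_comm (U.eval₂ φ (Polynomial.C y')), mul_comm (V.eval₂ φ (Polynomial.C y')),
    dd_mul, dd_mul, hev, hev, hev, hev, hU, hV, hU', hV'] at h2
  simp only [zero_mul, add_zero, sub_zero] at h2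
  rw [← h2]
  congr 1
  have hsum : ∀ (s : Finset ℕ) (f : ℕ → Polynomial E), dd x x' (∑ i ∈ s, f i) = ∑ i ∈ s, dd x x' (f i) :=
    fun s f => map_sum (ddA x x') f s
  rw [hsum]
  unfold Del
  rw [Finset.sum_comm]
  apply Finset.sum_congr rfl; intro j' _
  rw [bzP, Polynomial.eval₂_finsetSum, Finset.sum_mul, hsum]
  apply Finset.sum_congr rfl; intro j _
  rw [Polynomial.eval₂_monomial]
  have e : φ (bz V.coeff U.coeff j' j) * Polynomial.C y ^ j * Polynomial.C y' ^ j' =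
      Polynomial.C (y ^ j * y' ^ j') * φ (bz V.coeff U.coeff j' j) := by
    simp; ring
  rw [e, dd_C_mul, mul_comm]
  have : MM U V j j' = bz V.coeff U.coeff j' j := by unfold MM; rw [bz_symm]
  rw [this]; rfl

theorem Del_diag (x y : E) (hU : ev x y U = 0) (hV : ev x y V = 0) :
    Del m U V x y x y =
      ev x y (dX U) * ev x y (dY V) - ev x y (dY U) * ev x y (dX V) := by
  have h1 := congrArg dX (bzP_diag m V U (BD_natDegree H.hV) (BD_natDegree H.hU))
  rw [dX_sub, dX_mul, dX_mul] at h1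
  have h2 := congrArg (ev x y) h1
  simp only [map_sub, map_add, map_mul, hU, hV] at h2
  have e : ev x y (dX U) * ev x y (dY V) - ev x y (dY U) * ev x y (dX V) =
     ev x y (dX (∑ j ∈ Finset.range m, Polynomial.X ^ j * bzP m V U j)) := by
    rw [h2]; unfold dY; ring
  rw [e]
  unfold Del
  have hs : dX (∑ j ∈ Finset.range m, Polynomial.X ^ j * bzP m V U j) =
     ∑ j ∈ Finset.range m, ∑ j' ∈ Finset.range m,
       Polynomial.monomial (j + j') (Polynomial.derivative (MM U V j j')) := by
    apply Polynomial.ext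
    intro l
    rw [dX_coeff]
    simp only [Polynomial.finsetSum_coeff, map_sum]
    apply Finset.sum_congr rfl; intro j _
    rw [bzP, Finset.mul_sum]
    simp only [Polynomial.finsetSum_coeff, map_sum]
    apply Finset.sum_congr rfl; intro j' _
    rw [← Polynomial.monomial_one_right_eq_X_pow, Polynomial.monomial_mul_monomial,
      Polynomial.coeff_monomial, Polynomial.coeff_monomial, one_mul]
    split_ifs
    · rfl
    · simp
  rw [hs, map_sum]
  apply Finset.sum_congr rfl; intro j _
  rw [map_sum]
  apply Finset.sum_congr rfl; intro j' _
  rw [ddr_diag, ev_eq, Polynomial.eval₂_monomial, pow_add]; rfl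

end kernel

open scoped TensorProduct

section tri
variable {p m : ℕ} {U V : BP} (H : BoxHyp p m U V)
include H

theorem KB_tri (n : ℕ) (τ : ℕ → ℕ → ℝ)
    (h : ∀ i j, n ≤ i → i < 2 * p → j < m →
      ∑ j' ∈ Finset.range m, ∑ i' ∈ Finset.range (2 * p), KB U V i j i' j' * τ i' j' = 0) :
    ∀ i' j', i' + n < 2 * p → j' < m → τ i' j' = 0 := by
  intro i'
  induction i' using Nat.strong_induction_on with
  | _ i' ih =>
    intro j' hi' hj'
    refine box_inj H (fun j' => τ i' j') ?_ j' hj'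
    intro l hl
    have := h (2 * p - 1 - i') l (by omega) (by omega) hl
    rw [← this]
    apply Finset.sum_congr rfl
    intro j hj
    rw [Finset.sum_eq_single i']
    · unfold KB
      have e : 2 * p - 1 - i' + i' + 1 = 2 * p := by omega
      have e2 : MM U V l j = MM U V j l := by unfold MM; rw [bz_symm]
      rw [e, e2, mul_comm]
    · intro i'' hi'' hne
      rcases lt_or_gt_of_ne hne with hlt | hgt
      · rw [ih i'' hlt j (by omega) (by simpa using hj), mul_zero]
      · rw [KB_zero H _ _ _ _ (by omega), zero_mul]
    · intro hh; simp at hh; omega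

end tri

/-- the quotient algebra data -/
structure QuotData (U V : BP) (A : Type*) [CommRing A] [Algebra ℝ A] where
  π : BP →ₐ[ℝ] A
  surj : Function.Surjective π
  ker : ∀ g, π g = 0 ↔ g ∈ Ideal.span {U, V}

section quot
variable {p m : ℕ} {U V : BP} (H : BoxHyp p m U V)
variable {A : Type*} [CommRing A] [Algebra ℝ A] (Q : QuotData U V A)

/-- the class of `x` -/
noncomputable def QuotData.x : A := Q.π (Polynomial.C Polynomial.X)
/-- the class of `y` -/
noncomputable def QuotData.y : A := Q.π Polynomial.X

theorem QuotData.pi_eq (g : BP) : Q.π g = ev Q.x Q.y g := by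
  have := algHom_eq_ev Q.π
  exact congrArg (fun φ : BP →ₐ[ℝ] A => φ g) this

theorem QuotData.pi_mon (k l : ℕ) : Q.π (mon k l) = Q.x ^ k * Q.y ^ l := by
  rw [Q.pi_eq, ev_mon]

theorem QuotData.U0 : ev Q.x Q.y U = 0 := by
  rw [← Q.pi_eq, Q.ker]; exact Ideal.subset_span (by simp)

theorem QuotData.V0 : ev Q.x Q.y V = 0 := by
  rw [← Q.pi_eq, Q.ker]; exact Ideal.subset_span (by simp)

theorem QuotData.chi (χ : A →ₐ[ℝ] ℂ) (g : BP) : χ (Q.π g) = ev (χ Q.x) (χ Q.y) g := by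
  rw [Q.pi_eq, ev_comp]

/-- points give characters -/
theorem QuotData.exists_chi {E : Type*} [CommRing E] [Algebra ℝ E] (x y : E)
    (hU : ev x y U = 0) (hV : ev x y V = 0) :
    ∃ χ : A →ₐ[ℝ] E, χ Q.x = x ∧ χ Q.y = y := by
  have hk : RingHom.ker Q.π ≤ RingHom.ker (ev x y) := by
    intro g hg
    rw [RingHom.mem_ker] at hg ⊢
    obtain ⟨a, b, rfl⟩ := Ideal.mem_span_pair.mp ((Q.ker g).mp hg)
    simp [hU, hV]
  let χ := AlgHom.liftOfSurjective Q.π Q.surj (ev x y) hk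
  have hχ : ∀ g, χ (Q.π g) = ev x y g := fun g =>
    AlgHom.liftOfSurjective_apply Q.π Q.surj (ev x y) hk g
  refine ⟨χ, ?_, ?_⟩
  · rw [QuotData.x, hχ, ev_X]
  · rw [QuotData.y, hχ, ev_Y]

include H in
theorem QuotData.box_bij : Function.Bijective
    (Q.π.toLinearMap ∘ₗ (BD (2 * p - 1) (m - 1)).subtype) := by
  constructor
  · intro g h hgh
    have h1 : Q.π g.1 = Q.π h.1 := hgh
    have h2 : Q.π (g.1 - h.1) = 0 := by rw [map_sub, h1, sub_self]
    have := box_indep H (g.1 - h.1) ((Q.ker _).mp h2) (Submodule.sub_mem _ g.2 h.2)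
    exact Subtype.ext (sub_eq_zero.mp this)
  · intro a
    obtain ⟨g, rfl⟩ := Q.surj a
    obtain ⟨h, hh, hI⟩ := box_span H g
    refine ⟨⟨h, hh⟩, ?_⟩
    have := (Q.ker _).mpr hI
    rw [map_sub, sub_eq_zero] at this
    exact this.symm

/-- the box equivalence -/
noncomputable def QuotData.box : BD (2 * p - 1) (m - 1) ≃ₗ[ℝ] A :=
  LinearEquiv.ofBijective (Q.π.toLinearMap ∘ₗ (BD (2 * p - 1) (m - 1)).subtype) (Q.box_bij H)

include H Q in
theorem QuotData.finite : Module.Finite ℝ A := Module.Finite.equiv (Q.box H)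

include H Q in
theorem QuotData.finrank : Module.finrank ℝ A = 2 * p * m := by
  rw [← (Q.box H).finrank_eq, BD_finrank]
  have := H.hp
  have := H.hm
  congr 1 <;> omega

include H in
theorem QuotData.indep (c : ℕ → ℕ → ℝ)
    (h : ∑ j ∈ Finset.range m, ∑ i ∈ Finset.range (2 * p), c i j • (Q.x ^ i * Q.y ^ j) = 0) :
    ∀ i j, i < 2 * p → j < m → c i j = 0 := by
  intro i j hi hj
  set g : BP := ∑ j ∈ Finset.range m, ∑ i ∈ Finset.range (2 * p), c i j • mon i j with hg
  have h0 : Q.π g = 0 := by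
    rw [hg, map_sum]
    simp only [map_sum, map_smul, Q.pi_mon]
    exact h
  have hgB : g ∈ BD (2 * p - 1) (m - 1) := by
    apply Submodule.sum_mem; intro j hj
    apply Submodule.sum_mem; intro i hi
    apply Submodule.smul_mem
    simp at hi hj
    exact BD_mono (by omega) (by omega) (mon_mem_BD i j)
  have g0 := box_indep H g ((Q.ker _).mp h0) hgB
  have h1 : (g.coeff j).coeff i = c i j := by
    rw [hg]
    simp only [Polynomial.finsetSum_coeff, Polynomial.coeff_smul, mon_coeff, smul_eq_mul]
    rw [Finset.sum_eq_single j, Finset.sum_eq_single i]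
    · simp
    · intro b _ hb; simp [hb]
    · intro hk; simp at hk; omega
    · intro b _ hb; simp [hb]
    · intro hk; simp at hk; omega
  rw [← h1, g0]; simp

include H in
theorem QuotData.ext_fun (μ : A →ₗ[ℝ] ℝ)
    (h : ∀ i j, i < 2 * p → j < m → μ (Q.x ^ i * Q.y ^ j) = 0) : μ = 0 := by
  have hp := H.hp
  have hm := H.hm
  ext a
  obtain ⟨g, rfl⟩ := (Q.box H).surjective a
  have := BD_lin g.2 (μ ∘ₗ Q.π.toLinearMap) (by
    intro k l hk hl
    simp only [LinearMap.comp_apply, AlgHom.toLinearMap_apply, Q.pi_mon]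
    exact h k l (by omega) (by omega))
  exact this

/-- the Bezoutian map from functionals to the algebra -/
noncomputable def QuotData.bet (p m : ℕ) : (A →ₗ[ℝ] ℝ) →ₗ[ℝ] A where
  toFun μ := ∑ j ∈ Finset.range m, ∑ i ∈ Finset.range (2 * p),
    (∑ j' ∈ Finset.range m, ∑ i' ∈ Finset.range (2 * p),
      KB U V i j i' j' * μ (Q.x ^ i' * Q.y ^ j')) • (Q.x ^ i * Q.y ^ j)
  map_add' := by
    intro μ ν
    simp only [LinearMap.add_apply, mul_add, Finset.sum_add_distrib, add_smul]
  map_smul' := by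
    intro c μ
    simp only [LinearMap.smul_apply, smul_eq_mul, RingHom.id_apply, Finset.smul_sum, smul_smul,
      Finset.mul_sum, mul_left_comm]

theorem QuotData.bet_apply (μ : A →ₗ[ℝ] ℝ) : Q.bet p m μ =
    ∑ j ∈ Finset.range m, ∑ i ∈ Finset.range (2 * p),
    (∑ j' ∈ Finset.range m, ∑ i' ∈ Finset.range (2 * p),
      KB U V i j i' j' * μ (Q.x ^ i' * Q.y ^ j')) • (Q.x ^ i * Q.y ^ j) := rfl

include H in
theorem QuotData.bet_mul (μ : A →ₗ[ℝ] ℝ) (a : A) :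
    Q.bet p m (μ ∘ₗ LinearMap.mulLeft ℝ a) = a * Q.bet p m μ := by
  let x1 : A ⊗[ℝ] A := Q.x ⊗ₜ 1
  let y1 : A ⊗[ℝ] A := Q.y ⊗ₜ 1
  let x2 : A ⊗[ℝ] A := 1 ⊗ₜ Q.x
  let y2 : A ⊗[ℝ] A := 1 ⊗ₜ Q.y
  have e1 : ∀ g, ev x1 y1 g = (Q.π g) ⊗ₜ 1 := by
    intro g
    have := ev_comp (Algebra.TensorProduct.includeLeft : A →ₐ[ℝ] A ⊗[ℝ] A) Q.x Q.y g
    rw [← Q.pi_eq] at this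
    exact this.symm
  have e2 : ∀ g, ev x2 y2 g = 1 ⊗ₜ (Q.π g) := by
    intro g
    have := ev_comp (Algebra.TensorProduct.includeRight : A →ₐ[ℝ] A ⊗[ℝ] A) Q.x Q.y g
    rw [← Q.pi_eq] at this
    exact this.symm
  set D := Del m U V x1 y1 x2 y2 with hD
  have hU0 : Q.π U = 0 := by rw [Q.pi_eq, Q.U0]
  have hV0 : Q.π V = 0 := by rw [Q.pi_eq, Q.V0]
  have hx : (x1 - x2) * D = 0 := Del_x H x1 y1 x2 y2 (by rw [e1, hU0, TensorProduct.zero_tmul])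
    (by rw [e1, hV0, TensorProduct.zero_tmul]) (by rw [e2, hU0, TensorProduct.tmul_zero])
    (by rw [e2, hV0, TensorProduct.tmul_zero])
  have hy : (y1 - y2) * D = 0 := Del_y H x1 y1 x2 y2 (by rw [e1, hU0, TensorProduct.zero_tmul])
    (by rw [e1, hV0, TensorProduct.zero_tmul]) (by rw [e2, hU0, TensorProduct.tmul_zero])
    (by rw [e2, hV0, TensorProduct.tmul_zero])
  have hall : (a ⊗ₜ 1 - 1 ⊗ₜ a : A ⊗[ℝ] A) * D = 0 := by
    obtain ⟨g, rfl⟩ := Q.surj a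
    rw [← e1, ← e2]
    let I : Ideal (A ⊗[ℝ] A) := (Submodule.span (A ⊗[ℝ] A) {D}).annihilator
    have hI : ∀ e, e ∈ I ↔ e * D = 0 := by
      intro e
      rw [Submodule.mem_annihilator_span_singleton, smul_eq_mul]
    rw [← hI, ← Ideal.Quotient.eq]
    have h1 := ev_comp (Ideal.Quotient.mkₐ ℝ I) x1 y1 g
    have h2 := ev_comp (Ideal.Quotient.mkₐ ℝ I) x2 y2 g
    have hx' : Ideal.Quotient.mkₐ ℝ I x1 = Ideal.Quotient.mkₐ ℝ I x2 :=
      Ideal.Quotient.eq.mpr ((hI _).mpr hx)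
    have hy' : Ideal.Quotient.mkₐ ℝ I y1 = Ideal.Quotient.mkₐ ℝ I y2 :=
      Ideal.Quotient.eq.mpr ((hI _).mpr hy)
    rw [hx', hy', ← h2] at h1
    exact h1
  let Φ : A ⊗[ℝ] A →ₗ[ℝ] A := TensorProduct.lift
    ((LinearMap.lsmul ℝ A).flip.compr₂ LinearMap.id |>.compl₂ μ)
  have hΦ : ∀ c d : A, Φ (c ⊗ₜ d) = μ d • c := by
    intro c d
    simp [Φ]
  have hΦD : ∀ c d : A, Φ ((c ⊗ₜ d) * D) = c * Q.bet p m (μ ∘ₗ LinearMap.mulLeft ℝ d) := by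
    intro c d
    rw [hD, Del_eq H, Q.bet_apply]
    simp only [Finset.mul_sum, Finset.sum_smul, map_sum]
    apply Finset.sum_congr rfl; intro j _
    rw [Finset.sum_comm]
    apply Finset.sum_congr rfl; intro i _
    apply Finset.sum_congr rfl; intro j' _
    apply Finset.sum_congr rfl; intro i' _
    have : (c ⊗ₜ d : A ⊗[ℝ] A) * (KB U V i j i' j' • ((x1 ^ i * y1 ^ j) * (x2 ^ i' * y2 ^ j'))) =
        KB U V i j i' j' • ((c * (Q.x ^ i * Q.y ^ j)) ⊗ₜ (d * (Q.x ^ i' * Q.y ^ j'))) := by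
      simp only [x1, x2, y1, y2, Algebra.TensorProduct.tmul_pow, one_pow,
        Algebra.TensorProduct.tmul_mul_tmul, one_mul, mul_one, mul_smul_comm]
    rw [this, map_smul, hΦ, smul_smul, mul_smul_comm]
    rfl
  have := congrArg Φ hall
  rw [sub_mul, map_sub, hΦD, hΦD, map_zero, sub_eq_zero] at this
  rw [one_mul] at this
  rw [← this]
  congr 2
  ext b; simp

include H in
theorem QuotData.bet_inj : Function.Injective (Q.bet p m) := by
  rw [← LinearMap.ker_eq_bot, LinearMap.ker_eq_bot']
  intro μ hμ
  rw [Q.bet_apply] at hμ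
  have h1 := Q.indep H (fun i j => (∑ j' ∈ Finset.range m, ∑ i' ∈ Finset.range (2 * p),
      KB U V i j i' j' * μ (Q.x ^ i' * Q.y ^ j'))) hμ
  have h2 := KB_tri H 0 (fun i' j' => μ (Q.x ^ i' * Q.y ^ j')) (fun i j _ hi hj => h1 i j hi hj)
  exact Q.ext_fun H μ (fun i j hi hj => h2 i j (by omega) hj)

include H in
theorem QuotData.exists_T : ∃ T : A →ₗ[ℝ] ℝ,
    (∀ a, (∀ b, T (a * b) = 0) → a = 0) ∧
    (∀ k l, k ≤ 2 * p - 2 → l ≤ 2 * m - 2 → T (Q.π (mon k l)) = 0) ∧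
    (∀ χ : A →ₐ[ℝ] ℂ, ∃ c1 c2 : A, (∀ a, T (c1 * a) = (χ a).re) ∧ (∀ a, T (c2 * a) = (χ a).im) ∧
      χ c1 + Complex.I * χ c2 =
        ev (χ Q.x) (χ Q.y) (dX U) * ev (χ Q.x) (χ Q.y) (dY V)
          - ev (χ Q.x) (χ Q.y) (dY U) * ev (χ Q.x) (χ Q.y) (dX V)) := by
  have hp := H.hp
  have hm := H.hm
  haveI := Q.finite H
  have hinj := Q.bet_inj H
  have hsurj : Function.Surjective (Q.bet p m) := by
    rw [← LinearMap.injective_iff_surjective_of_finrank_eq_finrank]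
    · exact hinj
    · exact Subspace.dual_finrank_eq
  obtain ⟨T, hT⟩ := hsurj 1
  have haT : ∀ a, Q.bet p m (T ∘ₗ LinearMap.mulLeft ℝ a) = a := by
    intro a; rw [Q.bet_mul H, hT, mul_one]
  have hβ : ∀ μ a, T (Q.bet p m μ * a) = μ a := by
    intro μ a
    have := hinj (haT (Q.bet p m μ))
    exact congrArg (fun ν : A →ₗ[ℝ] ℝ => ν a) this
  refine ⟨T, ?_, ?_, ?_⟩
  · intro a ha
    rw [← haT a]
    have : T ∘ₗ LinearMap.mulLeft ℝ a = 0 := by ext b; simpa using ha b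
    rw [this, map_zero]
  · intro k l hk hl
    obtain ⟨j0, j1, hj0, hj1, rfl⟩ : ∃ j0 j1, j0 < m ∧ j1 < m ∧ l = j0 + j1 :=
      ⟨min l (m - 1), l - min l (m - 1), by omega, by omega, by omega⟩
    have h1 := haT (Q.y ^ j0)
    rw [Q.bet_apply] at h1
    set μ := T ∘ₗ LinearMap.mulLeft ℝ (Q.y ^ j0) with hμ
    have h2 := Q.indep H (fun i j => (∑ j' ∈ Finset.range m, ∑ i' ∈ Finset.range (2 * p),
      KB U V i j i' j' * μ (Q.x ^ i' * Q.y ^ j')) - if i = 0 ∧ j = j0 then 1 else 0) (by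
        simp only [sub_smul, Finset.sum_sub_distrib]
        rw [h1]
        rw [Finset.sum_eq_single j0, Finset.sum_eq_single 0]
        · simp
        · intro b _ hb; simp [hb]
        · intro hh; simp at hh; omega
        · intro b _ hb; simp [hb]
        · intro hh; simp at hh; omega)
    have h3 := KB_tri H 1 (fun i' j' => μ (Q.x ^ i' * Q.y ^ j')) (fun i j hi1 hi hj => by
      have := h2 i j hi hj
      rw [if_neg (by omega), sub_zero] at this
      exact this) k j1 (by omega) hj1
    rw [Q.pi_mon, ← h3, hμ]
    simp only [LinearMap.comp_apply, LinearMap.mulLeft_apply]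
    congr 1; ring
  · intro χ
    let μ1 : A →ₗ[ℝ] ℝ := Complex.reLm ∘ₗ χ.toLinearMap
    let μ2 : A →ₗ[ℝ] ℝ := Complex.imLm ∘ₗ χ.toLinearMap
    refine ⟨Q.bet p m μ1, Q.bet p m μ2, hβ μ1, hβ μ2, ?_⟩
    have hU0 : ev (χ Q.x) (χ Q.y) U = 0 := by rw [← ev_comp, Q.U0, map_zero]
    have hV0 : ev (χ Q.x) (χ Q.y) V = 0 := by rw [← ev_comp, Q.V0, map_zero]
    rw [← Del_diag H (χ Q.x) (χ Q.y) hU0 hV0, Del_eq H, Q.bet_apply, Q.bet_apply]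
    simp only [map_sum, map_smul, Finset.mul_sum]
    rw [← Finset.sum_add_distrib]
    apply Finset.sum_congr rfl; intro j _
    rw [Finset.sum_comm, ← Finset.sum_add_distrib]
    apply Finset.sum_congr rfl; intro i _
    simp only [Finset.sum_smul, Finset.mul_sum]
    rw [← Finset.sum_add_distrib]
    apply Finset.sum_congr rfl; intro j' _
    rw [← Finset.sum_add_distrib]
    apply Finset.sum_congr rfl; intro i' _
    have e1 : μ1 (Q.x ^ i' * Q.y ^ j') = (χ Q.x ^ i' * χ Q.y ^ j').re := by simp [μ1]
    have e2 : μ2 (Q.x ^ i' * Q.y ^ j') = (χ Q.x ^ i' * χ Q.y ^ j').im := by simp [μ2]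
    rw [e1, e2]
    set z := χ Q.x ^ i' * χ Q.y ^ j'
    rw [map_mul, map_pow, map_pow]
    simp only [Complex.real_smul]
    conv_rhs => rw [← Complex.re_add_im z]
    push_cast
    ring

end quot


theorem psd_isotropic {β γ : ℝ} (hγ : 0 ≤ γ) (h : ∀ t : ℝ, 0 ≤ 2 * t * β + t ^ 2 * γ) : β = 0 := by
  have h1 := h (-β / (1 + γ))
  have hpos : 0 < 1 + γ := by linarith
  have h2 : (2 * (-β / (1 + γ)) * β + (-β / (1 + γ)) ^ 2 * γ) * (1 + γ) ^ 2 =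
      -β ^ 2 * (2 + γ) := by
    field_simp; ring
  have h3 : 0 ≤ -β ^ 2 * (2 + γ) := by rw [← h2]; positivity
  nlinarith [sq_nonneg β]

theorem lagrangian_bound {W : Type*} [AddCommGroup W] [Module ℝ W] [FiniteDimensional ℝ W]
    (B : LinearMap.BilinForm ℝ W) (hs : ∀ u v, B u v = B v u)
    (hnd : B.Nondegenerate) (L M : Submodule ℝ W)
    (hL : ∀ u ∈ L, ∀ v ∈ L, B u v = 0) (hdim : 2 * Module.finrank ℝ L = Module.finrank ℝ W)
    (hM : ∀ u ∈ M, 0 ≤ B u u) : Module.finrank ℝ M ≤ Module.finrank ℝ L := by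
  have hM0 : ∀ u ∈ M, B u u = 0 → u ∈ M ⊓ B.orthogonal M := by
    intro u hu h0
    refine ⟨hu, ?_⟩
    rw [SetLike.mem_coe, LinearMap.BilinForm.mem_orthogonal_iff]
    intro v hv
    apply psd_isotropic (hM v hv)
    intro t
    have := hM (u + t • v) (M.add_mem hu (M.smul_mem t hv))
    simp only [map_add, LinearMap.add_apply, map_smul, LinearMap.smul_apply, smul_eq_mul, h0,
      hs u v] at this
    linarith
  set M0 := M ⊓ B.orthogonal M with hM0d
  set K := L ⊓ B.orthogonal M0 with hK
  have hLL : B.orthogonal L = L := by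
    symm
    apply Submodule.eq_of_le_of_finrank_eq
    · intro u hu
      rw [LinearMap.BilinForm.mem_orthogonal_iff]
      exact fun v hv => hL v hv u hu
    · rw [LinearMap.BilinForm.finrank_orthogonal hnd]; omega
  have h1 : M ⊓ K ≤ L ⊓ M0 := by
    rintro u ⟨hu, hu2, _⟩
    exact ⟨hu2, hM0 u hu (hL u hu2 u hu2)⟩
  have h2 : M ⊔ K ≤ B.orthogonal M0 := by
    apply sup_le
    · intro u hu
      rw [LinearMap.BilinForm.mem_orthogonal_iff]
      rintro v ⟨_, hv⟩
      rw [SetLike.mem_coe, LinearMap.BilinForm.mem_orthogonal_iff] at hv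
      rw [hs]; exact hv u hu
    · exact inf_le_right
  have h3 : B.orthogonal (L ⊔ M0) ≤ K := by
    intro u hu
    rw [LinearMap.BilinForm.mem_orthogonal_iff] at hu
    constructor
    · rw [← hLL, SetLike.mem_coe, LinearMap.BilinForm.mem_orthogonal_iff]
      exact fun v hv => hu v (Submodule.mem_sup_left hv)
    · rw [SetLike.mem_coe, LinearMap.BilinForm.mem_orthogonal_iff]
      exact fun v hv => hu v (Submodule.mem_sup_right hv)
  have e1 := Submodule.finrank_mono h1
  have e2 := Submodule.finrank_mono h2
  have e3 := Submodule.finrank_mono h3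
  rw [LinearMap.BilinForm.finrank_orthogonal hnd] at e2 e3
  have e4 := Submodule.finrank_sup_add_finrank_inf_eq M K
  have e5 := Submodule.finrank_sup_add_finrank_inf_eq L M0
  have e6 := Submodule.finrank_le M0
  have e7 := Submodule.finrank_le (L ⊔ M0)
  omega

section finalg
variable {A : Type*} [CommRing A] [Algebra ℝ A] [Module.Finite ℝ A]

theorem exists_char (I : Ideal A) (hI : I ≠ ⊤) : ∃ χ : A →ₐ[ℝ] ℂ, ∀ a ∈ I, χ a = 0 := by
  obtain ⟨P, hP, hIP⟩ := Ideal.exists_le_maximal I hI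
  let _ := Ideal.Quotient.field P
  let χ : (A ⧸ P) →ₐ[ℝ] ℂ := IsAlgClosed.lift
  refine ⟨χ.comp (Ideal.Quotient.mkₐ ℝ P), fun a ha => ?_⟩
  have : Ideal.Quotient.mkₐ ℝ P a = 0 := Ideal.Quotient.eq_zero_iff_mem.mpr (hIP ha)
  rw [AlgHom.comp_apply, this, map_zero]

theorem ideal_top (I : Ideal A) (h : ∀ χ : A →ₐ[ℝ] ℂ, ∃ a ∈ I, χ a ≠ 0) : (1 : A) ∈ I := by
  by_contra hn
  obtain ⟨χ, hχ⟩ := exists_char I (fun h => hn (by rw [h]; trivial))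
  obtain ⟨a, ha, h0⟩ := h χ
  exact h0 (hχ a ha)

theorem unit_of_char (u : A) (h : ∀ χ : A →ₐ[ℝ] ℂ, χ u ≠ 0) : IsUnit u := by
  have := ideal_top (Ideal.span {u}) (fun χ => ⟨u, Ideal.mem_span_singleton_self u, h χ⟩)
  exact isUnit_of_dvd_one (Ideal.mem_span_singleton.mp this)

theorem exists_sqrt_field (u : A) (h2 : ∀ χ : A →ₐ[ℝ] ℝ, 0 ≤ χ u) (I : Ideal A) [I.IsMaximal] :
    ∃ s : A, s ^ 2 - u ∈ I := by
  let _ := Ideal.Quotient.field I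
  let q := Ideal.Quotient.mkₐ ℝ I
  have hq : Function.Surjective q := Ideal.Quotient.mk_surjective
  have hk : ∀ a, q a = 0 → a ∈ I := fun a ha => Ideal.Quotient.eq_zero_iff_mem.mp ha
  rcases Real.nonempty_algEquiv_or (A ⧸ I) with ⟨⟨e⟩⟩ | ⟨⟨e⟩⟩
  · have h0 : 0 ≤ e (q u) := h2 (e.toAlgHom.comp q)
    obtain ⟨s, hs⟩ := hq (e.symm (Real.sqrt (e (q u))))
    refine ⟨s, hk _ ?_⟩
    apply e.injective
    rw [map_sub, map_pow, map_sub, map_pow, hs, AlgEquiv.apply_symm_apply, Real.sq_sqrt h0,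
      sub_self, map_zero]
  · obtain ⟨z, hz⟩ := IsAlgClosed.exists_pow_nat_eq (e (q u)) (n := 2) (by norm_num)
    obtain ⟨s, hs⟩ := hq (e.symm z)
    refine ⟨s, hk _ ?_⟩
    apply e.injective
    rw [map_sub, map_pow, map_sub, map_pow, hs, AlgEquiv.apply_symm_apply, hz, sub_self, map_zero]

theorem exists_sqrt_nil (u : A) (h2 : ∀ χ : A →ₐ[ℝ] ℝ, 0 ≤ χ u) :
    ∃ s : A, IsNilpotent (s ^ 2 - u) := by
  have hart : IsArtinianRing A := IsArtinianRing.of_finite ℝ A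
  choose s hs using fun I : MaximalSpectrum A =>
    (haveI := I.isMaximal; exists_sqrt_field u h2 I.asIdeal)
  obtain ⟨s0, hs0⟩ := Ideal.exists_forall_sub_mem_ideal
    (I := fun I : MaximalSpectrum A => I.asIdeal) (fun _ _ h => MaximalSpectrum.isCoprime_of_ne h) s
  refine ⟨s0, ?_⟩
  rw [← mem_nilradical, nilradical_eq_sInf, Ideal.mem_sInf]
  intro P hP
  have hP : P.IsPrime := hP
  have hPm : P.IsMaximal := inferInstance
  have h1 : s0 - s ⟨P, hPm⟩ ∈ P := hs0 ⟨P, hPm⟩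
  have h3 := hs ⟨P, hPm⟩
  simp only at h3
  have : s0 ^ 2 - u = (s0 - s ⟨P, hPm⟩) * (s0 + s ⟨P, hPm⟩) + (s ⟨P, hPm⟩ ^ 2 - u) := by ring
  rw [this]
  exact P.add_mem (P.mul_mem_right _ h1) h3

theorem exists_sqrt (u : A) (h : ∀ χ : A →ₐ[ℝ] ℂ, χ u ≠ 0)
    (h2 : ∀ χ : A →ₐ[ℝ] ℝ, 0 ≤ χ u) : ∃ s : A, s ^ 2 = u := by
  obtain ⟨s0, h3⟩ := exists_sqrt_nil u h2
  let P : Polynomial A := Polynomial.X ^ 2 - Polynomial.C u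
  have hP : Polynomial.aeval s0 P = s0 ^ 2 - u := by simp [P]
  have hP' : Polynomial.aeval s0 (Polynomial.derivative P) = 2 * s0 := by
    simp [P, one_add_one_eq_two]
  obtain ⟨r, ⟨-, hr⟩, -⟩ := Polynomial.existsUnique_nilpotent_sub_and_aeval_eq_zero
    (P := P) (x := s0) (by rw [hP]; exact h3) (by
      rw [hP']
      apply unit_of_char
      intro χ h0
      rw [map_mul, map_ofNat] at h0
      have hs0 : χ s0 = 0 := by simpa using h0
      have h4 := h3.map χ
      rw [map_sub, map_pow, hs0] at h4
      have := h4.eq_zero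
      apply h χ
      simpa using this)
  refine ⟨r, ?_⟩
  have : Polynomial.aeval r P = r ^ 2 - u := by simp [P]
  rw [this] at hr
  exact sub_eq_zero.mp hr

end finalg


section chars
variable {A : Type*} [CommRing A] [Algebra ℝ A]

theorem nd_ext {T : A →ₗ[ℝ] ℝ} (hT : ∀ a, (∀ b, T (a * b) = 0) → a = 0) {a b : A}
    (h : ∀ c, T (a * c) = T (b * c)) : a = b := by
  rw [← sub_eq_zero]
  apply hT
  intro c
  rw [sub_mul, map_sub, h, sub_self]

theorem char_mul {T : A →ₗ[ℝ] ℝ} (hT : ∀ a, (∀ b, T (a * b) = 0) → a = 0) {χ : A →ₐ[ℝ] ℂ}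
    {c1 c2 : A} (h1 : ∀ a, T (c1 * a) = (χ a).re) (h2 : ∀ a, T (c2 * a) = (χ a).im) (r : A) :
    c1 * r = (χ r).re • c1 - (χ r).im • c2 ∧ c2 * r = (χ r).im • c1 + (χ r).re • c2 := by
  constructor
  · apply nd_ext hT
    intro c
    rw [mul_assoc, h1, sub_mul, map_sub, smul_mul_assoc, smul_mul_assoc, map_smul, map_smul, h1, h2,
      map_mul, Complex.mul_re]
    rfl
  · apply nd_ext hT
    intro c
    rw [mul_assoc, h2, add_mul, map_add, smul_mul_assoc, smul_mul_assoc, map_smul, map_smul, h1, h2,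
      map_mul, Complex.mul_im, add_comm]
    rfl

theorem char_sep {T : A →ₗ[ℝ] ℝ} (hT : ∀ a, (∀ b, T (a * b) = 0) → a = 0) {χ χ' : A →ₐ[ℝ] ℂ}
    {c1 c2 : A} (h1 : ∀ a, T (c1 * a) = (χ a).re) (h2 : ∀ a, T (c2 * a) = (χ a).im)
    (hne : ∃ r, χ' r ≠ χ r) : χ' c1 + Complex.I * χ' c2 = 0 := by
  obtain ⟨r, hr⟩ := hne
  obtain ⟨e1, e2⟩ := char_mul hT h1 h2 r
  have e1 := congrArg χ' e1
  have e2 := congrArg χ' e2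
  simp only [map_mul, map_sub, map_add, map_smul, Complex.real_smul] at e1 e2
  have h3 : (χ' r - χ r) * (χ' c1 + Complex.I * χ' c2) = 0 := by
    rw [← Complex.re_add_im (χ r)]
    linear_combination e1 + Complex.I * e2 - ((χ r).im * χ' c2) * Complex.I_sq
  exact (mul_eq_zero.mp h3).resolve_left (sub_ne_zero.mpr hr)

theorem char_sep_conj {T : A →ₗ[ℝ] ℝ} (hT : ∀ a, (∀ b, T (a * b) = 0) → a = 0)
    {χ χ' : A →ₐ[ℝ] ℂ}
    {c1 c2 : A} (h1 : ∀ a, T (c1 * a) = (χ a).re) (h2 : ∀ a, T (c2 * a) = (χ a).im)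
    (hne : ∃ r, χ' r ≠ (starRingEnd ℂ) (χ r)) : χ' c1 - Complex.I * χ' c2 = 0 := by
  obtain ⟨r, hr⟩ := hne
  obtain ⟨e1, e2⟩ := char_mul hT h1 h2 r
  have e1 := congrArg χ' e1
  have e2 := congrArg χ' e2
  simp only [map_mul, map_sub, map_add, map_smul, Complex.real_smul] at e1 e2
  have hcj : (starRingEnd ℂ) (χ r) = (χ r).re - (χ r).im * Complex.I := by
    apply Complex.ext <;> simp
  have h3 : (χ' r - (starRingEnd ℂ) (χ r)) * (χ' c1 - Complex.I * χ' c2) = 0 := by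
    rw [hcj]
    linear_combination e1 - Complex.I * e2 - ((χ r).im * χ' c2) * Complex.I_sq
  exact (mul_eq_zero.mp h3).resolve_left (sub_ne_zero.mpr hr)

/-- positive vector attached to a character -/
theorem exists_e {T : A →ₗ[ℝ] ℝ} (hT : ∀ a, (∀ b, T (a * b) = 0) → a = 0) (χ : A →ₐ[ℝ] ℂ)
    (hc : ∃ c1 c2 : A, (∀ a, T (c1 * a) = (χ a).re) ∧ (∀ a, T (c2 * a) = (χ a).im) ∧
      χ c1 + Complex.I * χ c2 ≠ 0 ∧
      ((∀ a, (χ a).im = 0) → 0 < (χ c1 + Complex.I * χ c2).re)) :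
    ∃ (e : A) (d : ℂ), (∀ a, T (e * a) = (d * χ a).re) ∧ 0 < T (e * e) ∧
      (∀ χ' : A →ₐ[ℝ] ℂ, (∃ r, χ' r ≠ χ r) → (∃ r, χ' r ≠ (starRingEnd ℂ) (χ r)) → χ' e = 0) := by
  obtain ⟨c1, c2, h1, h2, h3, h4⟩ := hc
  have hz : ∀ χ' : A →ₐ[ℝ] ℂ, (∃ r, χ' r ≠ χ r) → (∃ r, χ' r ≠ (starRingEnd ℂ) (χ r)) →
      χ' c1 = 0 ∧ χ' c2 = 0 := by
    intro χ' hr hr'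
    have e1 := char_sep hT h1 h2 hr
    have e2 := char_sep_conj hT h1 h2 hr'
    constructor
    · linear_combination (e1 + e2) / 2
    · linear_combination (-Complex.I) * (e1 - e2) / 2 + χ' c2 * Complex.I_sq
  by_cases hreal : ∀ a, (χ a).im = 0
  · refine ⟨c1, 1, ?_, ?_, ?_⟩
    · intro a; rw [h1, one_mul]
    · have c20 : c2 = 0 := hT _ (fun b => by rw [h2, hreal])
      have := h4 hreal
      rw [c20] at this
      rw [h1]
      simpa using this
    · intro χ' hr hr'
      exact (hz χ' hr hr').1
  · push Not at hreal
    obtain ⟨r, hr⟩ := hreal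
    have e2 := char_sep_conj hT h1 h2 (χ' := χ) ⟨r, fun h => hr (by
      have := congrArg Complex.im h
      simp at this
      linarith)⟩
    set κ := χ c1 + Complex.I * χ c2 with hκ
    obtain ⟨d, hd⟩ := IsAlgClosed.exists_pow_nat_eq ((starRingEnd ℂ) κ) (n := 2) (by norm_num)
    have he : ∀ a, T ((d.re • c1 - d.im • c2) * a) = (d * χ a).re := by
      intro a
      rw [sub_mul, map_sub, smul_mul_assoc, smul_mul_assoc, map_smul, map_smul, h1, h2,
        Complex.mul_re]
      rfl
    refine ⟨d.re • c1 - d.im • c2, d, he, ?_, ?_⟩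
    · rw [he]
      have : χ (d.re • c1 - d.im • c2) = d * κ / 2 := by
        rw [map_sub, map_smul, map_smul, Complex.real_smul, Complex.real_smul]
        conv_rhs => rw [← Complex.re_add_im d]
        linear_combination (d.re / 2 : ℂ) * e2 - (d.im / 2 : ℂ) * Complex.I * e2 + 
          ((d.re : ℂ) / 2 + d.im / 2 * Complex.I) * hκ - d.im * χ c2 * Complex.I_sq
      rw [this]
      have h5 : d * (d * κ / 2) = ((Complex.normSq κ / 2 : ℝ) : ℂ) := by
        push_cast
        rw [← Complex.mul_conj, ← hd]
        ring
      rw [h5, Complex.ofReal_re]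
      have := Complex.normSq_pos.mpr h3
      linarith
    · intro χ' hr hr'
      obtain ⟨z1, z2⟩ := hz χ' hr hr'
      simp [z1, z2]

theorem core_alg [Module.Finite ℝ A]
    {T : A →ₗ[ℝ] ℝ} (hT : ∀ a, (∀ b, T (a * b) = 0) → a = 0)
    (L : Submodule ℝ A) (hL : ∀ u ∈ L, ∀ v ∈ L, T (u * v) = 0)
    (hdim : 2 * Module.finrank ℝ L = Module.finrank ℝ A)
    {ι : Type*} [Fintype ι] (X : ι → A →ₐ[ℝ] ℂ)
    (hc : ∀ i, ∃ c1 c2 : A, (∀ a, T (c1 * a) = (X i a).re) ∧ (∀ a, T (c2 * a) = (X i a).im) ∧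
      X i c1 + Complex.I * X i c2 ≠ 0 ∧
      ((∀ a, (X i a).im = 0) → 0 < (X i c1 + Complex.I * X i c2).re))
    (hX : ∀ i j, i ≠ j → (∃ r, X i r ≠ X j r) ∧ (∃ r, X i r ≠ (starRingEnd ℂ) (X j r)))
    {W : Type*} [AddCommGroup W] [Module ℝ W] [Module.Finite ℝ W] (θ : W →ₗ[ℝ] A) (g : A)
    (hg : ∀ i, X i g = 0) (hpos : ∀ w, 0 ≤ T (g ^ 2 * (θ w) ^ 2))
    (hinj : ∀ w, g * θ w = 0 → w = 0) :
    Fintype.card ι + Module.finrank ℝ W ≤ Module.finrank ℝ L := by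
  classical
  choose e d he hepos hez using fun i => exists_e hT (X i) (hc i)
  have hee : ∀ i j, i ≠ j → T (e i * e j) = 0 := by
    intro i j hij
    rw [he, hez j (X i) (hX i j hij).1 (hX i j hij).2, mul_zero, Complex.zero_re]
  have heg : ∀ i a, T (e i * (g * a)) = 0 := by
    intro i a
    rw [he, map_mul, hg, zero_mul, mul_zero, Complex.zero_re]
  let Φ : ((ι → ℝ) × W) →ₗ[ℝ] A :=
    LinearMap.coprod (Fintype.linearCombination ℝ e) (LinearMap.mulLeft ℝ g ∘ₗ θ)
  have hΦ : ∀ t w, Φ (t, w) = ∑ i, t i • e i + g * θ w := by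
    intro t w
    simp [Φ, Fintype.linearCombination_apply]
  have hei : ∀ t w i, T (e i * Φ (t, w)) = t i * T (e i * e i) := by
    intro t w i
    rw [hΦ, mul_add, map_add, heg, add_zero, Finset.mul_sum, map_sum, Finset.sum_eq_single i]
    · rw [mul_smul_comm, map_smul, smul_eq_mul]
    · intro j _ hj
      rw [mul_smul_comm, map_smul, hee i j hj.symm, smul_zero]
    · simp
  have hker : Function.Injective Φ := by
    rw [← LinearMap.ker_eq_bot, LinearMap.ker_eq_bot']
    rintro ⟨t, w⟩ h0
    have ht : t = 0 := by
      ext i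
      have := hei t w i
      rw [h0, mul_zero, map_zero] at this
      exact (mul_eq_zero.mp this.symm).resolve_right (hepos i).ne'
    subst ht
    rw [hΦ] at h0
    simp at h0
    rw [hinj w h0]; rfl
  have hfr : Module.finrank ℝ (LinearMap.range Φ) = Fintype.card ι + Module.finrank ℝ W := by
    rw [LinearMap.finrank_range_of_inj hker, Module.finrank_prod, Module.finrank_fintype_fun_eq_card]
  rw [← hfr]
  let B : LinearMap.BilinForm ℝ A := (LinearMap.mul ℝ A).compr₂ T
  have hB : ∀ u v, B u v = T (u * v) := fun u v => rfl
  apply lagrangian_bound B (fun u v => by rw [hB, hB, mul_comm]) _ L _ hL hdim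
  · rintro _ ⟨⟨t, w⟩, rfl⟩
    rw [hB]
    conv_rhs => rw [hΦ t w, add_mul, map_add, Finset.sum_mul, map_sum]
    apply add_nonneg
    · apply Finset.sum_nonneg
      intro i _
      rw [smul_mul_assoc, map_smul, ← hΦ, hei, smul_eq_mul, ← mul_assoc]
      exact mul_nonneg (mul_self_nonneg _) (hepos i).le
    · rw [← hΦ, hΦ, mul_add, map_add, Finset.mul_sum, map_sum, Finset.sum_eq_zero, zero_add]
      · have e1 : g * θ w * (g * θ w) = g ^ 2 * (θ w) ^ 2 := by ring
        rw [e1]; exact hpos w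
      · intro i _
        rw [mul_smul_comm, map_smul, mul_comm, heg, smul_zero]
  · constructor
    · intro a ha; exact hT a ha
    · intro a ha; exact hT a (fun b => by rw [mul_comm]; exact ha b)

/-- the root of the equation -/
theorem exists_g [Module.Finite ℝ A] {T : A →ₗ[ℝ] ℝ} (hT : ∀ a, (∀ b, T (a * b) = 0) → a = 0)
    (f q : A) (hq : ∀ χ : A →ₐ[ℝ] ℂ, χ q ≠ 0)
    (hq2 : ∀ χ : A →ₐ[ℝ] ℝ, 0 ≤ χ q) (hf2 : ∀ χ : A →ₐ[ℝ] ℝ, 0 ≤ χ f)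
    (hc : ∀ χ : A →ₐ[ℝ] ℂ, χ f = 0 → ∃ c1 c2 : A, (∀ a, T (c1 * a) = (χ a).re) ∧
      (∀ a, T (c2 * a) = (χ a).im) ∧ χ c1 + Complex.I * χ c2 ≠ 0) :
    (∃ g : A, g ^ 2 * q = f) ∧
    (∀ r : A, (∀ χ : A →ₐ[ℝ] ℂ, χ f = 0 → χ r = 0) → ∃ s, r = f * s) := by
  have key : ∀ r w : A, (∃ s, f * r = w * s) → (∀ χ : A →ₐ[ℝ] ℂ, χ f = 0 → χ r = 0) →
      ∃ s, r = w * s := by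
    intro r w hfr hr
    let J : Ideal A := Submodule.comap (LinearMap.mulRight A r) (Ideal.span {w})
    have hJ : ∀ c, c ∈ J ↔ ∃ s, c * r = w * s := by
      intro c
      show c * r ∈ Ideal.span {w} ↔ _
      rw [Ideal.mem_span_singleton]; rfl
    have h1 : (1 : A) ∈ J := by
      apply ideal_top
      intro χ
      by_cases h0 : χ f = 0
      · obtain ⟨c1, c2, h1, h2, h3⟩ := hc χ h0
        have h4 := char_mul hT h1 h2 r
        rw [hr χ h0] at h4
        simp at h4
        by_cases h5 : χ c1 = 0
        · refine ⟨c2, (hJ _).mpr ⟨0, by rw [h4.2, mul_zero]⟩, ?_⟩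
          intro h6; apply h3; rw [h5, h6]; simp
        · exact ⟨c1, (hJ _).mpr ⟨0, by rw [h4.1, mul_zero]⟩, h5⟩
      · exact ⟨f, (hJ _).mpr hfr, h0⟩
    simpa using (hJ 1).mp h1
  refine ⟨?_, fun r hr => key r f ⟨r, rfl⟩ hr⟩
  obtain ⟨κ, hκ⟩ := key f (f ^ 2) ⟨1, by ring⟩ (fun χ h => h)
  obtain ⟨v, hv⟩ := (unit_of_char q hq).exists_right_inv
  set ε := 1 - f * κ with hε
  have hε1 : ε * f = 0 := by rw [hε]; linear_combination hκ
  have hε2 : ε * (1 - ε) = 0 := by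
    have : ε * (1 - ε) = (ε * f) * κ := by rw [hε]; ring
    rw [this, hε1, zero_mul]
  have hval : ∀ {E : Type} [Field E] [Algebra ℝ E] (χ : A →ₐ[ℝ] E),
      (χ f = 0 → χ (f * v + ε) = 1) ∧ (χ f ≠ 0 → χ (f * v + ε) = χ f * χ v) := by
    intro E _ _ χ
    constructor
    · intro h; simp [hε, h]
    · intro h
      have := congrArg χ hε1
      rw [map_mul, map_zero] at this
      rw [map_add, map_mul, (mul_eq_zero.mp this).resolve_right h, add_zero]
  have hv0 : ∀ {E : Type} [Field E] [Algebra ℝ E] (χ : A →ₐ[ℝ] E), χ q * χ v = 1 := by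
    intro E _ _ χ
    rw [← map_mul, hv, map_one]
  obtain ⟨s, hs⟩ := exists_sqrt (f * v + ε) (by
    intro χ
    by_cases h : χ f = 0
    · rw [(hval χ).1 h]; exact one_ne_zero
    · rw [(hval χ).2 h]; exact mul_ne_zero h (right_ne_zero_of_mul_eq_one (hv0 χ))) (by
    intro χ
    by_cases h : χ f = 0
    · rw [(hval χ).1 h]; exact zero_le_one
    · rw [(hval χ).2 h]
      apply mul_nonneg (hf2 χ)
      by_contra hn
      nlinarith [hv0 χ, hq2 χ])
  refine ⟨s * (1 - ε), ?_⟩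
  have : (s * (1 - ε)) ^ 2 * q = f * (q * v) := by
    linear_combination (1 - ε) ^ 2 * q * hs + (-2 * v * q + ε * v * q) * hε1 + (1 - ε) * q * hε2
  rw [this, hv, mul_one]

end chars


theorem poly_dense {E : Polynomial ℂ} (hE : E ≠ 0) : Dense {x : ℂ | E.eval x ≠ 0} := by
  have : {x : ℂ | E.eval x ≠ 0} = (↑E.roots.toFinset : Set ℂ)ᶜ := by
    ext x; simp [hE]
  rw [this]
  exact (Finset.countable_toSet _).dense_compl ℂ

theorem poly_le_all {P D E : Polynomial ℂ} (hE : E ≠ 0) (K : ℝ)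
    (h : ∀ x, E.eval x ≠ 0 → ‖P.eval x‖ * (1 + ‖x‖) ≤ K * ‖D.eval x‖) (x : ℂ) :
    ‖P.eval x‖ * (1 + ‖x‖) ≤ K * ‖D.eval x‖ := by
  have hc : IsClosed {x : ℂ | ‖P.eval x‖ * (1 + ‖x‖) ≤ K * ‖D.eval x‖} :=
    isClosed_le ((P.continuous.norm).mul (by fun_prop)) (continuous_const.mul D.continuous.norm)
  have := (poly_dense hE).closure_eq ▸ closure_minimal (s := {x : ℂ | E.eval x ≠ 0}) h hc
  exact this (Set.mem_univ x)

theorem poly_zero (n : ℕ) : ∀ {P D E : Polynomial ℂ} (_ : D.natDegree = n) (_ : E ≠ 0) (K : ℝ)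
    (_ : ∀ x, E.eval x ≠ 0 → ‖P.eval x‖ * (1 + ‖x‖) ≤ K * ‖D.eval x‖), P = 0 := by
  induction n with
  | zero =>
    intro P D E hD hE K h
    have h := poly_le_all hE K h
    rw [Polynomial.natDegree_eq_zero] at hD
    obtain ⟨d, rfl⟩ := hD
    simp only [Polynomial.eval_C] at h
    by_cases hP : 0 < P.degree
    · exfalso
      have h1 := P.tendsto_norm_atTop hP (z := fun n : ℕ => (n : ℂ)) (l := Filter.atTop) (by
        simpa using tendsto_natCast_atTop_atTop (R := ℝ))
      obtain ⟨n, hn⟩ := (h1.eventually_gt_atTop (K * ‖d‖)).exists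
      have := h n
      have h3 : ‖P.eval (n : ℂ)‖ * 1 ≤ ‖P.eval (n : ℂ)‖ * (1 + ‖(n : ℂ)‖) :=
        mul_le_mul_of_nonneg_left (by linarith [norm_nonneg (n : ℂ)]) (norm_nonneg _)
      linarith
    · have hP := Polynomial.eq_C_of_degree_le_zero (not_lt.mp hP)
      rw [hP] at h ⊢
      simp only [Polynomial.eval_C] at h
      by_contra h0
      have hc : 0 < ‖P.coeff 0‖ := norm_pos_iff.mpr (fun h => h0 (by rw [h, map_zero]))
      obtain ⟨n, hn⟩ := exists_nat_gt (K * ‖d‖ / ‖P.coeff 0‖)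
      have := h n
      rw [div_lt_iff₀ hc] at hn
      simp only [Complex.norm_natCast] at this
      nlinarith
  | succ n ih =>
    intro P D E hD hE K h
    have h := poly_le_all hE K h
    obtain ⟨z, hz⟩ := IsAlgClosed.exists_root D (by
      intro h0
      rw [Polynomial.natDegree_eq_of_degree_eq_some (n := 0) h0] at hD
      omega)
    have hP : P.IsRoot z := by
      have := h z
      rw [hz.eq_zero, norm_zero, mul_zero] at this
      have h2 : ‖P.eval z‖ * 1 ≤ ‖P.eval z‖ * (1 + ‖z‖) :=
        mul_le_mul_of_nonneg_left (by linarith [norm_nonneg z]) (norm_nonneg _)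
      have : ‖P.eval z‖ ≤ 0 := by linarith
      exact norm_le_zero_iff.mp this
    obtain ⟨D', rfl⟩ := Polynomial.dvd_iff_isRoot.mpr hz
    obtain ⟨P', rfl⟩ := Polynomial.dvd_iff_isRoot.mpr hP
    have hD0 : D' ≠ 0 := by rintro rfl; simp at hD
    rw [Polynomial.natDegree_mul (Polynomial.X_sub_C_ne_zero z) hD0,
      Polynomial.natDegree_X_sub_C] at hD
    rw [ih (P := P') (D := D') (E := Polynomial.X - Polynomial.C z) (by omega)
      (Polynomial.X_sub_C_ne_zero z) K, mul_zero]
    intro x hx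
    have := h x
    rw [Polynomial.eval_mul, Polynomial.eval_mul, norm_mul, norm_mul] at this
    have hp : 0 < ‖(Polynomial.X - Polynomial.C z).eval x‖ := norm_pos_iff.mpr hx
    nlinarith

theorem prod_bound (C : ℝ) (hC : 0 ≤ C) (t : ℂ) (n : ℕ) :
    ∃ K : ℝ, ∀ (X : ℝ) (α V : ℂ → ℂ), 1 ≤ X → ∀ s : Multiset ℂ, Multiset.card s = n →
      (∀ y ∈ s, ‖α y‖ * X ≤ C * ‖V y‖) →
      ‖(s.map (fun y => α y - t * V y)).prod‖ ≤ (C + ‖t‖) ^ n * ‖(s.map V).prod‖ ∧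
      ‖(s.map (fun y => α y - t * V y)).prod - (-t) ^ n * (s.map V).prod‖ * X
        ≤ K * ‖(s.map V).prod‖ := by
  induction n with
  | zero =>
    refine ⟨0, fun X α V hX s hs h => ?_⟩
    rw [Multiset.card_eq_zero] at hs
    subst hs
    simp
  | succ n ih =>
    obtain ⟨K, hK⟩ := ih
    refine ⟨C * (C + ‖t‖) ^ n + ‖t‖ * K, fun X α V hX s hs h => ?_⟩
    obtain ⟨y, hys⟩ := Multiset.exists_mem_of_ne_zero (s := s) (by rintro rfl; simp at hs)
    obtain ⟨s, rfl⟩ := Multiset.exists_cons_of_mem hys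
    obtain ⟨h1, h2⟩ := hK X α V hX s (by simpa using hs)
      (fun y hy => h y (Multiset.mem_cons_of_mem hy))
    have hy := h y (Multiset.mem_cons_self y s)
    simp only [Multiset.map_cons, Multiset.prod_cons]
    set A := (s.map (fun y => α y - t * V y)).prod
    set B := (s.map V).prod
    have hα : ‖α y‖ ≤ C * ‖V y‖ := by nlinarith [norm_nonneg (α y)]
    have hC0 : 0 ≤ (C + ‖t‖) ^ n := by positivity
    constructor
    · rw [norm_mul, norm_mul, pow_succ]
      have h3 : ‖α y - t * V y‖ ≤ (C + ‖t‖) * ‖V y‖ := by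
        refine (norm_sub_le _ _).trans ?_
        rw [norm_mul]; linarith
      calc ‖α y - t * V y‖ * ‖A‖ ≤ ((C + ‖t‖) * ‖V y‖) * ((C + ‖t‖) ^ n * ‖B‖) :=
            mul_le_mul h3 h1 (norm_nonneg _) (by positivity)
        _ = _ := by ring
    · have e : (α y - t * V y) * A - (-t) ^ (n + 1) * (V y * B) =
          α y * A - t * V y * (A - (-t) ^ n * B) := by ring
      rw [e]
      have h4 : ‖α y * A - t * V y * (A - (-t) ^ n * B)‖ ≤
          ‖α y‖ * ‖A‖ + ‖t‖ * ‖V y‖ * ‖A - (-t) ^ n * B‖ := by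
        refine (norm_sub_le _ _).trans ?_
        rw [norm_mul, norm_mul, norm_mul]
      calc _ ≤ (‖α y‖ * ‖A‖ + ‖t‖ * ‖V y‖ * ‖A - (-t) ^ n * B‖) * X :=
            mul_le_mul_of_nonneg_right h4 (by linarith)
        _ = (‖α y‖ * X) * ‖A‖ + ‖t‖ * ‖V y‖ * (‖A - (-t) ^ n * B‖ * X) := by ring
        _ ≤ (C * ‖V y‖) * ((C + ‖t‖) ^ n * ‖B‖) + ‖t‖ * ‖V y‖ * (K * ‖B‖) := by
            gcongr
        _ = _ := by rw [norm_mul]; ring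

/-- evaluation of a bivariate complex polynomial -/
noncomputable def e2 (x y : ℂ) (g : Polynomial (Polynomial ℂ)) : ℂ :=
  (g.map (Polynomial.evalRingHom x)).eval y

theorem map_natDegree_le' {f : Polynomial (Polynomial ℂ)} {m : ℕ} (hf : f.natDegree ≤ m) (x : ℂ) :
    (f.map (Polynomial.evalRingHom x)).natDegree ≤ m := Polynomial.natDegree_map_le.trans hf

theorem map_natDegree_eq' {f : Polynomial (Polynomial ℂ)} {m : ℕ} (hf : f.natDegree ≤ m) (x : ℂ)
    (h : (f.coeff m).eval x ≠ 0) : (f.map (Polynomial.evalRingHom x)).natDegree = m := by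
  apply le_antisymm (map_natDegree_le' hf x)
  apply Polynomial.le_natDegree_of_ne_zero
  simpa using h

theorem res_eval {f g : Polynomial (Polynomial ℂ)} {m : ℕ} (hf : f.natDegree ≤ m)
    (hg : g.natDegree ≤ m) (x : ℂ) (h : (f.coeff m).eval x ≠ 0) :
    (Polynomial.resultant f g m m).eval x = ((f.coeff m).eval x) ^ m *
      ((f.map (Polynomial.evalRingHom x)).roots.map (fun y => e2 x y g)).prod := by
  have h1 := Polynomial.resultant_map_map f g m m (Polynomial.evalRingHom x)
  rw [Polynomial.coe_evalRingHom] at h1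
  rw [← h1]
  have h2 := Polynomial.resultant_eq_prod_eval (f.map (Polynomial.evalRingHom x))
    (g.map (Polynomial.evalRingHom x)) m (map_natDegree_le' hg x) (IsAlgClosed.splits _)
  rw [map_natDegree_eq' hf x h] at h2
  rw [h2, Polynomial.leadingCoeff, map_natDegree_eq' hf x h]
  simp [e2]

theorem nodup_of_simple {f : Polynomial ℂ} (hf : f ≠ 0)
    (h : ∀ y, f.eval y = 0 → f.derivative.eval y ≠ 0) : f.roots.Nodup := by
  classical
  rw [Multiset.nodup_iff_count_le_one]
  intro y
  rw [Polynomial.count_roots]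
  by_contra hn
  push Not at hn
  have := (Polynomial.one_lt_rootMultiplicity_iff_isRoot hf).mp hn
  exact h y this.1 this.2

theorem norm_vanish (m : ℕ) (f α V : Polynomial (Polynomial ℂ)) (hf : f.natDegree ≤ m)
    (hV : V.natDegree ≤ m) (hα : α.natDegree < m) (x0 : ℂ) (hx0 : (f.coeff m).eval x0 ≠ 0)
    (hV0 : ∀ y, e2 x0 y f = 0 → e2 x0 y V ≠ 0)
    (hsep : ∀ x y, e2 x y f = 0 → e2 x y V ≠ 0 → e2 x y f.derivative ≠ 0)
    (C : ℝ) (hC : 0 ≤ C) (hb : ∀ x y, e2 x y f = 0 → e2 x y V ≠ 0 →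
      ‖e2 x y α‖ * (1 + ‖x‖) ≤ C * ‖e2 x y V‖) :
    ∃ E : Polynomial ℂ, E ≠ 0 ∧ ∀ x, E.eval x ≠ 0 → ∃ s : Finset ℂ, s.card = m ∧
      ∀ y ∈ s, e2 x y f = 0 ∧ e2 x y V ≠ 0 ∧ e2 x y α = 0 := by
  set D := Polynomial.resultant f V m m with hD
  have hfm : f.coeff m ≠ 0 := by rintro h; rw [h] at hx0; simp at hx0
  have hf0 : ∀ x, (f.coeff m).eval x ≠ 0 → f.map (Polynomial.evalRingHom x) ≠ 0 := by
    intro x hx h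
    apply hx
    have := congrArg (fun g => Polynomial.coeff g m) h
    simpa using this
  have hD0 : D ≠ 0 := by
    intro h
    have h1 := res_eval hf hV x0 hx0
    rw [← hD, h, Polynomial.eval_zero, eq_comm, mul_eq_zero, Multiset.prod_eq_zero_iff,
      Multiset.mem_map] at h1
    rcases h1 with h1 | ⟨y, hy, h1⟩
    · exact pow_ne_zero _ hx0 h1
    · exact hV0 y ((Polynomial.mem_roots (hf0 x0 hx0)).mp hy) h1
  have hVD : ∀ x, (D * f.coeff m).eval x ≠ 0 → (f.coeff m).eval x ≠ 0 ∧
      ∀ y, e2 x y f = 0 → e2 x y V ≠ 0 := by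
    intro x hx
    rw [Polynomial.eval_mul] at hx
    have hx2 := right_ne_zero_of_mul hx
    refine ⟨hx2, fun y hy h0 => ?_⟩
    apply left_ne_zero_of_mul hx
    rw [hD, res_eval hf hV x hx2]
    rw [Multiset.prod_eq_zero, mul_zero]
    rw [Multiset.mem_map]
    exact ⟨y, (Polynomial.mem_roots (hf0 x hx2)).mpr hy, h0⟩
  have hcard : ∀ x, (f.coeff m).eval x ≠ 0 →
      Multiset.card (f.map (Polynomial.evalRingHom x)).roots = m := by
    intro x hx
    rw [Polynomial.splits_iff_card_roots.mp (IsAlgClosed.splits _), map_natDegree_eq' hf x hx]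
  have he2 : ∀ t x y, e2 x y (α - Polynomial.C (Polynomial.C t) * V) = e2 x y α - t * e2 x y V := by
    intro t x y
    simp [e2]
  have hdeg : ∀ t, (α - Polynomial.C (Polynomial.C t) * V).natDegree ≤ m := by
    intro t
    refine (Polynomial.natDegree_sub_le _ _).trans (max_le hα.le ?_)
    exact (Polynomial.natDegree_C_mul_le _ _).trans hV
  have hP : ∀ t : ℂ, Polynomial.resultant f (α - Polynomial.C (Polynomial.C t) * V) m m -
      Polynomial.C ((-t) ^ m) * D = 0 := by
    intro t
    obtain ⟨K, hK⟩ := prod_bound C hC t m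
    refine poly_zero _ (D := D) (E := D * f.coeff m) rfl (mul_ne_zero hD0 hfm) K ?_
    intro x hx
    obtain ⟨hx1, hx2⟩ := hVD x hx
    obtain ⟨-, h2⟩ := hK (1 + ‖x‖) (fun y => e2 x y α) (fun y => e2 x y V)
      (by linarith [norm_nonneg x]) _ (hcard x hx1) (by
        intro y hy
        have hy := (Polynomial.mem_roots (hf0 x hx1)).mp hy
        exact hb x y hy (hx2 y hy))
    rw [Polynomial.eval_sub, Polynomial.eval_mul, Polynomial.eval_C, hD,
      res_eval hf (hdeg t) x hx1, res_eval hf hV x hx1]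
    simp only [he2]
    set c := (f.coeff m).eval x
    rw [mul_left_comm, ← mul_sub, norm_mul, norm_mul, mul_assoc, mul_left_comm K]
    exact mul_le_mul_of_nonneg_left h2 (norm_nonneg _)
  refine ⟨D * f.coeff m, mul_ne_zero hD0 hfm, ?_⟩
  intro x hx
  obtain ⟨hx1, hx2⟩ := hVD x hx
  refine ⟨(f.map (Polynomial.evalRingHom x)).roots.toFinset, ?_, ?_⟩
  · rw [Multiset.toFinset_card_of_nodup, hcard x hx1]
    apply nodup_of_simple (hf0 x hx1)
    intro y hy
    rw [Polynomial.derivative_map]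
    exact hsep x y hy (hx2 y hy)
  · intro y hy
    rw [Multiset.mem_toFinset, Polynomial.mem_roots (hf0 x hx1)] at hy
    refine ⟨hy, hx2 y hy, ?_⟩
    have hVy := hx2 y hy
    set t := e2 x y α / e2 x y V with ht
    have h1 := congrArg (Polynomial.eval x) (hP t)
    rw [Polynomial.eval_sub, Polynomial.eval_mul, Polynomial.eval_C, Polynomial.eval_zero,
      res_eval hf (hdeg t) x hx1, Multiset.prod_eq_zero, mul_zero, zero_sub, neg_eq_zero,
      mul_eq_zero] at h1
    · rw [Polynomial.eval_mul] at hx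
      have h2 := h1.resolve_right (left_ne_zero_of_mul hx)
      have h3 : t = 0 := by
        have := eq_zero_of_pow_eq_zero h2
        simpa using this
      rw [ht, div_eq_zero_iff] at h3
      exact h3.resolve_right hVy
    · rw [Multiset.mem_map]
      refine ⟨y, (Polynomial.mem_roots (hf0 x hx1)).mpr hy, ?_⟩
      rw [he2, ht, div_mul_cancel₀ _ hVy, sub_self]

theorem vanish_of_roots {m : ℕ} {α : Polynomial (Polynomial ℂ)} (hα : α.natDegree < m)
    {E : Polynomial ℂ} (hE : E ≠ 0)
    (h : ∀ x, E.eval x ≠ 0 → ∃ s : Finset ℂ, s.card = m ∧ ∀ y ∈ s, e2 x y α = 0) : α = 0 := by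
  ext1 n
  rw [Polynomial.coeff_zero]
  have : α.coeff n * E = 0 := by
    apply Polynomial.funext
    intro x
    rw [Polynomial.eval_mul, Polynomial.eval_zero]
    by_cases hx : E.eval x = 0
    · rw [hx, mul_zero]
    · obtain ⟨s, hs, h1⟩ := h x hx
      have h2 := Polynomial.eq_zero_of_natDegree_lt_card_of_eval_eq_zero'
        (α.map (Polynomial.evalRingHom x)) s h1
        (by rw [hs]; exact lt_of_le_of_lt Polynomial.natDegree_map_le hα)
      have h3 := congrArg (fun g => Polynomial.coeff g n) h2
      simp only [Polynomial.coeff_map, Polynomial.coe_evalRingHom, Polynomial.coeff_zero] at h3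
      rw [h3, zero_mul]
  exact (mul_eq_zero.mp this).resolve_right hE


/-! ### The affine setup -/

theorem rot_natDegree {R : Type*} [CommRing R] (p : ℕ) (q : Polynomial R) (h : q.natDegree ≤ p) :
    ((1 + Polynomial.X ^ 2) * Polynomial.derivative q
      - Polynomial.C (p : R) * Polynomial.X * q).natDegree ≤ p := by
  have e : (1 + Polynomial.X ^ 2) * Polynomial.derivative q
      - Polynomial.C (p : R) * Polynomial.X * q =
      Polynomial.X * (Polynomial.X * Polynomial.derivative q - Polynomial.C (p : R) * q)
        + Polynomial.derivative q := by ring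
  rw [e, Polynomial.natDegree_le_iff_coeff_eq_zero]
  intro n hn
  rw [Polynomial.natDegree_le_iff_coeff_eq_zero] at h
  obtain ⟨k, rfl⟩ : ∃ k, n = k + 1 := ⟨n - 1, by omega⟩
  rw [Polynomial.coeff_add, Polynomial.coeff_X_mul, Polynomial.coeff_sub, Polynomial.coeff_C_mul,
    Polynomial.coeff_derivative, h (k + 1 + 1) (by omega)]
  rcases k with _ | k
  · obtain rfl : p = 0 := by omega
    simp
  · rw [Polynomial.coeff_X_mul, Polynomial.coeff_derivative]
    by_cases hk : k + 1 = p
    · subst hk; push_cast; ring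
    · rw [h (k + 1) (by omega)]; ring

/-- rotation derivative in `x` -/
noncomputable def UU (p : ℕ) (f : BP) : BP :=
  (1 + Polynomial.C Polynomial.X ^ 2) * dX f
    - Polynomial.C (Polynomial.C (p : ℝ)) * Polynomial.C Polynomial.X * f

/-- rotation derivative in `y` -/
noncomputable def VV (m : ℕ) (f : BP) : BP :=
  (1 + Polynomial.X ^ 2) * dY f - Polynomial.C (Polynomial.C (m : ℝ)) * Polynomial.X * f

theorem C_mem_BD {r : ℕ} (q : Polynomial ℝ) (h : q.natDegree ≤ r) (s : ℕ) :
    (Polynomial.C q : BP) ∈ BD r s := by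
  apply mem_BD_of
  · simp
  · intro l
    rw [Polynomial.coeff_C]
    split_ifs
    · exact h
    · simp

theorem Y_mem_BD : (Polynomial.X : BP) ∈ BD 0 1 := by
  have := mon_mem_BD 0 1
  have e : mon 0 1 = Polynomial.X := by unfold mon; simp [Polynomial.monomial_one_one_eq_X]
  rwa [e] at this

theorem one_mem_BD (r s : ℕ) : (1 : BP) ∈ BD r s := by
  have := C_mem_BD (r := r) 1 (by simp) s
  simpa using this

theorem dX_mem_BD' {r s : ℕ} {g : BP} (hg : g ∈ BD r s) : dX g ∈ BD r s :=
  dX_mem_BD (BD_mono (Nat.le_succ r) le_rfl hg)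

theorem dY_mem_BD' {r s : ℕ} {g : BP} (hg : g ∈ BD r s) : dY g ∈ BD r s :=
  dY_mem_BD (BD_mono le_rfl (Nat.le_succ s) hg)

theorem UU_coeff (p : ℕ) (f : BP) (l : ℕ) : (UU p f).coeff l =
    (1 + Polynomial.X ^ 2) * Polynomial.derivative (f.coeff l)
      - Polynomial.C (p : ℝ) * Polynomial.X * f.coeff l := by
  unfold UU
  have e : (1 + (Polynomial.C Polynomial.X : BP) ^ 2) = Polynomial.C (1 + Polynomial.X ^ 2) := by
    simp
  rw [e, Polynomial.coeff_sub, Polynomial.coeff_C_mul, ← Polynomial.C_mul, Polynomial.coeff_C_mul,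
    dX_coeff]

theorem UU_mem {p m : ℕ} {f : BP} (hf : f ∈ BD p m) : UU p f ∈ BD p m := by
  apply mem_BD_of
  · rw [Polynomial.natDegree_le_iff_coeff_eq_zero]
    intro n hn
    rw [UU_coeff, Polynomial.coeff_eq_zero_of_natDegree_lt (lt_of_le_of_lt (BD_natDegree hf) hn)]
    simp
  · intro l
    rw [UU_coeff]
    exact rot_natDegree p _ (BD_coeff_natDegree hf l)

theorem VV_mem {p m : ℕ} {f : BP} (hf : f ∈ BD p m) : VV m f ∈ BD p m := by
  apply mem_BD_of
  · have := rot_natDegree m f (BD_natDegree hf)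
    unfold VV dY
    simpa using this
  · intro l
    have h1 : VV m f ∈ BD (0 + p) (2 + m) := by
      unfold VV
      apply Submodule.sub_mem
      · apply BD_mul _ (dY_mem_BD' hf)
        apply Submodule.add_mem _ (one_mem_BD _ _)
        have := mon_mem_BD 0 2
        have e : mon 0 2 = Polynomial.X ^ 2 := by
          unfold mon; simp [Polynomial.X_pow_eq_monomial]
        rwa [e] at this
      · apply BD_mul _ hf
        have := BD_mul (C_mem_BD (r := 0) (Polynomial.C (m : ℝ)) (by simp) 1) Y_mem_BD
        simpa using this
    have := BD_coeff_natDegree h1 l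
    simpa using this

/-- bihomogenization, evaluated -/
noncomputable def hz (r s : ℕ) (g : BP) (x0 x1 y0 y1 : ℂ) : ℂ :=
  ∑ l ∈ Finset.range (s + 1), ∑ k ∈ Finset.range (r + 1),
    (((g.coeff l).coeff k : ℝ) : ℂ) * (x0 ^ (r - k) * x1 ^ k * (y0 ^ (s - l) * y1 ^ l))

theorem hz_smul (r s : ℕ) (g : BP) (c d x0 x1 y0 y1 : ℂ) :
    hz r s g (c * x0) (c * x1) (d * y0) (d * y1) = c ^ r * d ^ s * hz r s g x0 x1 y0 y1 := by
  unfold hz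
  rw [Finset.mul_sum]
  apply Finset.sum_congr rfl
  intro l hl
  rw [Finset.mul_sum]
  apply Finset.sum_congr rfl
  intro k hk
  simp only [Finset.mem_range] at hl hk
  have e1 : c ^ r = c ^ (r - k) * c ^ k := by rw [← pow_add]; congr 1; omega
  have e2 : d ^ s = d ^ (s - l) * d ^ l := by rw [← pow_add]; congr 1; omega
  rw [e1, e2]
  simp only [mul_pow]
  ring

theorem hz_ev {r s : ℕ} {g : BP} (hg : g ∈ BD r s) (x y : ℂ) : hz r s g 1 x 1 y = ev x y g := by
  rw [BD_ev hg]
  unfold hz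
  simp [Algebra.smul_def]

theorem hz_xinf {r s : ℕ} {g : BP} (hg : g ∈ BD r s) (y : ℂ) :
    hz r s g 0 1 1 y = Polynomial.aeval y (xc r g) := by
  unfold hz
  rw [Polynomial.aeval_eq_sum_range' (lt_of_le_of_lt (xc_natDegree hg) (Nat.lt_succ_self s))]
  apply Finset.sum_congr rfl
  intro l _
  rw [Finset.sum_range_succ, Finset.sum_eq_zero]
  · simp [Algebra.smul_def]
  · intro k hk
    simp only [Finset.mem_range] at hk
    rw [zero_pow (by omega)]; ring

theorem hz_yinf {r s : ℕ} {g : BP} (hg : g ∈ BD r s) (x : ℂ) :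
    hz r s g 1 x 0 1 = Polynomial.aeval x (g.coeff s) := by
  unfold hz
  rw [Finset.sum_range_succ, Finset.sum_eq_zero,
    Polynomial.aeval_eq_sum_range' (lt_of_le_of_lt (BD_coeff_natDegree hg s) (Nat.lt_succ_self r))]
  · simp [Algebra.smul_def]
  · intro l hl
    simp only [Finset.mem_range] at hl
    rw [zero_pow (by omega)]; simp

theorem hz_inf {r s : ℕ} {g : BP} :
    hz r s g 0 1 0 1 = (((g.coeff s).coeff r : ℝ) : ℂ) := by
  unfold hz
  rw [Finset.sum_range_succ, Finset.sum_eq_zero, Finset.sum_range_succ, Finset.sum_eq_zero]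
  · simp
  · intro k hk
    simp only [Finset.mem_range] at hk
    rw [zero_pow (by omega)]; simp
  · intro l hl
    simp only [Finset.mem_range] at hl
    rw [zero_pow (n := s - l) (by omega)]; simp

theorem hz_cont (r s : ℕ) (g : BP) :
    Continuous (fun z : (ℂ × ℂ) × (ℂ × ℂ) => hz r s g z.1.1 z.1.2 z.2.1 z.2.2) := by
  unfold hz
  fun_prop

/-- no common zeros at infinity, analytic form -/
structure InfHyp (p m : ℕ) (U V : BP) : Prop where
  hp : 1 ≤ p
  hm : 1 ≤ m
  hU : U ∈ BD p m
  hV : V ∈ BD p m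
  infx : ∀ y0 y1 : ℂ, (y0 ≠ 0 ∨ y1 ≠ 0) → hz p m U 0 1 y0 y1 ≠ 0 ∨ hz p m V 0 1 y0 y1 ≠ 0
  infy : ∀ x0 x1 : ℂ, (x0 ≠ 0 ∨ x1 ≠ 0) → hz p m U x0 x1 0 1 ≠ 0 ∨ hz p m V x0 x1 0 1 ≠ 0

theorem InfHyp.box {p m : ℕ} {U V : BP} (H : InfHyp p m U V) : BoxHyp p m U V where
  hp := H.hp
  hm := H.hm
  hU := H.hU
  hV := H.hV
  hcx := by
    rw [Polynomial.isCoprime_iff_aeval_ne_zero_of_isAlgClosed ℝ ℂ]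
    intro y
    rw [← hz_xinf H.hU, ← hz_xinf H.hV]
    exact H.infx 1 y (by simp)
  htop := by
    have := H.infx 0 1 (by simp)
    rw [hz_inf, hz_inf] at this
    simpa using this
  hcy := by
    rw [Polynomial.isCoprime_iff_aeval_ne_zero_of_isAlgClosed ℝ ℂ]
    intro x
    rw [← hz_yinf H.hU, ← hz_yinf H.hV]
    exact H.infy 1 x (by simp)

/-- homogeneous size of `x` -/
noncomputable def nm (x : ℂ) : ℝ := max 1 ‖x‖

theorem nm_one (x : ℂ) : 1 ≤ nm x := le_max_left _ _
theorem nm_pos (x : ℂ) : 0 < nm x := lt_of_lt_of_le one_pos (nm_one x)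
theorem nm_norm (x : ℂ) : ‖x‖ ≤ nm x := le_max_right _ _

theorem nm_sphere (x : ℂ) :
    (((nm x : ℂ))⁻¹ * 1, ((nm x : ℂ))⁻¹ * x) ∈ Metric.sphere (0 : ℂ × ℂ) 1 := by
  rw [mem_sphere_zero_iff_norm, Prod.norm_def]
  have h := nm_pos x
  simp only [norm_mul, norm_inv, Complex.norm_real, Real.norm_eq_abs, abs_of_pos h, norm_one]
  rw [← mul_max_of_nonneg _ _ (by positivity)]
  exact inv_mul_cancel₀ h.ne'

theorem InfHyp.far {p m : ℕ} {U V : BP} (H : InfHyp p m U V) :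
    ∃ c : ℝ, 0 < c ∧ ∀ x y : ℂ, 1 ≤ c * (nm x * nm y) →
      c * (nm x ^ p * nm y ^ m) ≤ ‖ev x y U‖ + ‖ev x y V‖ := by
  let Ψ : (ℂ × ℂ) × (ℂ × ℂ) → ℝ := fun z => ‖hz p m U z.1.1 z.1.2 z.2.1 z.2.2‖
    + ‖hz p m V z.1.1 z.1.2 z.2.1 z.2.2‖ + ‖z.1.1 * z.2.1‖
  have hΨ : Continuous Ψ := by
    have h1 := hz_cont p m U
    have h2 := hz_cont p m V
    fun_prop
  let K : Set ((ℂ × ℂ) × (ℂ × ℂ)) := Metric.sphere (0 : ℂ × ℂ) 1 ×ˢ Metric.sphere (0 : ℂ × ℂ) 1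
  have hK : IsCompact K := (isCompact_sphere _ _).prod (isCompact_sphere _ _)
  have hne : K.Nonempty := ⟨_, Set.mk_mem_prod (nm_sphere 0) (nm_sphere 0)⟩
  obtain ⟨z, hz1, hz2⟩ := hK.exists_isMinOn hne hΨ.continuousOn
  have hpos : 0 < Ψ z := by
    obtain ⟨⟨x0, x1⟩, ⟨y0, y1⟩⟩ := z
    have hx : x0 ≠ 0 ∨ x1 ≠ 0 := by
      by_contra hcon
      push Not at hcon
      have := hz1.1
      simp [hcon.1, hcon.2] at this
    have hy : y0 ≠ 0 ∨ y1 ≠ 0 := by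
      by_contra hcon
      push Not at hcon
      have := hz1.2
      simp [hcon.1, hcon.2] at this
    show 0 < ‖hz p m U x0 x1 y0 y1‖ + ‖hz p m V x0 x1 y0 y1‖ + ‖x0 * y0‖
    by_cases h0 : x0 * y0 = 0
    · have : hz p m U x0 x1 y0 y1 ≠ 0 ∨ hz p m V x0 x1 y0 y1 ≠ 0 := by
        rcases mul_eq_zero.mp h0 with h | h
        · subst h
          have hx1 : x1 ≠ 0 := by simpa using hx
          have hU := hz_smul p m U x1 1 0 1 y0 y1
          have hV := hz_smul p m V x1 1 0 1 y0 y1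
          simp only [mul_zero, mul_one, one_mul, one_pow] at hU hV
          rw [hU, hV]
          rcases H.infx y0 y1 hy with h | h
          · left; exact mul_ne_zero (pow_ne_zero _ hx1) h
          · right; exact mul_ne_zero (pow_ne_zero _ hx1) h
        · subst h
          have hy1 : y1 ≠ 0 := by simpa using hy
          have hU := hz_smul p m U 1 y1 x0 x1 0 1
          have hV := hz_smul p m V 1 y1 x0 x1 0 1
          simp only [mul_zero, mul_one, one_mul, one_pow] at hU hV
          rw [hU, hV]
          rcases H.infy x0 x1 hx with h | h
          · left; exact mul_ne_zero (pow_ne_zero _ hy1) h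
          · right; exact mul_ne_zero (pow_ne_zero _ hy1) h
      rcases this with h | h
      · have := norm_pos_iff.mpr h; positivity
      · have := norm_pos_iff.mpr h; positivity
    · have := norm_pos_iff.mpr h0; positivity
  refine ⟨Ψ z / 2, by positivity, ?_⟩
  intro x y hxy
  have h1 : Ψ z ≤ _ := hz2 (Set.mk_mem_prod (nm_sphere x) (nm_sphere y))
  have hX := nm_pos x
  have hY := nm_pos y
  simp only [Ψ, hz_smul] at h1
  rw [show Ψ z = ‖hz p m U z.1.1 z.1.2 z.2.1 z.2.2‖
    + ‖hz p m V z.1.1 z.1.2 z.2.1 z.2.2‖ + ‖z.1.1 * z.2.1‖ from rfl] at hxy ⊢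
  set c := ‖hz p m U z.1.1 z.1.2 z.2.1 z.2.2‖
    + ‖hz p m V z.1.1 z.1.2 z.2.1 z.2.2‖ + ‖z.1.1 * z.2.1‖
  rw [hz_ev H.hU, hz_ev H.hV] at h1
  simp only [norm_mul, norm_pow, norm_inv, Complex.norm_real, Real.norm_eq_abs, abs_of_pos hX,
    abs_of_pos hY, mul_one] at h1
  have h2 : (nm x)⁻¹ * (nm y)⁻¹ ≤ c / 2 := by
    rw [← mul_inv, inv_le_iff_one_le_mul₀ (by positivity)]
    exact hxy
  have h3 : c / 2 ≤ (nm x)⁻¹ ^ p * (nm y)⁻¹ ^ m * (‖ev x y U‖ + ‖ev x y V‖) := by linarith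
  rw [inv_pow, inv_pow, ← mul_inv] at h3
  rwa [inv_mul_eq_div, le_div_iff₀ (by positivity)] at h3

theorem BD_bound {r s : ℕ} {g : BP} (hg : g ∈ BD r s) :
    ∃ C : ℝ, 0 ≤ C ∧ ∀ x y : ℂ, ‖ev x y g‖ ≤ C * (nm x ^ r * nm y ^ s) := by
  refine ⟨∑ l ∈ Finset.range (s + 1), ∑ k ∈ Finset.range (r + 1), |(g.coeff l).coeff k|,
    by positivity, ?_⟩
  intro x y
  rw [BD_ev hg, Finset.sum_mul]
  refine (norm_sum_le _ _).trans (Finset.sum_le_sum ?_)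
  intro l hl
  rw [Finset.sum_mul]
  refine (norm_sum_le _ _).trans (Finset.sum_le_sum ?_)
  intro k hk
  simp only [Finset.mem_range] at hl hk
  rw [norm_smul, Real.norm_eq_abs, norm_mul, norm_pow, norm_pow]
  have h1 : ‖x‖ ^ k ≤ nm x ^ r :=
    (pow_le_pow_left₀ (norm_nonneg _) (nm_norm x) k).trans (pow_le_pow_right₀ (nm_one x) (by omega))
  have h2 : ‖y‖ ^ l ≤ nm y ^ s :=
    (pow_le_pow_left₀ (norm_nonneg _) (nm_norm y) l).trans (pow_le_pow_right₀ (nm_one y) (by omega))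
  have := nm_pos x
  gcongr

theorem exists_BD (g : BP) : ∃ r s, g ∈ BD r s := by
  refine ⟨∑ l ∈ g.support, (g.coeff l).natDegree, g.natDegree, mem_BD_of le_rfl ?_⟩
  intro l
  by_cases h : l ∈ g.support
  · exact Finset.single_le_sum (f := fun l => (g.coeff l).natDegree) (fun _ _ => Nat.zero_le _) h
  · rw [Polynomial.notMem_support_iff.mp h]; simp

theorem near_bound (M : ℝ) (g : BP) :
    ∃ C : ℝ, 0 ≤ C ∧ ∀ x y : ℂ, nm x ≤ M → nm y ≤ M → ‖ev x y g‖ ≤ C := by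
  obtain ⟨r, s, hg⟩ := exists_BD g
  obtain ⟨C, hC, h⟩ := BD_bound hg
  refine ⟨C * (|M| ^ r * |M| ^ s), by positivity, ?_⟩
  intro x y hx hy
  have h1 := nm_pos x
  have h2 := nm_pos y
  have h3 : nm x ≤ |M| := hx.trans (le_abs_self _)
  have h4 : nm y ≤ |M| := hy.trans (le_abs_self _)
  refine (h x y).trans ?_
  gcongr

theorem InfHyp.alpha_bound {p m : ℕ} {U V : BP} (H : InfHyp p m U V) {f h α β α1 α2 α3 β1 β2 β3 : BP}
    (hα : α ∈ BD (p - 1) (m - 1)) (hβ : β ∈ BD (p - 1) (m - 1))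
    (hab : α * U + β * V = f * h) (hα1 : α = α1 * U + α2 * V + α3 * f)
    (hβ1 : β = β1 * U + β2 * V + β3 * f) :
    ∃ C : ℝ, 0 ≤ C ∧ ∀ x y : ℂ, ev x y f = 0 → ev x y V ≠ 0 →
      ‖ev x y α‖ * (1 + ‖x‖) ≤ C * ‖ev x y V‖ := by
  obtain ⟨c, hc, hfar⟩ := H.far
  obtain ⟨A, hA, hA'⟩ := BD_bound hα
  obtain ⟨B, hB, hB'⟩ := BD_bound hβ
  obtain ⟨C1, hC1, hC1'⟩ := near_bound c⁻¹ α1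
  obtain ⟨C2, hC2, hC2'⟩ := near_bound c⁻¹ α2
  obtain ⟨D1, hD1, hD1'⟩ := near_bound c⁻¹ β1
  obtain ⟨D2, hD2, hD2'⟩ := near_bound c⁻¹ β2
  refine ⟨4 * A / c + 4 * B / c + (C1 + C2 + D1 + D2) * (1 + c⁻¹), by positivity, ?_⟩
  intro x y hf hV
  have hX := nm_pos x
  have hY := nm_pos y
  have hV0 := norm_pos_iff.mpr hV
  have e1 : ev x y α * ev x y U = - (ev x y β * ev x y V) := by
    have := congrArg (ev x y) hab
    simp only [map_add, map_mul, hf, zero_mul] at this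
    linear_combination this
  have e2 : ev x y α = ev x y α1 * ev x y U + ev x y α2 * ev x y V := by
    have := congrArg (ev x y) hα1
    simp only [map_add, map_mul, hf, mul_zero, add_zero] at this
    exact this
  have e3 : ev x y β = ev x y β1 * ev x y U + ev x y β2 * ev x y V := by
    have := congrArg (ev x y) hβ1
    simp only [map_add, map_mul, hf, mul_zero, add_zero] at this
    exact this
  have hx2 : 1 + ‖x‖ ≤ 2 * nm x := by linarith [nm_one x, nm_norm x]
  have hp : nm x ^ p = nm x ^ (p - 1) * nm x := by
    rw [← pow_succ]; congr 1; have := H.hp; omega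
  have hm : nm y ^ m = nm y ^ (m - 1) * nm y := by
    rw [← pow_succ]; congr 1; have := H.hm; omega
  have key : ∀ (D : ℝ) (z : ℂ), 0 ≤ D → ‖z‖ ≤ D * (nm x ^ (p - 1) * nm y ^ (m - 1)) →
      ‖z‖ * (1 + ‖x‖) ≤ 2 * D * (nm x ^ p * nm y ^ m) := by
    intro D z hD hz
    calc ‖z‖ * (1 + ‖x‖) ≤ (D * (nm x ^ (p - 1) * nm y ^ (m - 1))) * (2 * nm x) := by gcongr
      _ = 2 * D * (nm x ^ p * nm y ^ (m - 1)) * 1 := by rw [hp]; ring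
      _ ≤ 2 * D * (nm x ^ p * nm y ^ (m - 1)) * nm y := by
          have := nm_one y
          gcongr
      _ = _ := by rw [hm]; ring
  have hS : 0 < nm x ^ p * nm y ^ m := by positivity
  set S := nm x ^ p * nm y ^ m
  set P := nm x ^ (p - 1) * nm y ^ (m - 1)
  by_cases hreg : 1 ≤ c * (nm x * nm y)
  · have hlow := hfar x y hreg
    have goal1 : ‖ev x y α‖ * (1 + ‖x‖) ≤ (4 * A / c + 4 * B / c) * ‖ev x y V‖ := by
      rw [← add_div, div_mul_eq_mul_div, le_div_iff₀ hc]
      by_cases hUV : ‖ev x y U‖ ≤ ‖ev x y V‖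
      · have k1 := key A _ hA (hA' x y)
        have k2 : c * S ≤ 2 * ‖ev x y V‖ := by linarith
        nlinarith [mul_le_mul_of_nonneg_left k2 hA, mul_le_mul_of_nonneg_right k1 hc.le,
          mul_nonneg hB hV0.le]
      · push Not at hUV
        have k1 := key B _ hB (hB' x y)
        have k2 : c * S ≤ 2 * ‖ev x y U‖ := by linarith
        have hU0 : 0 < ‖ev x y U‖ := lt_trans hV0 hUV
        have k3 : ‖ev x y α‖ * ‖ev x y U‖ = ‖ev x y β‖ * ‖ev x y V‖ := by
          rw [← norm_mul, e1, norm_neg, norm_mul]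
        have k4 : ‖ev x y α‖ * (1 + ‖x‖) * c * ‖ev x y U‖
            ≤ (4 * B * ‖ev x y V‖) * ‖ev x y U‖ := by
          calc ‖ev x y α‖ * (1 + ‖x‖) * c * ‖ev x y U‖
              = (‖ev x y β‖ * (1 + ‖x‖)) * c * ‖ev x y V‖ := by
                linear_combination (1 + ‖x‖) * c * k3
            _ ≤ (2 * B * S) * c * ‖ev x y V‖ := by gcongr
            _ = 2 * B * (c * S) * ‖ev x y V‖ := by ring
            _ ≤ 2 * B * (2 * ‖ev x y U‖) * ‖ev x y V‖ := by gcongr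
            _ = _ := by ring
        have k5 := le_of_mul_le_mul_right k4 hU0
        nlinarith [mul_nonneg hA hV0.le]
    have : 0 ≤ (C1 + C2 + D1 + D2) * (1 + c⁻¹) * ‖ev x y V‖ := by positivity
    linarith
  · push Not at hreg
    have hXY : nm x * nm y ≤ c⁻¹ := by
      rw [le_inv_comm₀ (by positivity) hc, ← one_div, le_div_iff₀ (by positivity)]
      exact hreg.le
    have hx3 : nm x ≤ c⁻¹ := le_trans (by nlinarith [nm_one x, nm_one y]) hXY
    have hy3 : nm y ≤ c⁻¹ := le_trans (by nlinarith [nm_one x, nm_one y]) hXY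
    have b1 := hC1' x y hx3 hy3
    have b2 := hC2' x y hx3 hy3
    have b3 := hD1' x y hx3 hy3
    have b4 := hD2' x y hx3 hy3
    have b5 : ‖x‖ ≤ c⁻¹ := (nm_norm x).trans hx3
    have goal1 : ‖ev x y α‖ ≤ (C1 + C2 + D1 + D2) * ‖ev x y V‖ := by
      by_cases hUV : ‖ev x y U‖ ≤ ‖ev x y V‖
      · calc ‖ev x y α‖ ≤ ‖ev x y α1‖ * ‖ev x y U‖ + ‖ev x y α2‖ * ‖ev x y V‖ := by
              rw [e2]; refine (norm_add_le _ _).trans ?_; rw [norm_mul, norm_mul]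
          _ ≤ C1 * ‖ev x y V‖ + C2 * ‖ev x y V‖ := by gcongr
          _ ≤ _ := by nlinarith
      · push Not at hUV
        have hU0 : 0 < ‖ev x y U‖ := lt_trans hV0 hUV
        have k3 : ‖ev x y α‖ * ‖ev x y U‖ = ‖ev x y β‖ * ‖ev x y V‖ := by
          rw [← norm_mul, e1, norm_neg, norm_mul]
        have k4 : ‖ev x y β‖ ≤ (D1 + D2) * ‖ev x y U‖ := by
          calc ‖ev x y β‖ ≤ ‖ev x y β1‖ * ‖ev x y U‖ + ‖ev x y β2‖ * ‖ev x y V‖ := by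
                rw [e3]; refine (norm_add_le _ _).trans ?_; rw [norm_mul, norm_mul]
            _ ≤ D1 * ‖ev x y U‖ + D2 * ‖ev x y U‖ := by gcongr
            _ = _ := by ring
        have k5 : ‖ev x y α‖ * ‖ev x y U‖ ≤ ((D1 + D2) * ‖ev x y V‖) * ‖ev x y U‖ := by
          rw [k3]; nlinarith
        have k6 := le_of_mul_le_mul_right k5 hU0
        nlinarith
    have : 0 ≤ (4 * A / c + 4 * B / c) * ‖ev x y V‖ := by positivity
    calc ‖ev x y α‖ * (1 + ‖x‖) ≤ ((C1 + C2 + D1 + D2) * ‖ev x y V‖) * (1 + c⁻¹) := by gcongr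
      _ ≤ _ := by nlinarith


/-! ### Low-degree syzygies -/

theorem xc_mul {n p s m : ℕ} {α U : BP} (hα : α ∈ BD n s) (hU : U ∈ BD p m) :
    xc (n + p) (α * U) = xc n α * xc p U := by
  ext l
  rw [xc_coeff, Polynomial.coeff_mul, Polynomial.coeff_mul, Polynomial.finsetSum_coeff]
  apply Finset.sum_congr rfl
  intro i _
  rw [Polynomial.coeff_mul_add_eq_of_natDegree_le (BD_coeff_natDegree hα _)
    (BD_coeff_natDegree hU _), xc_coeff, xc_coeff]

theorem syz_zero {p m : ℕ} {U V : BP} (H : BoxHyp p m U V) {α β : BP}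
    (hα : α ∈ BD (p - 1) (m - 1)) (hβ : β ∈ BD (p - 1) (m - 1)) (h : α * U + β * V = 0) :
    α = 0 ∧ β = 0 := by
  have hm := H.hm
  have key : ∀ n, α ∈ BD n (m - 1) → β ∈ BD n (m - 1) → xc n α = 0 ∧ xc n β = 0 := by
    intro n h1 h2
    have e : xc n α * xc p U + xc n β * xc p V = 0 := by
      rw [← xc_mul h1 H.hU, ← xc_mul h2 H.hV]
      ext l
      rw [Polynomial.coeff_add, xc_coeff, xc_coeff, ← Polynomial.coeff_add, ← Polynomial.coeff_add,
        h]
      simp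
    have hz : ∀ g ∈ BD n (m - 1), ∀ k, m ≤ k → (xc n g).coeff k = 0 := by
      intro g hg k hk
      rw [xc_coeff]
      exact hg n k (Or.inr (by omega))
    exact cop_aux m _ _ _ _ H.hcx H.htop (xc_natDegree H.hU) (xc_natDegree H.hV)
      (hz _ h1) (hz _ h2) e
  have low : ∀ n (g : BP), g ∈ BD (n + 1) (m - 1) → xc (n + 1) g = 0 → g ∈ BD n (m - 1) := by
    intro n g hg h0 k l hkl
    by_cases hk : k = n + 1
    · subst hk
      have := congrArg (fun q => Polynomial.coeff q l) h0
      simpa using this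
    · exact hg k l (by omega)
  have main : ∀ n, α ∈ BD n (m - 1) → β ∈ BD n (m - 1) → α = 0 ∧ β = 0 := by
    intro n
    induction n with
    | zero =>
      intro h1 h2
      obtain ⟨h3, h4⟩ := key 0 h1 h2
      have hz : ∀ g ∈ BD 0 (m - 1), xc 0 g = 0 → g = 0 := by
        intro g hg h0
        ext l k
        rcases Nat.eq_zero_or_pos k with hk | hk
        · subst hk
          have := congrArg (fun q => Polynomial.coeff q l) h0
          simpa using this
        · simpa using hg k l (Or.inl hk)
      exact ⟨hz _ h1 h3, hz _ h2 h4⟩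
    | succ n ih =>
      intro h1 h2
      obtain ⟨h3, h4⟩ := key _ h1 h2
      exact ih (low n _ h1 h3) (low n _ h2 h4)
  exact main _ hα hβ

theorem lin_rep {E1 E2 A : Type*} [AddCommGroup E1] [Module ℝ E1] [AddCommGroup E2] [Module ℝ E2]
    [AddCommGroup A] [Module ℝ A] [Module.Finite ℝ E1] [Module.Finite ℝ E2] [Module.Finite ℝ A]
    (M : E1 →ₗ[ℝ] E2) (φ : E2 →ₗ[ℝ] A) (hM : ∀ u, M u = 0 → u = 0)
    (hφ : Function.Surjective φ) (h0 : ∀ u, φ (M u) = 0)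
    (hdim : Module.finrank ℝ E2 = Module.finrank ℝ E1 + Module.finrank ℝ A) (v : E2)
    (hv : φ v = 0) : ∃ u, M u = v := by
  have hle : LinearMap.range M ≤ LinearMap.ker φ := by
    rintro _ ⟨u, rfl⟩
    exact h0 u
  have hM' : Function.Injective M := by
    rw [← LinearMap.ker_eq_bot, LinearMap.ker_eq_bot']
    exact hM
  have h1 := LinearMap.finrank_range_of_inj hM'
  have h2 := LinearMap.finrank_range_add_finrank_ker φ
  rw [LinearMap.range_eq_top.mpr hφ, finrank_top] at h2
  have heq := Submodule.eq_of_le_of_finrank_eq hle (by omega)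
  have : v ∈ LinearMap.range M := by rw [heq]; exact hv
  exact this

theorem pair_rep {p m : ℕ} {U V : BP} (H : BoxHyp p m U V)
    {A : Type*} [CommRing A] [Algebra ℝ A] (Q : QuotData U V A) (G : BP)
    (hG : G ∈ BD (2 * p - 1) (2 * m - 1)) (hGI : G ∈ Ideal.span {U, V}) :
    ∃ α ∈ BD (p - 1) (m - 1), ∃ β ∈ BD (p - 1) (m - 1), G = α * U + β * V := by
  have hp := H.hp
  have hm := H.hm
  have := Q.finite H
  let φ : BD (2 * p - 1) (2 * m - 1) →ₗ[ℝ] A :=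
    Q.π.toLinearMap.comp (BD (2 * p - 1) (2 * m - 1)).subtype
  have hφ : Function.Surjective φ := by
    intro t
    obtain ⟨g, rfl⟩ := Q.surj t
    obtain ⟨h, hh, hgh⟩ := box_span H g
    refine ⟨⟨h, BD_mono le_rfl (by omega) hh⟩, ?_⟩
    have := (Q.ker _).mpr hgh
    rw [map_sub, sub_eq_zero] at this
    exact this.symm
  let M : (BD (p - 1) (m - 1) × BD (p - 1) (m - 1)) →ₗ[ℝ] BD (2 * p - 1) (2 * m - 1) :=
    { toFun := fun ab => ⟨ab.1.1 * U + ab.2.1 * V, by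
        apply Submodule.add_mem
        · exact BD_mono (by omega) (by omega) (BD_mul ab.1.2 H.hU)
        · exact BD_mono (by omega) (by omega) (BD_mul ab.2.2 H.hV)⟩
      map_add' := by
        intro u v
        apply Subtype.ext
        simp only [Prod.fst_add, Prod.snd_add, Submodule.coe_add]
        ring
      map_smul' := by
        intro c u
        apply Subtype.ext
        simp [smul_add] }
  have hM : ∀ u, M u = 0 → u = 0 := by
    rintro ⟨α, β⟩ h0
    have := congrArg Subtype.val h0
    obtain ⟨h1, h2⟩ := syz_zero H α.2 β.2 this
    ext1
    · exact Subtype.ext h1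
    · exact Subtype.ext h2
  have h0 : ∀ u, φ (M u) = 0 := by
    intro ab
    show Q.π (ab.1.1 * U + ab.2.1 * V) = 0
    rw [Q.ker]
    exact Ideal.mem_span_pair.mpr ⟨_, _, rfl⟩
  have hdim : Module.finrank ℝ (BD (2 * p - 1) (2 * m - 1)) =
      Module.finrank ℝ (BD (p - 1) (m - 1) × BD (p - 1) (m - 1)) + Module.finrank ℝ A := by
    have : Module.Free ℝ (BD (p - 1) (m - 1)) := Module.Free.of_equiv (BDequiv _ _).symm
    rw [Module.finrank_prod, BD_finrank, BD_finrank, Q.finrank H]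
    obtain ⟨p, rfl⟩ : ∃ k, p = k + 1 := ⟨p - 1, by omega⟩
    obtain ⟨m, rfl⟩ : ∃ k, m = k + 1 := ⟨m - 1, by omega⟩
    have e1 : 2 * (p + 1) - 1 + 1 = 2 * (p + 1) := by omega
    have e2 : 2 * (m + 1) - 1 + 1 = 2 * (m + 1) := by omega
    rw [e1, e2]
    simp only [Nat.add_sub_cancel]
    ring
  obtain ⟨⟨α, β⟩, h⟩ := lin_rep (E1 := BD (p - 1) (m - 1) × BD (p - 1) (m - 1))
    (E2 := BD (2 * p - 1) (2 * m - 1)) (A := A) M φ hM hφ h0 hdim ⟨G, hG⟩ ((Q.ker _).mpr hGI)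
  exact ⟨α.1, α.2, β.1, β.2, (congrArg Subtype.val h).symm⟩

/-! ### The affine hypotheses -/

/-- hypotheses on the affine polynomial in good coordinates -/
structure AffHyp (a b : ℕ) (f : BP) : Prop where
  ha : 1 ≤ a
  hb : 1 ≤ b
  hf : f ∈ BD (2 * a) (2 * b)
  inf : InfHyp (2 * a) (2 * b) (UU (2 * a) f) (VV (2 * b) f)
  hi : ∀ x y : ℂ, ev x y (UU (2 * a) f) = 0 → ev x y (VV (2 * b) f) = 0 →
    1 + x ^ 2 ≠ 0 ∧ 1 + y ^ 2 ≠ 0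
  htop : Polynomial.aeval Complex.I (f.coeff (2 * b)) ≠ 0
  node : ∀ x y : ℂ, ev x y f = 0 → ev x y (dX f) = 0 → ev x y (dY f) = 0 →
    ev x y (dX (dX f)) * ev x y (dY (dY f)) - ev x y (dX (dY f)) ^ 2 ≠ 0
  nonneg : ∀ x y : ℝ, 0 ≤ ev x y f

section evs
variable {E : Type*} [CommRing E] [Algebra ℝ E]

theorem ev_UU (p : ℕ) (f : BP) (x y : E) :
    ev x y (UU p f) = (1 + x ^ 2) * ev x y (dX f) - p * x * ev x y f := by
  simp [UU]

theorem ev_VV (m : ℕ) (f : BP) (x y : E) :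
    ev x y (VV m f) = (1 + y ^ 2) * ev x y (dY f) - m * y * ev x y f := by
  simp [VV]

theorem dX_one : dX (1 : BP) = 0 := by
  have := dX_C 1
  simpa using this

theorem dY_one : dY (1 : BP) = 0 := by simp [dY]

theorem dX_UU (p : ℕ) (f : BP) (x y : E) : ev x y (dX (UU p f)) =
    2 * x * ev x y (dX f) + (1 + x ^ 2) * ev x y (dX (dX f)) - p * ev x y f
      - p * x * ev x y (dX f) := by
  rw [UU, dX_sub, dX_mul, dX_mul, dX_mul, dX_add, pow_two, dX_mul, dX_one, dX_C, dX_C]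
  simp
  ring

theorem dY_UU (p : ℕ) (f : BP) (x y : E) : ev x y (dY (UU p f)) =
    (1 + x ^ 2) * ev x y (dX (dY f)) - p * x * ev x y (dY f) := by
  rw [UU, dY_sub, dY_mul, dY_mul, dY_mul, dY_add, pow_two, dY_mul, dY_one, dY_C, dY_C, dX_dY]
  simp
  ring

theorem dX_VV (p : ℕ) (f : BP) (x y : E) : ev x y (dX (VV p f)) =
    (1 + y ^ 2) * ev x y (dX (dY f)) - p * y * ev x y (dX f) := by
  rw [VV, dX_sub, dX_mul, dX_mul, dX_mul, dX_add, pow_two, dX_mul, dX_one, dX_C, dX_Y]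
  simp
  ring

theorem dY_VV (p : ℕ) (f : BP) (x y : E) : ev x y (dY (VV p f)) =
    2 * y * ev x y (dY f) + (1 + y ^ 2) * ev x y (dY (dY f)) - p * ev x y f
      - p * y * ev x y (dY f) := by
  rw [VV, dY_sub, dY_mul, dY_mul, dY_mul, dY_add, pow_two, dY_mul, dY_one, dY_C, dY_Y]
  simp
  ring

end evs

section aff
variable {a b : ℕ} {f : BP}

/-- nodes are the common zeros of `f, U, V` -/
theorem AffHyp.node_of (H : AffHyp a b f) {x y : ℂ} (h0 : ev x y f = 0)
    (hU : ev x y (UU (2 * a) f) = 0) (hV : ev x y (VV (2 * b) f) = 0) :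
    ev x y (dX f) = 0 ∧ ev x y (dY f) = 0 := by
  obtain ⟨h1, h2⟩ := H.hi x y hU hV
  rw [ev_UU, h0, mul_zero, sub_zero] at hU
  rw [ev_VV, h0, mul_zero, sub_zero] at hV
  exact ⟨(mul_eq_zero.mp hU).resolve_left h1, (mul_eq_zero.mp hV).resolve_left h2⟩

theorem jac_node {x y : ℂ} (h0 : ev x y f = 0) (hx : ev x y (dX f) = 0)
    (hy : ev x y (dY f) = 0) :
    ev x y (dX (UU (2 * a) f)) * ev x y (dY (VV (2 * b) f))
      - ev x y (dY (UU (2 * a) f)) * ev x y (dX (VV (2 * b) f)) =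
    ((1 + x ^ 2) * (1 + y ^ 2)) *
      (ev x y (dX (dX f)) * ev x y (dY (dY f)) - ev x y (dX (dY f)) ^ 2) := by
  rw [dX_UU, dY_UU, dX_VV, dY_VV, h0, hx, hy]
  ring

theorem node_UV {x y : ℂ} (h0 : ev x y f = 0) (hx : ev x y (dX f) = 0)
    (hy : ev x y (dY f) = 0) :
    ev x y (UU (2 * a) f) = 0 ∧ ev x y (VV (2 * b) f) = 0 := by
  rw [ev_UU, ev_VV, h0, hx, hy]
  simp

theorem AffHyp.jac_ne (H : AffHyp a b f) {x y : ℂ} (h0 : ev x y f = 0) (hx : ev x y (dX f) = 0)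
    (hy : ev x y (dY f) = 0) :
    ev x y (dX (UU (2 * a) f)) * ev x y (dY (VV (2 * b) f))
      - ev x y (dY (UU (2 * a) f)) * ev x y (dX (VV (2 * b) f)) ≠ 0 := by
  rw [jac_node h0 hx hy]
  obtain ⟨hU, hV⟩ := node_UV (a := a) (b := b) h0 hx hy
  obtain ⟨h1, h2⟩ := H.hi x y hU hV
  exact mul_ne_zero (mul_ne_zero h1 h2) (H.node x y h0 hx hy)

variable {A : Type*} [CommRing A] [Algebra ℝ A]

theorem AffHyp.exists_g (H : AffHyp a b f) (Q : QuotData (UU (2 * a) f) (VV (2 * b) f) A)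
    (T : A →ₗ[ℝ] ℝ) (hT : ∀ a, (∀ b, T (a * b) = 0) → a = 0)
    (hTc : ∀ χ : A →ₐ[ℝ] ℂ, ∃ c1 c2 : A, (∀ a, T (c1 * a) = (χ a).re) ∧
      (∀ a, T (c2 * a) = (χ a).im) ∧
      χ c1 + Complex.I * χ c2 =
        ev (χ Q.x) (χ Q.y) (dX (UU (2 * a) f)) * ev (χ Q.x) (χ Q.y) (dY (VV (2 * b) f))
          - ev (χ Q.x) (χ Q.y) (dY (UU (2 * a) f)) * ev (χ Q.x) (χ Q.y) (dX (VV (2 * b) f))) :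
    (∃ g : A, g ^ 2 * ((1 + Q.x ^ 2) * (1 + Q.y ^ 2)) = Q.π f) ∧
    (∀ r : BP, (∀ x y : ℂ, ev x y f = 0 → ev x y (dX f) = 0 → ev x y (dY f) = 0 → ev x y r = 0) →
      ∃ r1 r2 r3 : BP, r = r1 * UU (2 * a) f + r2 * VV (2 * b) f + r3 * f) := by
  have := Q.finite H.inf.box
  have hU : ∀ χ : A →ₐ[ℝ] ℂ, ev (χ Q.x) (χ Q.y) (UU (2 * a) f) = 0 := by
    intro χ
    rw [← ev_comp, Q.U0, map_zero]
  have hV : ∀ χ : A →ₐ[ℝ] ℂ, ev (χ Q.x) (χ Q.y) (VV (2 * b) f) = 0 := by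
    intro χ
    rw [← ev_comp, Q.V0, map_zero]
  have hn : ∀ χ : A →ₐ[ℝ] ℂ, χ (Q.π f) = 0 → ev (χ Q.x) (χ Q.y) f = 0 ∧
      ev (χ Q.x) (χ Q.y) (dX f) = 0 ∧ ev (χ Q.x) (χ Q.y) (dY f) = 0 := by
    intro χ h
    rw [Q.chi] at h
    exact ⟨h, H.node_of h (hU χ) (hV χ)⟩
  obtain ⟨h1, h2⟩ := _root_.exists_g hT (Q.π f) ((1 + Q.x ^ 2) * (1 + Q.y ^ 2))
    (by
      intro χ
      obtain ⟨h1, h2⟩ := H.hi _ _ (hU χ) (hV χ)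
      simpa using And.intro h1 h2)
    (by
      intro χ
      simp only [map_mul, map_add, map_one, map_pow]
      positivity)
    (by
      intro χ
      rw [Q.pi_eq, ev_comp]
      exact H.nonneg _ _)
    (by
      intro χ h
      obtain ⟨c1, c2, h1, h2, h3⟩ := hTc χ
      obtain ⟨n0, n1, n2⟩ := hn χ h
      refine ⟨c1, c2, h1, h2, ?_⟩
      rw [h3]
      exact H.jac_ne n0 n1 n2)
  refine ⟨h1, ?_⟩
  intro r hr
  obtain ⟨s, hs⟩ := h2 (Q.π r) (by
    intro χ h
    obtain ⟨n0, n1, n2⟩ := hn χ h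
    rw [Q.chi]
    exact hr _ _ n0 n1 n2)
  obtain ⟨s, rfl⟩ := Q.surj s
  rw [← map_mul, ← sub_eq_zero, ← map_sub, Q.ker, Ideal.mem_span_pair] at hs
  obtain ⟨r1, r2, h⟩ := hs
  exact ⟨r1, r2, s, by linear_combination -h⟩

/-- base change to `ℂ` -/
noncomputable def bc : BP →+* Polynomial (Polynomial ℂ) :=
  Polynomial.mapRingHom (Polynomial.mapRingHom (algebraMap ℝ ℂ))

theorem e2_bc (x y : ℂ) (g : BP) : e2 x y (bc g) = ev x y g := by
  unfold e2 bc
  rw [Polynomial.coe_mapRingHom, Polynomial.map_map, Polynomial.eval_map, ev_eq]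
  congr 1
  ext r <;> simp

theorem bc_inj : Function.Injective bc :=
  Polynomial.map_injective _ (Polynomial.map_injective _ (algebraMap ℝ ℂ).injective)

theorem bc_coeff (g : BP) (l : ℕ) (x : ℂ) :
    ((bc g).coeff l).eval x = Polynomial.aeval x (g.coeff l) := by
  unfold bc
  rw [Polynomial.coe_mapRingHom, Polynomial.coeff_map, Polynomial.coe_mapRingHom,
    Polynomial.eval_map_algebraMap]

theorem bc_natDegree (g : BP) : (bc g).natDegree ≤ g.natDegree := Polynomial.natDegree_map_le

theorem bc_dY (g : BP) : (bc g).derivative = bc (dY g) := by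
  unfold bc dY
  rw [Polynomial.coe_mapRingHom, Polynomial.derivative_map]

/-- the key injectivity statement -/
theorem AffHyp.star (H : AffHyp a b f) (Q : QuotData (UU (2 * a) f) (VV (2 * b) f) A)
    (h : BP) (hh : h ∈ BD a b) (hfh : Q.π (f * h) = 0) : h = 0 := by
  have ha := H.ha
  have hb := H.hb
  obtain ⟨T, hT, -, hTc⟩ := Q.exists_T H.inf.box
  obtain ⟨-, hr⟩ := H.exists_g Q T hT hTc
  rw [Q.ker] at hfh
  obtain ⟨α, hα, β, hβ, hab⟩ := pair_rep H.inf.box Q (f * h)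
    (BD_mono (by omega) (by omega) (BD_mul H.hf hh)) hfh
  have hnode : ∀ x y : ℂ, ev x y f = 0 → ev x y (dX f) = 0 → ev x y (dY f) = 0 →
      ev x y α = 0 ∧ ev x y β = 0 := by
    intro x y h0 hx hy
    have hj := H.jac_ne h0 hx hy
    obtain ⟨hU, hV⟩ := node_UV (a := a) (b := b) h0 hx hy
    have e1 := congrArg (fun g => ev x y (dX g)) hab
    have e2 := congrArg (fun g => ev x y (dY g)) hab
    simp only [dX_add, dX_mul, dY_add, dY_mul, map_add, map_mul, h0, hx, hy, hU, hV] at e1 e2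
    constructor
    · apply (mul_eq_zero.mp ?_).resolve_right hj
      linear_combination (- ev x y (dY (VV (2 * b) f))) * e1 + (ev x y (dX (VV (2 * b) f))) * e2
    · apply (mul_eq_zero.mp ?_).resolve_right hj
      linear_combination (ev x y (dY (UU (2 * a) f))) * e1 - (ev x y (dX (UU (2 * a) f))) * e2
  obtain ⟨α1, α2, α3, hα1⟩ := hr α (fun x y h0 hx hy => (hnode x y h0 hx hy).1)
  obtain ⟨β1, β2, β3, hβ1⟩ := hr β (fun x y h0 hx hy => (hnode x y h0 hx hy).2)
  obtain ⟨C, hC, hbound⟩ := H.inf.alpha_bound hα hβ hab.symm hα1 hβ1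
  have hdeg : ∀ g ∈ BD (2 * a - 1) (2 * b - 1), (bc g).natDegree < 2 * b := by
    intro g hg
    have := (bc_natDegree g).trans (BD_natDegree hg)
    omega
  have hI : (1 : ℂ) + Complex.I ^ 2 = 0 := by simp
  obtain ⟨E, hE, hs⟩ := norm_vanish (2 * b) (bc f) (bc α) (bc (VV (2 * b) f))
    ((bc_natDegree _).trans (BD_natDegree H.hf)) ((bc_natDegree _).trans (BD_natDegree H.inf.hV))
    (hdeg α hα) Complex.I (by rw [bc_coeff]; exact H.htop)
    (by
      intro y h0 hV
      rw [e2_bc] at h0 hV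
      refine (H.hi Complex.I y ?_ hV).1 hI
      rw [ev_UU, h0, hI]; simp)
    (by
      intro x y h0 hV hd
      rw [e2_bc] at h0 hV
      rw [bc_dY, e2_bc] at hd
      apply hV
      rw [ev_VV, h0, hd]; simp)
    C hC
    (by
      intro x y h0 hV
      rw [e2_bc] at h0 hV
      rw [e2_bc, e2_bc]
      exact hbound x y h0 hV)
  have hα0 : α = 0 := by
    apply bc_inj
    rw [map_zero]
    apply vanish_of_roots (hdeg α hα) hE
    intro x hx
    obtain ⟨s, h1, h2⟩ := hs x hx
    exact ⟨s, h1, fun y hy => (h2 y hy).2.2⟩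
  have hβ0 : β = 0 := by
    apply bc_inj
    rw [map_zero]
    apply vanish_of_roots (hdeg β hβ) hE
    intro x hx
    obtain ⟨s, h1, h2⟩ := hs x hx
    refine ⟨s, h1, fun y hy => ?_⟩
    obtain ⟨h3, h4, -⟩ := h2 y hy
    rw [e2_bc] at h3 h4 ⊢
    have := congrArg (ev x y) hab
    rw [hα0] at this
    simp only [map_mul, map_add, map_zero, h3, zero_mul, zero_add] at this
    exact (mul_eq_zero.mp this.symm).resolve_right h4
  rw [hα0, hβ0, zero_mul, zero_mul, add_zero] at hab
  rcases mul_eq_zero.mp hab with h0 | h0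
  · exfalso
    apply H.htop
    rw [h0]; simp
  · exact h0

end aff


/-! ### Real second-order conditions -/

theorem ev_ofReal (x y : ℝ) (g : BP) : ev (x : ℂ) (y : ℂ) g = ((ev x y g : ℝ) : ℂ) := by
  have := ev_comp Complex.ofRealAm x y g
  simpa using this.symm

theorem chain_rule (P R : Polynomial ℝ) (g : BP) :
    Polynomial.derivative (ev P R g) =
      ev P R (dX g) * Polynomial.derivative P + ev P R (dY g) * Polynomial.derivative R := by
  have hC : ∀ q : Polynomial ℝ, Polynomial.derivative (ev P R (Polynomial.C q)) =
      ev P R (dX (Polynomial.C q)) * Polynomial.derivative P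
        + ev P R (dY (Polynomial.C q)) * Polynomial.derivative R := by
    intro q
    rw [dX_C, dY_C, ev_C, ev_C, map_zero, zero_mul, add_zero, ← Polynomial.comp_eq_aeval,
      ← Polynomial.comp_eq_aeval, Polynomial.derivative_comp]
    ring
  have hmul : ∀ g h : BP,
      (Polynomial.derivative (ev P R g) =
        ev P R (dX g) * Polynomial.derivative P + ev P R (dY g) * Polynomial.derivative R) →
      (Polynomial.derivative (ev P R h) =
        ev P R (dX h) * Polynomial.derivative P + ev P R (dY h) * Polynomial.derivative R) →
      (Polynomial.derivative (ev P R (g * h)) =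
        ev P R (dX (g * h)) * Polynomial.derivative P
          + ev P R (dY (g * h)) * Polynomial.derivative R) := by
    intro g h hg hh
    rw [dX_mul, dY_mul]
    simp only [map_add, map_mul, Polynomial.derivative_mul, hg, hh]
    ring
  induction g using Polynomial.induction_on with
  | C q => exact hC q
  | add g h hg hh =>
    rw [dX_add, dY_add]
    simp only [map_add, hg, hh]
    ring
  | monomial n q ih =>
    rw [pow_succ, ← mul_assoc]
    apply hmul _ _ ih
    rw [dX_Y, dY_Y]
    simp

theorem poly_nonneg_second (P : Polynomial ℝ) (h : ∀ s, 0 ≤ P.eval s) (h0 : P.eval 0 = 0) :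
    (Polynomial.derivative P).eval 0 = 0 ∧
      0 ≤ (Polynomial.derivative (Polynomial.derivative P)).eval 0 := by
  have h1 : (Polynomial.derivative P).eval 0 = 0 := by
    have hmin : IsLocalMin (fun s => P.eval s) 0 := by
      apply Filter.Eventually.of_forall
      intro s
      show P.eval 0 ≤ P.eval s
      rw [h0]; exact h s
    have := hmin.deriv_eq_zero
    rwa [Polynomial.deriv] at this
  refine ⟨h1, ?_⟩
  have c0 : P.coeff 0 = 0 := by rwa [Polynomial.coeff_zero_eq_eval_zero]
  have c1 : P.coeff 1 = 0 := by
    rw [← Polynomial.coeff_zero_eq_eval_zero, Polynomial.coeff_derivative] at h1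
    simpa using h1
  have hdvd : Polynomial.X ^ 2 ∣ P := by
    rw [Polynomial.X_pow_dvd_iff]
    intro d hd
    interval_cases d
    · exact c0
    · exact c1
  obtain ⟨R, hR⟩ := hdvd
  have hclosed : IsClosed {s : ℝ | 0 ≤ R.eval s} :=
    isClosed_le continuous_const R.continuous
  have hsub : ({0}ᶜ : Set ℝ) ⊆ {s : ℝ | 0 ≤ R.eval s} := by
    intro s hs
    have hs : s ≠ 0 := hs
    have := h s
    rw [hR] at this
    simp only [Polynomial.eval_mul, Polynomial.eval_pow, Polynomial.eval_X] at this
    exact nonneg_of_mul_nonneg_right this (by positivity)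
  have h2 : (0 : ℝ) ∈ {s : ℝ | 0 ≤ R.eval s} :=
    (hclosed.closure_subset_iff.mpr hsub) ((dense_compl_singleton (0 : ℝ)) 0)
  have h3 : (Polynomial.derivative (Polynomial.derivative P)).eval 0 = 2 * R.eval 0 := by
    rw [hR]
    simp
    left
    norm_num
  rw [h3]
  have : 0 ≤ R.eval 0 := h2
  linarith

theorem quad_nonneg (A B C : ℝ) (h : ∀ u v : ℝ, 0 ≤ A * u ^ 2 + 2 * B * u * v + C * v ^ 2) :
    0 ≤ A * C - B ^ 2 := by
  by_contra hneg
  push Not at hneg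
  have hA := h 1 0
  have hC := h 0 1
  have h1 := h C (-B)
  have h2 := h (-B) A
  have e1 : 0 ≤ C * (A * C - B ^ 2) := by nlinarith
  have e2 : 0 ≤ A * (A * C - B ^ 2) := by nlinarith
  have hA0 : A = 0 := by nlinarith
  have hC0 : C = 0 := by nlinarith
  have h3 := h 1 1
  have h4 := h 1 (-1)
  have : B = 0 := by nlinarith
  subst hA0 hC0 this
  simp at hneg

theorem real_zero_second {f : BP} (hf : ∀ x y : ℝ, 0 ≤ ev x y f) {x y : ℝ} (h0 : ev x y f = 0) :
    ev x y (dX f) = 0 ∧ ev x y (dY f) = 0 ∧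
      0 ≤ ev x y (dX (dX f)) * ev x y (dY (dY f)) - ev x y (dX (dY f)) ^ 2 := by
  have key : ∀ u v : ℝ, ev x y (dX f) * u + ev x y (dY f) * v = 0 ∧
      0 ≤ ev x y (dX (dX f)) * u ^ 2 + 2 * ev x y (dX (dY f)) * u * v
        + ev x y (dY (dY f)) * v ^ 2 := by
    intro u v
    set P : Polynomial ℝ := Polynomial.C x + Polynomial.C u * Polynomial.X with hP
    set R : Polynomial ℝ := Polynomial.C y + Polynomial.C v * Polynomial.X with hR
    have hev : ∀ (g : BP) (s : ℝ), (ev P R g).eval s = ev (x + u * s) (y + v * s) g := by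
      intro g s
      have := ev_comp (Polynomial.aeval s : Polynomial ℝ →ₐ[ℝ] ℝ) P R g
      rw [Polynomial.aeval_def, Algebra.algebraMap_self, Polynomial.eval₂_id] at this
      rw [this]
      simp [hP, hR]
    have hev0 : ∀ g : BP, (ev P R g).eval 0 = ev x y g := by
      intro g; rw [hev]; simp
    have dP : Polynomial.derivative P = Polynomial.C u := by simp [hP]
    have dR : Polynomial.derivative R = Polynomial.C v := by simp [hR]
    obtain ⟨h1, h2⟩ := poly_nonneg_second (ev P R f) (fun s => by rw [hev]; exact hf _ _)
      (by rw [hev0, h0])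
    have d1 : Polynomial.derivative (ev P R f) =
        ev P R (dX f) * Polynomial.C u + ev P R (dY f) * Polynomial.C v := by
      rw [chain_rule, dP, dR]
    rw [d1] at h1 h2
    constructor
    · simpa [hev0] using h1
    · simp only [Polynomial.derivative_add, Polynomial.derivative_mul, Polynomial.derivative_C,
        mul_zero, add_zero, chain_rule, dP, dR] at h2
      simp only [Polynomial.eval_add, Polynomial.eval_mul, Polynomial.eval_C, hev0, ← dX_dY] at h2
      linarith
  refine ⟨by simpa using (key 1 0).1, by simpa using (key 0 1).1, ?_⟩
  exact quad_nonneg _ _ _ (fun u v => (key u v).2)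


/-! ### The affine core bound -/

theorem euler_natDegree {R : Type*} [CommRing R] (p : ℕ) (hp : 1 ≤ p) (q : Polynomial R)
    (h : q.natDegree ≤ p) :
    (Polynomial.C (p : R) * q - Polynomial.X * Polynomial.derivative q).natDegree ≤ p - 1 := by
  rw [Polynomial.natDegree_le_iff_coeff_eq_zero]
  intro n hn
  rw [Polynomial.natDegree_le_iff_coeff_eq_zero] at h
  obtain ⟨k, rfl⟩ : ∃ k, n = k + 1 := ⟨n - 1, by omega⟩
  rw [Polynomial.coeff_sub, Polynomial.coeff_C_mul, Polynomial.coeff_X_mul,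
    Polynomial.coeff_derivative]
  by_cases hk : k + 1 = p
  · subst hk; push_cast; ring
  · rw [h (k + 1) (by omega)]; ring

theorem eulX_mem {p m : ℕ} (hp : 1 ≤ p) {f : BP} (hf : f ∈ BD p m) :
    Polynomial.C (Polynomial.C (p : ℝ)) * f - Polynomial.C Polynomial.X * dX f
      ∈ BD (p - 1) m := by
  have hco : ∀ l, (Polynomial.C (Polynomial.C (p : ℝ)) * f
      - Polynomial.C Polynomial.X * dX f).coeff l =
      Polynomial.C (p : ℝ) * f.coeff l - Polynomial.X * Polynomial.derivative (f.coeff l) := by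
    intro l
    rw [Polynomial.coeff_sub, Polynomial.coeff_C_mul, Polynomial.coeff_C_mul, dX_coeff]
  apply mem_BD_of
  · rw [Polynomial.natDegree_le_iff_coeff_eq_zero]
    intro n hn
    rw [hco, Polynomial.coeff_eq_zero_of_natDegree_lt (lt_of_le_of_lt (BD_natDegree hf) hn)]
    simp
  · intro l
    rw [hco]
    exact euler_natDegree p hp _ (BD_coeff_natDegree hf l)

theorem eulY_mem {p m : ℕ} (hm : 1 ≤ m) {f : BP} (hf : f ∈ BD p m) :
    Polynomial.C (Polynomial.C (m : ℝ)) * f - Polynomial.X * dY f ∈ BD p (m - 1) := by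
  apply mem_BD_of
  · have := euler_natDegree m hm f (BD_natDegree hf)
    unfold dY
    simpa using this
  · intro l
    have h1 : Polynomial.C (Polynomial.C (m : ℝ)) * f - Polynomial.X * dY f
        ∈ BD (0 + p) (1 + m) := by
      apply Submodule.sub_mem
      · exact BD_mul (C_mem_BD (r := 0) (Polynomial.C (m : ℝ)) (by simp) 1) hf
      · exact BD_mul Y_mem_BD (dY_mem_BD' hf)
    have := BD_coeff_natDegree h1 l
    simpa using this

theorem iso_of {A : Type*} [CommRing A] [Algebra ℝ A] (π : BP →ₐ[ℝ] A) (T : A →ₗ[ℝ] ℝ) {K N : ℕ}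
    (hT : ∀ k l, k ≤ K → l ≤ N → T (π (mon k l)) = 0) {g : BP} (hg : g ∈ BD K N) :
    T (π g) = 0 :=
  BD_lin hg (T ∘ₗ π.toLinearMap) hT

theorem lam_solve {K N : ℕ} (hK : 1 ≤ K) (hN : 1 ≤ N) (Λ : ℕ → ℕ → ℝ)
    (h1 : ∀ k l, k + 2 ≤ K → l ≤ N → Λ (k + 2) l = - Λ k l)
    (h2 : ∀ k l, k ≤ K → l + 2 ≤ N → Λ k (l + 2) = - Λ k l) :
    ∃ c1 c2 : ℂ, ∀ k l, k ≤ K → l ≤ N → Λ k l =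
      (c1 * (Complex.I ^ k * Complex.I ^ l) + c2 * (Complex.I ^ k * (-Complex.I) ^ l)).re := by
  refine ⟨⟨(Λ 0 0 - Λ 1 1) / 2, (- Λ 1 0 - Λ 0 1) / 2⟩,
    ⟨(Λ 0 0 + Λ 1 1) / 2, (- Λ 1 0 + Λ 0 1) / 2⟩, ?_⟩
  set c1 : ℂ := ⟨(Λ 0 0 - Λ 1 1) / 2, (- Λ 1 0 - Λ 0 1) / 2⟩
  set c2 : ℂ := ⟨(Λ 0 0 + Λ 1 1) / 2, (- Λ 1 0 + Λ 0 1) / 2⟩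
  have base : ∀ k l, k ≤ 1 → l ≤ 1 → Λ k l =
      (c1 * (Complex.I ^ k * Complex.I ^ l) + c2 * (Complex.I ^ k * (-Complex.I) ^ l)).re := by
    intro k l hk hl
    interval_cases k <;> interval_cases l <;> simp [c1, c2] <;> ring
  have row : ∀ k l, k ≤ 1 → l ≤ N → Λ k l =
      (c1 * (Complex.I ^ k * Complex.I ^ l) + c2 * (Complex.I ^ k * (-Complex.I) ^ l)).re := by
    intro k l hk
    induction l using Nat.strong_induction_on with
    | _ l ih =>
      intro hl
      rcases Nat.lt_or_ge l 2 with h | h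
      · exact base k l hk (by omega)
      · obtain ⟨l, rfl⟩ : ∃ j, l = j + 2 := ⟨l - 2, by omega⟩
        rw [h2 k l (by omega) hl, ih l (by omega) (by omega), ← Complex.neg_re]
        congr 1
        rw [pow_add, pow_add, neg_sq, Complex.I_sq]
        ring
  intro k
  induction k using Nat.strong_induction_on with
  | _ k ih =>
    intro l hk hl
    rcases Nat.lt_or_ge k 2 with h | h
    · exact row k l (by omega) hl
    · obtain ⟨k, rfl⟩ : ∃ j, k = j + 2 := ⟨k - 2, by omega⟩
      rw [h1 k l hk hl, ih k (by omega) l (by omega) hl, ← Complex.neg_re]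
      congr 1
      rw [pow_add, Complex.I_sq]
      ring

/-- the real functional picking the sign -/
noncomputable def pick (c : ℂ) : ℂ →ₗ[ℝ] ℝ :=
  open Classical in if 0 ≤ c.re then Complex.imLm else Complex.reLm

theorem pick_pos (c z : ℂ) (h : pick c z = 0) : 0 ≤ (c * z ^ 2).re := by
  unfold pick at h
  rw [pow_two]
  split_ifs at h with hc
  · have h : z.im = 0 := h
    simp only [Complex.mul_re, Complex.mul_im, h]
    nlinarith [mul_nonneg hc (sq_nonneg z.re)]
  · have h : z.re = 0 := h
    push Not at hc
    simp only [Complex.mul_re, Complex.mul_im, h]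
    nlinarith [mul_nonneg (neg_nonneg.mpr hc.le) (sq_nonneg z.im)]

section core
variable {a b : ℕ} {f : BP} {A : Type*} [CommRing A] [Algebra ℝ A]

theorem AffHyp.unitsQ (H : AffHyp a b f) (Q : QuotData (UU (2 * a) f) (VV (2 * b) f) A) :
    IsUnit (1 + Q.x ^ 2) ∧ IsUnit (1 + Q.y ^ 2) := by
  have := Q.finite H.inf.box
  have h : ∀ χ : A →ₐ[ℝ] ℂ, 1 + (χ Q.x) ^ 2 ≠ 0 ∧ 1 + (χ Q.y) ^ 2 ≠ 0 := by
    intro χ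
    apply H.hi
    · rw [← ev_comp, Q.U0, map_zero]
    · rw [← ev_comp, Q.V0, map_zero]
  constructor
  · apply unit_of_char
    intro χ
    simpa using (h χ).1
  · apply unit_of_char
    intro χ
    simpa using (h χ).2

theorem AffHyp.lam (H : AffHyp a b f) (Q : QuotData (UU (2 * a) f) (VV (2 * b) f) A)
    (T : A →ₗ[ℝ] ℝ)
    (hTm : ∀ k l, k ≤ 2 * (2 * a) - 2 → l ≤ 2 * (2 * b) - 2 → T (Q.π (mon k l)) = 0)
    (g : A) (hg : g ^ 2 * ((1 + Q.x ^ 2) * (1 + Q.y ^ 2)) = Q.π f) :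
    (∀ k l, k + 2 ≤ 2 * a → l ≤ 2 * b → T (g ^ 2 * (Q.x ^ (k + 2) * Q.y ^ l))
      = - T (g ^ 2 * (Q.x ^ k * Q.y ^ l))) ∧
    (∀ k l, k ≤ 2 * a → l + 2 ≤ 2 * b → T (g ^ 2 * (Q.x ^ k * Q.y ^ (l + 2)))
      = - T (g ^ 2 * (Q.x ^ k * Q.y ^ l))) := by
  have ha := H.ha
  have hb := H.hb
  obtain ⟨ux, uy⟩ := H.unitsQ Q
  have hU := Q.U0
  have hV := Q.V0
  rw [ev_UU] at hU
  rw [ev_VV] at hV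
  have hf : ev Q.x Q.y f = g ^ 2 * ((1 + Q.x ^ 2) * (1 + Q.y ^ 2)) := by rw [← Q.pi_eq, hg]
  have ha0 : (2 * a : ℝ) ≠ 0 := by positivity
  have hb0 : (2 * b : ℝ) ≠ 0 := by positivity
  constructor
  · have hfy : ev Q.x Q.y (dY f) = ((2 * b : ℕ) : A) * Q.y * (g ^ 2 * (1 + Q.x ^ 2)) := by
      apply uy.mul_left_cancel
      rw [hf] at hV
      linear_combination hV
    have hfe : ev Q.x Q.y (Polynomial.C (Polynomial.C ((2 * b : ℕ) : ℝ)) * f - Polynomial.X * dY f)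
        = ((2 * b : ℕ) : A) * (g ^ 2 * (1 + Q.x ^ 2)) := by
      simp only [map_sub, map_mul, hfy, hf, ev_C, ev_Y, Polynomial.aeval_C, map_natCast]
      ring
    have main : ∀ k l, k + 2 ≤ 2 * a → l ≤ 2 * b →
        (2 * b : ℝ) * T (g ^ 2 * (1 + Q.x ^ 2) * (Q.x ^ k * Q.y ^ l)) = 0 := by
      intro k l hk hl
      rw [← smul_eq_mul, ← map_smul]
      rcases Nat.lt_or_ge l (2 * b) with h | h
      · have e : (2 * b : ℝ) • (g ^ 2 * (1 + Q.x ^ 2) * (Q.x ^ k * Q.y ^ l)) =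
            Q.π ((Polynomial.C (Polynomial.C ((2 * b : ℕ) : ℝ)) * f - Polynomial.X * dY f)
              * mon k l) := by
          rw [map_mul, Q.pi_mon, Q.pi_eq, hfe, Algebra.smul_def]
          push_cast
          simp only [map_mul, map_ofNat, map_natCast]
          ring
        rw [e]
        apply iso_of Q.π T hTm
        exact BD_mono (by omega) (by omega)
          (BD_mul (eulY_mem (by omega) H.hf) (mon_mem_BD k l))
      · obtain rfl : l = (2 * b - 1) + 1 := by omega
        have e : (2 * b : ℝ) • (g ^ 2 * (1 + Q.x ^ 2) * (Q.x ^ k * Q.y ^ ((2 * b - 1) + 1))) =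
            Q.π (dY f * mon k (2 * b - 1)) := by
          rw [map_mul, Q.pi_mon, Q.pi_eq, hfy, Algebra.smul_def, pow_succ]
          push_cast
          simp only [map_mul, map_ofNat, map_natCast]
          ring
        rw [e]
        apply iso_of Q.π T hTm
        have hfy' : dY f ∈ BD (2 * a) (2 * b - 1) := by
          apply dY_mem_BD
          have e : 2 * b - 1 + 1 = 2 * b := by omega
          rw [e]; exact H.hf
        exact BD_mono (by omega) (by omega) (BD_mul hfy' (mon_mem_BD k _))
    intro k l hk hl
    have := (mul_eq_zero.mp (main k l hk hl)).resolve_left hb0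
    rw [eq_neg_iff_add_eq_zero, ← map_add, ← this]
    congr 1
    ring
  · have hfx : ev Q.x Q.y (dX f) = ((2 * a : ℕ) : A) * Q.x * (g ^ 2 * (1 + Q.y ^ 2)) := by
      apply ux.mul_left_cancel
      rw [hf] at hU
      linear_combination hU
    have hfe : ev Q.x Q.y (Polynomial.C (Polynomial.C ((2 * a : ℕ) : ℝ)) * f
        - Polynomial.C Polynomial.X * dX f)
        = ((2 * a : ℕ) : A) * (g ^ 2 * (1 + Q.y ^ 2)) := by
      simp only [map_sub, map_mul, hfx, hf, ev_C, Polynomial.aeval_C, Polynomial.aeval_X,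
        map_natCast]
      ring
    have main : ∀ k l, k ≤ 2 * a → l + 2 ≤ 2 * b →
        (2 * a : ℝ) * T (g ^ 2 * (1 + Q.y ^ 2) * (Q.x ^ k * Q.y ^ l)) = 0 := by
      intro k l hk hl
      rw [← smul_eq_mul, ← map_smul]
      rcases Nat.lt_or_ge k (2 * a) with h | h
      · have e : (2 * a : ℝ) • (g ^ 2 * (1 + Q.y ^ 2) * (Q.x ^ k * Q.y ^ l)) =
            Q.π ((Polynomial.C (Polynomial.C ((2 * a : ℕ) : ℝ)) * f
              - Polynomial.C Polynomial.X * dX f) * mon k l) := by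
          rw [map_mul, Q.pi_mon, Q.pi_eq, hfe, Algebra.smul_def]
          push_cast
          simp only [map_mul, map_ofNat, map_natCast]
          ring
        rw [e]
        apply iso_of Q.π T hTm
        exact BD_mono (by omega) (by omega)
          (BD_mul (eulX_mem (by omega) H.hf) (mon_mem_BD k l))
      · obtain rfl : k = (2 * a - 1) + 1 := by omega
        have e : (2 * a : ℝ) • (g ^ 2 * (1 + Q.y ^ 2) * (Q.x ^ ((2 * a - 1) + 1) * Q.y ^ l)) =
            Q.π (dX f * mon (2 * a - 1) l) := by
          rw [map_mul, Q.pi_mon, Q.pi_eq, hfx, Algebra.smul_def, pow_succ]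
          push_cast
          simp only [map_mul, map_ofNat, map_natCast]
          ring
        rw [e]
        apply iso_of Q.π T hTm
        have hfx' : dX f ∈ BD (2 * a - 1) (2 * b) := by
          apply dX_mem_BD
          have e : 2 * a - 1 + 1 = 2 * a := by omega
          rw [e]; exact H.hf
        exact BD_mono (by omega) (by omega) (BD_mul hfx' (mon_mem_BD _ l))
    intro k l hk hl
    have := (mul_eq_zero.mp (main k l hk hl)).resolve_left ha0
    rw [eq_neg_iff_add_eq_zero, ← map_add, ← this]
    congr 1
    ring

theorem AffHyp.sq_form (H : AffHyp a b f) (Q : QuotData (UU (2 * a) f) (VV (2 * b) f) A)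
    (T : A →ₗ[ℝ] ℝ)
    (hTm : ∀ k l, k ≤ 2 * (2 * a) - 2 → l ≤ 2 * (2 * b) - 2 → T (Q.π (mon k l)) = 0)
    (g : A) (hg : g ^ 2 * ((1 + Q.x ^ 2) * (1 + Q.y ^ 2)) = Q.π f) :
    ∃ c1 c2 : ℂ, ∀ h ∈ BD (2 * a) (2 * b), T (g ^ 2 * Q.π h) =
      (c1 * ev Complex.I Complex.I h + c2 * ev Complex.I (-Complex.I) h).re := by
  have ha := H.ha
  have hb := H.hb
  obtain ⟨l1, l2⟩ := H.lam Q T hTm g hg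
  obtain ⟨c1, c2, hc⟩ := lam_solve (K := 2 * a) (N := 2 * b) (by omega) (by omega)
    (fun k l => T (g ^ 2 * (Q.x ^ k * Q.y ^ l))) l1 l2
  refine ⟨c1, c2, ?_⟩
  intro h hh
  let T1 : BP →ₗ[ℝ] ℝ := T ∘ₗ (LinearMap.mulLeft ℝ (g ^ 2)) ∘ₗ Q.π.toLinearMap
  let T2 : BP →ₗ[ℝ] ℝ := Complex.reLm ∘ₗ
    ((LinearMap.mulLeft ℝ c1) ∘ₗ (ev Complex.I Complex.I).toLinearMap
      + (LinearMap.mulLeft ℝ c2) ∘ₗ (ev Complex.I (-Complex.I)).toLinearMap)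
  have := BD_lin hh (T1 - T2) (by
    intro k l hk hl
    have h1 : T1 (mon k l) = T (g ^ 2 * Q.π (mon k l)) := rfl
    have h2 : T2 (mon k l) = (c1 * ev Complex.I Complex.I (mon k l)
      + c2 * ev Complex.I (-Complex.I) (mon k l)).re := rfl
    rw [LinearMap.sub_apply, h1, h2, Q.pi_mon, ev_mon, ev_mon, hc k l hk hl, sub_self])
  rw [LinearMap.sub_apply, sub_eq_zero] at this
  exact this

end core


section core
variable {a b : ℕ} {f : BP}

/-- the quotient -/
noncomputable def quotQ (U V : BP) : QuotData U V (BP ⧸ (Ideal.span {U, V} : Ideal BP)) where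
  π := Ideal.Quotient.mkₐ ℝ _
  surj := Ideal.Quotient.mkₐ_surjective ℝ _
  ker := fun g => by
    rw [Ideal.Quotient.mkₐ_eq_mk, Ideal.Quotient.eq_zero_iff_mem]

theorem ker_finrank {E : Type*} [AddCommGroup E] [Module ℝ E] [Module.Finite ℝ E]
    (ℓ : E →ₗ[ℝ] ℝ × ℝ) : Module.finrank ℝ E ≤ Module.finrank ℝ (LinearMap.ker ℓ) + 2 := by
  have h := LinearMap.finrank_range_add_finrank_ker ℓ
  have h2 := Submodule.finrank_le (LinearMap.range ℓ)
  have h3 : Module.finrank ℝ (ℝ × ℝ) = 2 := by simp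
  omega

theorem exists_sub {A : Type*} [CommRing A] [Algebra ℝ A] (π : BP →ₐ[ℝ] A) (r s : ℕ)
    (h : ∀ g ∈ BD r s, π g = 0 → g = 0) :
    Module.finrank ℝ (LinearMap.range (π.toLinearMap ∘ₗ (BD r s).subtype))
      = (r + 1) * (s + 1) := by
  rw [← BD_finrank r s]
  apply LinearMap.finrank_range_of_inj
  intro u v huv
  have h1 : π u.1 = π v.1 := huv
  have := h (u.1 - v.1) (Submodule.sub_mem _ u.2 v.2) (by rw [map_sub, h1, sub_self])
  exact Subtype.ext (sub_eq_zero.mp this)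

theorem core_alg_ker {A : Type*} [CommRing A] [Algebra ℝ A] [Module.Finite ℝ A]
    {T : A →ₗ[ℝ] ℝ} (hT : ∀ a, (∀ b, T (a * b) = 0) → a = 0)
    (L : Submodule ℝ A) (hL : ∀ u ∈ L, ∀ v ∈ L, T (u * v) = 0)
    (hdim : 2 * Module.finrank ℝ L = Module.finrank ℝ A)
    {ι : Type*} [Fintype ι] (X : ι → A →ₐ[ℝ] ℂ)
    (hc : ∀ i, ∃ c1 c2 : A, (∀ a, T (c1 * a) = (X i a).re) ∧ (∀ a, T (c2 * a) = (X i a).im) ∧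
      X i c1 + Complex.I * X i c2 ≠ 0 ∧
      ((∀ a, (X i a).im = 0) → 0 < (X i c1 + Complex.I * X i c2).re))
    (hX : ∀ i j, i ≠ j → (∃ r, X i r ≠ X j r) ∧ (∃ r, X i r ≠ (starRingEnd ℂ) (X j r)))
    {E : Type*} [AddCommGroup E] [Module ℝ E] [Module.Finite ℝ E] (θ : E →ₗ[ℝ] A)
    (ℓ : E →ₗ[ℝ] ℝ × ℝ) (g : A)
    (hg : ∀ i, X i g = 0) (hpos : ∀ w, ℓ w = 0 → 0 ≤ T (g ^ 2 * (θ w) ^ 2))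
    (hinj : ∀ w, g * θ w = 0 → w = 0) :
    Fintype.card ι + Module.finrank ℝ E ≤ Module.finrank ℝ L + 2 := by
  have h := core_alg hT L hL hdim X hc hX (W := LinearMap.ker ℓ)
    (θ ∘ₗ (LinearMap.ker ℓ).subtype) g hg (fun w => hpos w.1 w.2)
    (fun w hw => Subtype.ext (hinj w.1 hw))
  have := ker_finrank ℓ
  omega

set_option maxHeartbeats 1000000 in
theorem AffHyp.bound_R' {A : Type*} [CommRing A] [Algebra ℝ A]
    (Q : QuotData (UU (2 * a) f) (VV (2 * b) f) A) (H : AffHyp a b f) (R : Finset (ℂ × ℂ))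
    (hR : ∀ z ∈ R, ev z.1 z.2 f = 0 ∧ ev z.1 z.2 (dX f) = 0 ∧ ev z.1 z.2 (dY f) = 0)
    (hsel : ∀ z ∈ R, ∀ w ∈ R, z.1 = (starRingEnd ℂ) w.1 → z.2 = (starRingEnd ℂ) w.2 → z = w) :
    R.card + (a + 1) * (b + 1) ≤ 4 * a * b + 2 := by
  have ha := H.ha
  have hb := H.hb
  have hfin := Q.finite H.inf.box
  obtain ⟨T, hT, hTm, hTc⟩ := Q.exists_T H.inf.box
  obtain ⟨⟨g, hg⟩, -⟩ := H.exists_g Q T hT hTc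
  obtain ⟨c1, c2, hsq⟩ := H.sq_form Q T hTm g hg
  have hch : ∀ z : R, ∃ χ : A →ₐ[ℝ] ℂ,
      χ Q.x = z.1.1 ∧ χ Q.y = z.1.2 := by
    intro z
    obtain ⟨h0, h1, h2⟩ := hR z.1 z.2
    obtain ⟨hU, hV⟩ := node_UV (a := a) (b := b) h0 h1 h2
    exact Q.exists_chi _ _ hU hV
  choose X hX1 hX2 using hch
  let L := LinearMap.range (Q.π.toLinearMap ∘ₗ (BD (2 * a - 1) (2 * b - 1)).subtype)
  have hLdim : Module.finrank ℝ L = (2 * a - 1 + 1) * (2 * b - 1 + 1) := by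
    apply exists_sub
    intro g hg h0
    exact box_indep H.inf.box g ((Q.ker _).mp h0) (BD_mono (by omega) (by omega) hg)
  have hLdim' : Module.finrank ℝ L = 4 * a * b := by
    rw [hLdim, Nat.sub_add_cancel (by omega), Nat.sub_add_cancel (by omega)]
    ring
  let ℓ : BD a b →ₗ[ℝ] ℝ × ℝ :=
    LinearMap.prod (pick c1 ∘ₗ (ev Complex.I Complex.I).toLinearMap ∘ₗ (BD a b).subtype)
      (pick c2 ∘ₗ (ev Complex.I (-Complex.I)).toLinearMap ∘ₗ (BD a b).subtype)
  have key := core_alg_ker hT L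
    (by
      rintro _ ⟨u, rfl⟩ _ ⟨v, rfl⟩
      show T (Q.π u.1 * Q.π v.1) = 0
      rw [← map_mul]
      exact iso_of Q.π T hTm (BD_mono (by omega) (by omega) (BD_mul u.2 v.2)))
    (by
      rw [hLdim', Q.finrank H.inf.box]; ring)
    X
    (by
      intro z
      obtain ⟨d1, d2, h1, h2, h3⟩ := hTc (X z)
      obtain ⟨n0, n1, n2⟩ := hR z.1 z.2
      rw [hX1, hX2] at h3
      have hj := H.jac_ne n0 n1 n2
      refine ⟨d1, d2, h1, h2, ?_, ?_⟩
      · rw [h3]; exact hj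
      · intro him
        rw [h3, jac_node n0 n1 n2]
        rw [jac_node n0 n1 n2] at hj
        have hx := him Q.x
        have hy := him Q.y
        rw [hX1] at hx
        rw [hX2] at hy
        obtain ⟨x, hx⟩ : ∃ x : ℝ, z.1.1 = (x : ℂ) := ⟨z.1.1.re, by apply Complex.ext <;> simp [hx]⟩
        obtain ⟨y, hy⟩ : ∃ y : ℝ, z.1.2 = (y : ℂ) := ⟨z.1.2.re, by apply Complex.ext <;> simp [hy]⟩
        rw [hx, hy] at hj n0 ⊢
        rw [ev_ofReal] at n0
        obtain ⟨-, -, h5⟩ := real_zero_second H.nonneg (x := x) (y := y) (by exact_mod_cast n0)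
        simp only [ev_ofReal] at hj ⊢
        norm_cast at hj ⊢
        refine lt_of_le_of_ne ?_ (Ne.symm hj)
        positivity)
    (by
      intro z w hzw
      constructor
      · by_contra hcon
        push Not at hcon
        apply hzw
        have h1 := hcon Q.x
        have h2 := hcon Q.y
        rw [hX1, hX1] at h1
        rw [hX2, hX2] at h2
        exact Subtype.ext (Prod.ext h1 h2)
      · by_contra hcon
        push Not at hcon
        apply hzw
        have h1 := hcon Q.x
        have h2 := hcon Q.y
        rw [hX1, hX1] at h1
        rw [hX2, hX2] at h2
        exact Subtype.ext (hsel _ z.2 _ w.2 h1 h2))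
    (E := BD a b)
    (Q.π.toLinearMap ∘ₗ (BD a b).subtype) ℓ g
    (by
      intro z
      have h1 := congrArg (X z) hg
      rw [Q.chi, hX1, hX2, (hR z.1 z.2).1] at h1
      have h2 := (H.unitsQ Q)
      rw [map_mul] at h1
      have h3 := (h2.1.mul h2.2).map (X z)
      have h4 := (mul_eq_zero.mp h1).resolve_right h3.ne_zero
      rw [map_pow] at h4
      exact pow_eq_zero_iff (two_ne_zero) |>.mp h4)
    (by
      intro w hw
      have hw1 : pick c1 (ev Complex.I Complex.I w.1) = 0 := congrArg Prod.fst hw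
      have hw2 : pick c2 (ev Complex.I (-Complex.I) w.1) = 0 := congrArg Prod.snd hw
      show 0 ≤ T (g ^ 2 * (Q.π w.1) ^ 2)
      rw [← map_pow, hsq _ (by
        rw [pow_two, two_mul, two_mul]
        exact BD_mul w.2 w.2), map_pow, map_pow, Complex.add_re]
      exact add_nonneg (pick_pos _ _ hw1) (pick_pos _ _ hw2))
    (by
      intro w hw
      have hw : g * Q.π w.1 = 0 := hw
      have : Q.π (f * w.1) = 0 := by
        rw [map_mul, ← hg]
        linear_combination (g * ((1 + Q.x ^ 2) * (1 + Q.y ^ 2))) * hw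
      exact Subtype.ext (H.star Q w.1 w.2 this))
  rw [Fintype.card_coe, hLdim', BD_finrank] at key
  omega

theorem AffHyp.bound_R (H : AffHyp a b f) (R : Finset (ℂ × ℂ))
    (hR : ∀ z ∈ R, ev z.1 z.2 f = 0 ∧ ev z.1 z.2 (dX f) = 0 ∧ ev z.1 z.2 (dY f) = 0)
    (hsel : ∀ z ∈ R, ∀ w ∈ R, z.1 = (starRingEnd ℂ) w.1 → z.2 = (starRingEnd ℂ) w.2 → z = w) :
    R.card + (a + 1) * (b + 1) ≤ 4 * a * b + 2 :=
  AffHyp.bound_R' (quotQ _ _) H R hR hsel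

theorem AffHyp.bound_all (H : AffHyp a b f) (S : Finset (ℂ × ℂ))
    (hS : ∀ z ∈ S, ev z.1 z.2 f = 0 ∧ ev z.1 z.2 (dX f) = 0 ∧ ev z.1 z.2 (dY f) = 0)
    (N : ℕ) (hN : N ≤ (S.filter (fun z => z.1.im = 0 ∧ z.2.im = 0)).card) :
    N + S.card + 2 * ((a + 1) * (b + 1)) ≤ 2 * (4 * a * b + 2) := by
  classical
  let cj : ℂ × ℂ → ℂ × ℂ := fun z => ((starRingEnd ℂ) z.1, (starRingEnd ℂ) z.2)
  have cjcj : ∀ z, cj (cj z) = z := by intro z; simp [cj]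
  let up : ℂ × ℂ → Prop := fun z => 0 < z.1.im ∨ (z.1.im = 0 ∧ 0 < z.2.im)
  let re : ℂ × ℂ → Prop := fun z => z.1.im = 0 ∧ z.2.im = 0
  let U := S.filter up
  let D := (S.filter (fun z => up (cj z))).image cj
  let RR := S.filter re
  have hev : ∀ (z : ℂ × ℂ) (g : BP), ev (cj z).1 (cj z).2 g = (starRingEnd ℂ) (ev z.1 z.2 g) := by
    intro z g
    have := ev_comp (Complex.conjAe : ℂ →ₐ[ℝ] ℂ) z.1 z.2 g
    simpa [cj] using this.symm
  have hUD : ∀ z ∈ U ∪ D, up z := by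
    intro z hz
    rcases Finset.mem_union.mp hz with h | h
    · exact (Finset.mem_filter.mp h).2
    · obtain ⟨w, hw, rfl⟩ := Finset.mem_image.mp h
      exact (Finset.mem_filter.mp hw).2
  have hb := H.bound_R ((U ∪ D) ∪ RR) (by
    intro z hz
    rcases Finset.mem_union.mp hz with h | h
    · rcases Finset.mem_union.mp h with h | h
      · exact hS z (Finset.mem_filter.mp h).1
      · obtain ⟨w, hw, rfl⟩ := Finset.mem_image.mp h
        obtain ⟨h1, h2, h3⟩ := hS w (Finset.mem_filter.mp hw).1
        simp [hev, h1, h2, h3]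
    · exact hS z (Finset.mem_filter.mp h).1)
    (by
      intro z hz w hw h1 h2
      have i1 : z.1.im = - w.1.im := by rw [h1]; simp
      have i2 : z.2.im = - w.2.im := by rw [h2]; simp
      have cz : up z ∨ re z := by
        rcases Finset.mem_union.mp hz with h | h
        · exact Or.inl (hUD z h)
        · exact Or.inr (Finset.mem_filter.mp h).2
      have cw : up w ∨ re w := by
        rcases Finset.mem_union.mp hw with h | h
        · exact Or.inl (hUD w h)
        · exact Or.inr (Finset.mem_filter.mp h).2
      have hr : w.1.im = 0 ∧ w.2.im = 0 := by
        rcases cz with (h | ⟨h, h'⟩) | ⟨h, h'⟩ <;> rcases cw with (k | ⟨k, k'⟩) | ⟨k, k'⟩ <;>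
          constructor <;> linarith
      apply Prod.ext
      · rw [h1]; apply Complex.ext <;> simp [hr.1]
      · rw [h2]; apply Complex.ext <;> simp [hr.2])
  have hdis : Disjoint (U ∪ D) RR := by
    rw [Finset.disjoint_left]
    intro z hz hz2
    have h1 := hUD z hz
    obtain ⟨h2, h3⟩ := (Finset.mem_filter.mp hz2).2
    rcases h1 with h | ⟨_, h⟩ <;> linarith
  rw [Finset.card_union_of_disjoint hdis] at hb
  have hUcard : U.card ≤ (U ∪ D).card := Finset.card_le_card Finset.subset_union_left
  have hDcard : D.card ≤ (U ∪ D).card := Finset.card_le_card Finset.subset_union_right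
  have hD : D.card = (S.filter (fun z => up (cj z))).card := by
    apply Finset.card_image_of_injective
    intro z w h
    rw [← cjcj z, ← cjcj w, h]
  have hcov : S ⊆ U ∪ (S.filter (fun z => up (cj z)) ∪ RR) := by
    intro z hz
    have : up z ∨ up (cj z) ∨ re z := by
      simp only [up, re, cj, Complex.conj_im, neg_eq_zero, Left.neg_pos_iff]
      rcases lt_trichotomy z.1.im 0 with h | h | h
      · tauto
      · rcases lt_trichotomy z.2.im 0 with h' | h' | h' <;> tauto
      · tauto
    simp only [U, RR, Finset.mem_union, Finset.mem_filter]
    tauto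
  have hScard := Finset.card_le_card hcov
  have h1 := Finset.card_union_le U (S.filter (fun z => up (cj z)) ∪ RR)
  have h2 := Finset.card_union_le (S.filter (fun z => up (cj z))) RR
  have hN' : N ≤ RR.card := hN
  omega

end core


section mv
variable {K : Type*} [CommRing K]

/-- linear substitution -/
noncomputable def lsub (G : Matrix (Fin 4) (Fin 4) K) :
    MvPolynomial (Fin 4) K →ₐ[K] MvPolynomial (Fin 4) K :=
  aeval (fun j => ∑ i, C (G j i) * X i)

theorem eval_lsub (G : Matrix (Fin 4) (Fin 4) K) (v : Fin 4 → K) (F : MvPolynomial (Fin 4) K) :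
    eval v (lsub G F) = eval (G.mulVec v) F := by
  induction F using MvPolynomial.induction_on with
  | C c => simp [lsub, algebraMap_eq]
  | add p q hp hq => simp [hp, hq]
  | mul_X p i hp =>
    rw [map_mul, map_mul, hp, map_mul]
    simp [lsub, Matrix.mulVec, dotProduct]

theorem pderiv_lsub (G : Matrix (Fin 4) (Fin 4) K) (i : Fin 4) (F : MvPolynomial (Fin 4) K) :
    pderiv i (lsub G F) = ∑ j, C (G j i) * lsub G (pderiv j F) := by
  induction F using MvPolynomial.induction_on with
  | C c => simp [lsub, algebraMap_eq]
  | add p q hp hq =>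
    simp only [map_add, hp, hq, mul_add, Finset.sum_add_distrib]
  | mul_X p k hp =>
    have h1 : pderiv i (lsub G (X k)) = C (G k i) := by
      simp only [lsub, aeval_X, map_sum, pderiv_mul, pderiv_C, zero_mul, zero_add]
      rw [Finset.sum_eq_single i]
      · simp
      · intro j _ hj
        rw [pderiv_X_of_ne hj, mul_zero]
      · simp
    rw [map_mul, pderiv_mul, hp, h1]
    simp only [pderiv_mul, map_add, map_mul, mul_add, Finset.sum_add_distrib, Finset.sum_mul]
    refine congrArg₂ (fun x y => x + y) ?_ ?_
    · apply Finset.sum_congr rfl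
      intro j _
      rw [mul_assoc]
    · rw [Finset.sum_eq_single k]
      · rw [pderiv_X_self, map_one, mul_one, mul_comm]
      · intro j _ hj
        rw [pderiv_X_of_ne hj.symm]; simp
      · simp

theorem eval_pderiv_lsub (G : Matrix (Fin 4) (Fin 4) K) (v : Fin 4 → K)
    (F : MvPolynomial (Fin 4) K) :
    (fun i => eval v (pderiv i (lsub G F))) =
      G.transpose.mulVec (fun i => eval (G.mulVec v) (pderiv i F)) := by
  funext i
  rw [pderiv_lsub, map_sum]
  simp [Matrix.mulVec, dotProduct, eval_lsub]

/-- Hessian -/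
noncomputable def hess (F : MvPolynomial (Fin 4) K) (v : Fin 4 → K) : Matrix (Fin 4) (Fin 4) K :=
  Matrix.of fun i j => eval v (pderiv i (pderiv j F))

theorem hess_lsub (G : Matrix (Fin 4) (Fin 4) K) (v : Fin 4 → K) (F : MvPolynomial (Fin 4) K) :
    hess (lsub G F) v = G.transpose * hess F (G.mulVec v) * G := by
  ext i j
  simp only [hess, Matrix.of_apply, Matrix.mul_apply, Matrix.transpose_apply]
  rw [pderiv_lsub, map_sum, map_sum]
  apply Finset.sum_congr rfl
  intro k _
  rw [pderiv_mul, pderiv_C, zero_mul, zero_add, pderiv_lsub]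
  simp only [map_mul, eval_C, map_sum, eval_lsub]
  rw [mul_comm]

/-- weights -/
def w1 : Fin 4 → ℕ := ![1, 1, 0, 0]
/-- weights -/
def w2 : Fin 4 → ℕ := ![0, 0, 1, 1]

/-- bihomogeneous -/
structure BH (F : MvPolynomial (Fin 4) K) (r s : ℕ) : Prop where
  h1 : IsWeightedHomogeneous w1 F r
  h2 : IsWeightedHomogeneous w2 F s

theorem weight4 (w : Fin 4 → ℕ) (d : Fin 4 →₀ ℕ) :
    Finsupp.weight w d = d 0 * w 0 + d 1 * w 1 + d 2 * w 2 + d 3 * w 3 := by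
  rw [Finsupp.weight_apply, Finsupp.sum_fintype _ _ (by simp), Fin.sum_univ_four]
  simp

theorem BH_iff {F : MvPolynomial (Fin 4) K} {r s : ℕ} :
    BH F r s ↔ ∀ d ∈ F.support, d 0 + d 1 = r ∧ d 2 + d 3 = s := by
  constructor
  · intro H d hd
    have h1 := H.h1 (mem_support_iff.mp hd)
    have h2 := H.h2 (mem_support_iff.mp hd)
    rw [weight4] at h1 h2
    simpa [w1, w2] using And.intro h1 h2
  · intro H
    constructor
    · intro d hd
      rw [weight4]
      simpa [w1, w2] using (H d (mem_support_iff.mpr hd)).1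
    · intro d hd
      rw [weight4]
      simpa [w1, w2] using (H d (mem_support_iff.mpr hd)).2

variable {F P : MvPolynomial (Fin 4) K} {r s : ℕ}

theorem BH.add (hF : BH F r s) (hP : BH P r s) : BH (F + P) r s := ⟨hF.1.add hP.1, hF.2.add hP.2⟩
theorem BH.neg (hF : BH F r s) : BH (-F) r s := ⟨hF.1.neg, hF.2.neg⟩
theorem BH.sub (hF : BH F r s) (hP : BH P r s) : BH (F - P) r s := ⟨hF.1.sub hP.1, hF.2.sub hP.2⟩

theorem BH.map {L : Type*} [CommRing L] (φ : K →+* L) (hF : BH F r s) : BH (map φ F) r s := by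
  rw [BH_iff] at *
  intro d hd
  exact hF d (support_map_subset _ _ hd)

theorem BH.euler1 (hF : BH F r s) (v : Fin 4 → K) :
    v 0 * eval v (pderiv 0 F) + v 1 * eval v (pderiv 1 F) = r * eval v F := by
  have h := congrArg (eval v) hF.h1.sum_weight_X_mul_pderiv
  rw [Fin.sum_univ_four] at h
  simpa [w1] using h

theorem BH.euler2 (hF : BH F r s) (v : Fin 4 → K) :
    v 2 * eval v (pderiv 2 F) + v 3 * eval v (pderiv 3 F) = s * eval v F := by
  have h := congrArg (eval v) hF.h2.sum_weight_X_mul_pderiv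
  rw [Fin.sum_univ_four] at h
  simpa [w2] using h

theorem BH.pderiv0 (hF : BH F (r + 1) s) : BH (pderiv 0 F) r s :=
  ⟨hF.1.pderiv (by simp [w1]), hF.2.pderiv (by simp [w2])⟩
theorem BH.pderiv1 (hF : BH F (r + 1) s) : BH (pderiv 1 F) r s :=
  ⟨hF.1.pderiv (by simp [w1]), hF.2.pderiv (by simp [w2])⟩
theorem BH.pderiv2 (hF : BH F r (s + 1)) : BH (pderiv 2 F) r s :=
  ⟨hF.1.pderiv (by simp [w1]), hF.2.pderiv (by simp [w2])⟩
theorem BH.pderiv3 (hF : BH F r (s + 1)) : BH (pderiv 3 F) r s :=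
  ⟨hF.1.pderiv (by simp [w1]), hF.2.pderiv (by simp [w2])⟩

theorem BH.X0 (hF : BH F r s) : BH (X 0 * F) (r + 1) s :=
  ⟨by simpa [w1, add_comm] using (isWeightedHomogeneous_X K w1 0).mul hF.1,
   by simpa [w2] using (isWeightedHomogeneous_X K w2 0).mul hF.2⟩
theorem BH.X1 (hF : BH F r s) : BH (X 1 * F) (r + 1) s :=
  ⟨by simpa [w1, add_comm] using (isWeightedHomogeneous_X K w1 1).mul hF.1,
   by simpa [w2] using (isWeightedHomogeneous_X K w2 1).mul hF.2⟩
theorem BH.X2 (hF : BH F r s) : BH (X 2 * F) r (s + 1) :=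
  ⟨by simpa [w1, add_comm] using (isWeightedHomogeneous_X K w1 2).mul hF.1,
   by simpa [w2, add_comm] using (isWeightedHomogeneous_X K w2 2).mul hF.2⟩
theorem BH.X3 (hF : BH F r s) : BH (X 3 * F) r (s + 1) :=
  ⟨by simpa [w1, add_comm] using (isWeightedHomogeneous_X K w1 3).mul hF.1,
   by simpa [w2, add_comm] using (isWeightedHomogeneous_X K w2 3).mul hF.2⟩

/-- weighted homogeneity under linear substitution -/
theorem wh_lsub (G : Matrix (Fin 4) (Fin 4) K) {w w' : Fin 4 → ℕ}
    (hG : ∀ j i, w' i ≠ w j → G j i = 0) {n : ℕ} (hF : IsWeightedHomogeneous w F n) :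
    IsWeightedHomogeneous w' (lsub G F) n := by
  have hlin : ∀ j, IsWeightedHomogeneous w' (lsub G (X j)) (w j) := by
    intro j
    rw [lsub, aeval_X]
    apply IsWeightedHomogeneous.sum
    intro i _
    by_cases h : w' i = w j
    · rw [← h]
      exact (isWeightedHomogeneous_X K w' i).C_mul _
    · rw [hG j i h]
      simpa using isWeightedHomogeneous_zero K w' (w j)
  rw [F.as_sum, map_sum]
  apply IsWeightedHomogeneous.sum
  intro d hd
  have hw := hF (mem_support_iff.mp hd)
  rw [← hw, weight4, monomial_eq, map_mul, Finsupp.prod_fintype _ _ (by simp), Fin.prod_univ_four]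
  simp only [map_mul, map_pow]
  have hc : lsub G (C (coeff d F)) = C (coeff d F) := by
    rw [← algebraMap_eq, AlgHom.commutes]
  rw [hc]
  exact ((((hlin 0).pow _).mul ((hlin 1).pow _)).mul ((hlin 2).pow _)).mul ((hlin 3).pow _)
    |>.C_mul _

/-- block diagonal matrix -/
def blk (g h : Matrix (Fin 2) (Fin 2) K) : Matrix (Fin 4) (Fin 4) K :=
  !![g 0 0, g 0 1, 0, 0; g 1 0, g 1 1, 0, 0; 0, 0, h 0 0, h 0 1; 0, 0, h 1 0, h 1 1]

/-- swap -/
def swp : Matrix (Fin 4) (Fin 4) K :=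
  !![0, 0, 1, 0; 0, 0, 0, 1; 1, 0, 0, 0; 0, 1, 0, 0]

theorem BH.lsub_blk (hF : BH F r s) (g h : Matrix (Fin 2) (Fin 2) K) :
    BH (lsub (blk g h) F) r s := by
  constructor
  · apply wh_lsub _ _ hF.1
    intro j i
    fin_cases j <;> fin_cases i <;> simp [w1, blk]
  · apply wh_lsub _ _ hF.2
    intro j i
    fin_cases j <;> fin_cases i <;> simp [w2, blk]

theorem BH.lsub_swp (hF : BH F r s) : BH (lsub swp F) s r := by
  constructor
  · apply wh_lsub _ _ hF.2
    intro j i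
    fin_cases j <;> fin_cases i <;> simp [w1, w2, swp]
  · apply wh_lsub _ _ hF.1
    intro j i
    fin_cases j <;> fin_cases i <;> simp [w1, w2, swp]

theorem blk_mulVec (g h : Matrix (Fin 2) (Fin 2) K) (v : Fin 4 → K) :
    (blk g h).mulVec v = ![g 0 0 * v 0 + g 0 1 * v 1, g 1 0 * v 0 + g 1 1 * v 1,
      h 0 0 * v 2 + h 0 1 * v 3, h 1 0 * v 2 + h 1 1 * v 3] := by
  funext i
  fin_cases i <;> simp [blk, Matrix.mulVec, dotProduct, Fin.sum_univ_four]

theorem swp_mulVec (v : Fin 4 → K) :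
    (swp : Matrix (Fin 4) (Fin 4) K).mulVec v = ![v 2, v 3, v 0, v 1] := by
  funext i
  fin_cases i <;> simp [swp, Matrix.mulVec, dotProduct, Fin.sum_univ_four]

theorem blk_mul (g h g' h' : Matrix (Fin 2) (Fin 2) K) :
    blk g h * blk g' h' = blk (g * g') (h * h') := by
  ext i j
  fin_cases i <;> fin_cases j <;> simp [blk, Matrix.mul_apply, Fin.sum_univ_four]

theorem blk_one : blk (1 : Matrix (Fin 2) (Fin 2) K) 1 = 1 := by
  ext i j
  fin_cases i <;> fin_cases j <;> simp [blk]

theorem swp_mul : (swp : Matrix (Fin 4) (Fin 4) K) * swp = 1 := by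
  ext i j
  fin_cases i <;> fin_cases j <;> simp [swp, Matrix.mul_apply, Fin.sum_univ_four]

theorem map_lsub {L : Type*} [CommRing L] (φ : K →+* L) (G : Matrix (Fin 4) (Fin 4) K)
    (F : MvPolynomial (Fin 4) K) : MvPolynomial.map φ (lsub G F) = lsub (G.map φ) (MvPolynomial.map φ F) := by
  induction F using MvPolynomial.induction_on with
  | C c => simp [lsub, algebraMap_eq]
  | add p q hp hq => simp [hp, hq]
  | mul_X p i hp =>
    rw [map_mul, map_mul, hp, map_mul, map_mul]
    simp [lsub]

/-- evaluation scales -/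
theorem BH.eval_smul (hF : BH F r s) (c d : K) (v : Fin 4 → K) :
    eval ![c * v 0, c * v 1, d * v 2, d * v 3] F = c ^ r * d ^ s * eval v F := by
  rw [eval_eq', eval_eq', Finset.mul_sum]
  apply Finset.sum_congr rfl
  intro e he
  obtain ⟨h1, h2⟩ := BH_iff.mp hF e he
  rw [Fin.prod_univ_four, Fin.prod_univ_four, ← h1, ← h2]
  simp
  ring

end mv


section deh

/-- complexification -/
noncomputable abbrev cF (F : MvPolynomial (Fin 4) ℝ) : MvPolynomial (Fin 4) ℂ :=
  MvPolynomial.map (algebraMap ℝ ℂ) F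

/-- dehomogenization -/
noncomputable def deh : MvPolynomial (Fin 4) ℝ →ₐ[ℝ] BP :=
  aeval ![1, Polynomial.C Polynomial.X, 1, Polynomial.X]

theorem deh_C (c : ℝ) : deh (C c) = Polynomial.C (Polynomial.C c) := by
  rw [← algebraMap_eq, AlgHom.commutes]; rfl

theorem deh_X0 : deh (X 0) = 1 := by simp [deh]
theorem deh_X1 : deh (X 1) = Polynomial.C Polynomial.X := by simp [deh]
theorem deh_X2 : deh (X 2) = 1 := by simp [deh]
theorem deh_X3 : deh (X 3) = Polynomial.X := by simp [deh]

theorem ev_deh {E : Type*} [CommRing E] [Algebra ℝ E] (x y : E) (F : MvPolynomial (Fin 4) ℝ) :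
    ev x y (deh F) = aeval ![1, x, 1, y] F := by
  have : (ev x y).comp deh = aeval ![1, x, 1, y] := by
    apply MvPolynomial.algHom_ext
    intro i
    fin_cases i <;> simp [deh, ev_eq]
  exact DFunLike.congr_fun this F

theorem aeval_cF (v : Fin 4 → ℂ) (F : MvPolynomial (Fin 4) ℝ) : aeval v F = eval v (cF F) := by
  rw [aeval_def, eval₂_eq_eval_map]

theorem ev_dehC (x y : ℂ) (F : MvPolynomial (Fin 4) ℝ) :
    ev x y (deh F) = eval ![1, x, 1, y] (cF F) := by
  rw [ev_deh, aeval_cF]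

theorem ev_dehR (x y : ℝ) (F : MvPolynomial (Fin 4) ℝ) :
    ev x y (deh F) = eval ![1, x, 1, y] F := by
  rw [ev_deh, aeval_eq_eval]

theorem dX_deh (F : MvPolynomial (Fin 4) ℝ) : dX (deh F) = deh (pderiv 1 F) := by
  induction F using MvPolynomial.induction_on with
  | C c => rw [deh_C, dX_C, pderiv_C]; simp
  | add p q hp hq => rw [map_add, dX_add, hp, hq, map_add, map_add]
  | mul_X p k hp =>
    have hk : dX (deh (X k)) = deh (pderiv 1 (X k)) := by
      fin_cases k
      · show dX (deh (X 0)) = deh (pderiv 1 (X 0))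
        rw [pderiv_X_of_ne (by decide), deh_X0, map_zero, ← Polynomial.C_1, dX_C]; simp
      · show dX (deh (X 1)) = deh (pderiv 1 (X 1))
        rw [pderiv_X_self, deh_X1, map_one, dX_C]; simp
      · show dX (deh (X 2)) = deh (pderiv 1 (X 2))
        rw [pderiv_X_of_ne (by decide), deh_X2, map_zero, ← Polynomial.C_1, dX_C]; simp
      · show dX (deh (X 3)) = deh (pderiv 1 (X 3))
        rw [pderiv_X_of_ne (by decide), deh_X3, map_zero, dX_Y]
    rw [map_mul, dX_mul, hp, hk, pderiv_mul, map_add, map_mul, map_mul]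

theorem dY_deh (F : MvPolynomial (Fin 4) ℝ) : dY (deh F) = deh (pderiv 3 F) := by
  induction F using MvPolynomial.induction_on with
  | C c => rw [deh_C, dY_C, pderiv_C]; simp
  | add p q hp hq => rw [map_add, dY_add, hp, hq, map_add, map_add]
  | mul_X p k hp =>
    have hk : dY (deh (X k)) = deh (pderiv 3 (X k)) := by
      fin_cases k
      · show dY (deh (X 0)) = deh (pderiv 3 (X 0))
        rw [pderiv_X_of_ne (by decide), deh_X0, map_zero, ← Polynomial.C_1, dY_C]
      · show dY (deh (X 1)) = deh (pderiv 3 (X 1))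
        rw [pderiv_X_of_ne (by decide), deh_X1, map_zero, dY_C]
      · show dY (deh (X 2)) = deh (pderiv 3 (X 2))
        rw [pderiv_X_of_ne (by decide), deh_X2, map_zero, ← Polynomial.C_1, dY_C]
      · show dY (deh (X 3)) = deh (pderiv 3 (X 3))
        rw [pderiv_X_self, deh_X3, map_one, dY_Y]
    rw [map_mul, dY_mul, hp, hk, pderiv_mul, map_add, map_mul, map_mul]

theorem deh_monomial (d : Fin 4 →₀ ℕ) (c : ℝ) : deh (monomial d c) = c • mon (d 1) (d 3) := by
  rw [monomial_eq, map_mul, deh_C, Finsupp.prod_fintype _ _ (by simp), Fin.prod_univ_four]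
  simp only [map_mul, map_pow, deh_X0, deh_X1, deh_X2, deh_X3, one_pow, one_mul, mul_one]
  rw [mon, ← Polynomial.C_mul_X_pow_eq_monomial, Algebra.smul_def, map_pow]
  rfl

variable {F : MvPolynomial (Fin 4) ℝ} {r s : ℕ}

theorem deh_mem (hF : BH F r s) : deh F ∈ BD r s := by
  rw [F.as_sum, map_sum]
  apply Submodule.sum_mem
  intro d hd
  obtain ⟨h1, h2⟩ := BH_iff.mp hF d hd
  rw [deh_monomial]
  exact Submodule.smul_mem _ _ (BD_mono (by omega) (by omega) (mon_mem_BD _ _))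

theorem hz_add (g h : BP) (x0 x1 y0 y1 : ℂ) :
    hz r s (g + h) x0 x1 y0 y1 = hz r s g x0 x1 y0 y1 + hz r s h x0 x1 y0 y1 := by
  simp [hz, ← Finset.sum_add_distrib, add_mul]

theorem hz_mon (c : ℝ) {k l : ℕ} (hk : k ≤ r) (hl : l ≤ s) (x0 x1 y0 y1 : ℂ) :
    hz r s (c • mon k l) x0 x1 y0 y1 = c * (x0 ^ (r - k) * x1 ^ k * (y0 ^ (s - l) * y1 ^ l)) := by
  unfold hz
  rw [Finset.sum_eq_single l, Finset.sum_eq_single k]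
  · simp [mon_coeff]
  · intro k' _ hk'
    simp [mon_coeff, hk'.symm]
  · intro h; exact absurd (Finset.mem_range.mpr (by omega)) h
  · intro l' _ hl'
    apply Finset.sum_eq_zero
    intro k' _
    simp [mon_coeff, hl'.symm]
  · intro h; exact absurd (Finset.mem_range.mpr (by omega)) h

theorem hz_sum {ι : Type*} (S : Finset ι) (g : ι → BP) (x0 x1 y0 y1 : ℂ) :
    hz r s (∑ i ∈ S, g i) x0 x1 y0 y1 = ∑ i ∈ S, hz r s (g i) x0 x1 y0 y1 := by
  classical
  induction S using Finset.induction_on with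
  | empty => simp [hz]
  | insert a S ha ih => rw [Finset.sum_insert ha, hz_add, ih, Finset.sum_insert ha]

theorem hz_deh (hF : BH F r s) (x0 x1 y0 y1 : ℂ) :
    hz r s (deh F) x0 x1 y0 y1 = eval ![x0, x1, y0, y1] (cF F) := by
  rw [← aeval_cF]
  conv_lhs => rw [F.as_sum]
  conv_rhs => rw [F.as_sum]
  rw [map_sum, map_sum, hz_sum]
  apply Finset.sum_congr rfl
  intro d hd
  obtain ⟨h1, h2⟩ := BH_iff.mp hF d hd
  rw [deh_monomial, hz_mon _ (by omega) (by omega), aeval_monomial,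
    Finsupp.prod_fintype _ _ (by simp), Fin.prod_univ_four]
  have e1 : r - d 1 = d 0 := by omega
  have e2 : s - d 3 = d 2 := by omega
  rw [e1, e2]
  simp
  left
  ring

/-- rotation derivatives -/
noncomputable def RU {K : Type*} [CommRing K] (F : MvPolynomial (Fin 4) K) : MvPolynomial (Fin 4) K :=
  X 0 * pderiv 1 F - X 1 * pderiv 0 F
/-- rotation derivatives -/
noncomputable def RV {K : Type*} [CommRing K] (F : MvPolynomial (Fin 4) K) : MvPolynomial (Fin 4) K :=
  X 2 * pderiv 3 F - X 3 * pderiv 2 F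

theorem eval_RU {K : Type*} [CommRing K] (F : MvPolynomial (Fin 4) K) (v : Fin 4 → K) :
    eval v (RU F) = v 0 * eval v (pderiv 1 F) - v 1 * eval v (pderiv 0 F) := by
  simp [RU]
theorem eval_RV {K : Type*} [CommRing K] (F : MvPolynomial (Fin 4) K) (v : Fin 4 → K) :
    eval v (RV F) = v 2 * eval v (pderiv 3 F) - v 3 * eval v (pderiv 2 F) := by
  simp [RV]

theorem cF_RU (F : MvPolynomial (Fin 4) ℝ) : cF (RU F) = RU (cF F) := by
  simp [RU, cF, pderiv_map]
theorem cF_RV (F : MvPolynomial (Fin 4) ℝ) : cF (RV F) = RV (cF F) := by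
  simp [RV, cF, pderiv_map]

theorem BH.RU {K : Type*} [CommRing K] {F : MvPolynomial (Fin 4) K} (hF : BH F r s) (hr : 1 ≤ r) :
    BH (RU F) r s := by
  obtain ⟨r, rfl⟩ := Nat.exists_eq_add_of_le' hr
  exact hF.pderiv1.X0.sub hF.pderiv0.X1
theorem BH.RV {K : Type*} [CommRing K] {F : MvPolynomial (Fin 4) K} (hF : BH F r s) (hs : 1 ≤ s) :
    BH (RV F) r s := by
  obtain ⟨s, rfl⟩ := Nat.exists_eq_add_of_le' hs
  exact hF.pderiv3.X2.sub hF.pderiv2.X3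

theorem BH.eu1 (hF : BH F r s) : X 0 * pderiv 0 F + X 1 * pderiv 1 F = C (r : ℝ) * F := by
  have h := hF.h1.sum_weight_X_mul_pderiv
  rw [Fin.sum_univ_four] at h
  simpa [w1] using h
theorem BH.eu2 (hF : BH F r s) : X 2 * pderiv 2 F + X 3 * pderiv 3 F = C (s : ℝ) * F := by
  have h := hF.h2.sum_weight_X_mul_pderiv
  rw [Fin.sum_univ_four] at h
  simpa [w2] using h

theorem UU_deh (hF : BH F r s) : UU r (deh F) = deh (RU F) := by
  have h := congrArg deh hF.eu1
  simp only [map_add, map_mul, deh_X0, deh_X1, deh_C, one_mul] at h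
  simp only [RU, map_sub, map_mul, deh_X0, deh_X1, one_mul]
  unfold UU
  rw [dX_deh]
  simp only [map_add, map_mul, map_pow, map_one, map_natCast] at h ⊢
  linear_combination (Polynomial.C (Polynomial.X : Polynomial ℝ)) * h

theorem VV_deh (hF : BH F r s) : VV s (deh F) = deh (RV F) := by
  have h := congrArg deh hF.eu2
  simp only [map_add, map_mul, deh_X2, deh_X3, deh_C, one_mul] at h
  simp only [RV, map_sub, map_mul, deh_X2, deh_X3, one_mul]
  unfold VV
  rw [dY_deh]
  simp only [map_add, map_mul, map_pow, map_one, map_natCast] at h ⊢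
  linear_combination (Polynomial.X : BP) * h

/-- all singular points are nodes -/
def NodeC (Q : MvPolynomial (Fin 4) ℂ) : Prop :=
  ∀ v : Fin 4 → ℂ, (v 0 ≠ 0 ∨ v 1 ≠ 0) → (v 2 ≠ 0 ∨ v 3 ≠ 0) →
    (∀ i, eval v (pderiv i Q) = 0) → (hess Q v).rank = 2

theorem NodeC.lsub {Q : MvPolynomial (Fin 4) ℂ} (hQ : NodeC Q) (G G' : Matrix (Fin 4) (Fin 4) ℂ)
    (hG : G' * G = 1)
    (hb : ∀ v : Fin 4 → ℂ, (v 0 ≠ 0 ∨ v 1 ≠ 0) → (v 2 ≠ 0 ∨ v 3 ≠ 0) →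
      ((G.mulVec v) 0 ≠ 0 ∨ (G.mulVec v) 1 ≠ 0) ∧ ((G.mulVec v) 2 ≠ 0 ∨ (G.mulVec v) 3 ≠ 0)) :
    NodeC (lsub G Q) := by
  intro v h1 h2 hs
  obtain ⟨k1, k2⟩ := hb v h1 h2
  have hdet : IsUnit G.det := by
    have := congrArg Matrix.det hG
    rw [Matrix.det_mul, Matrix.det_one] at this
    exact IsUnit.of_mul_eq_one _ (by rw [mul_comm]; exact this)
  have hs' : (fun i => eval (G.mulVec v) (pderiv i Q)) = 0 := by
    have h := eval_pderiv_lsub G v Q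
    have h0 : (fun i => eval v (pderiv i (_root_.lsub G Q))) = 0 := funext hs
    rw [h0] at h
    have := congrArg (G'.transpose.mulVec) h.symm
    rw [Matrix.mulVec_mulVec, ← Matrix.transpose_mul] at this
    have hG2 : G * G' = 1 := mul_eq_one_comm.mp hG
    rw [hG2] at this
    simpa using this
  rw [hess_lsub, Matrix.rank_mul_eq_left_of_isUnit_det _ _ hdet,
    Matrix.rank_mul_eq_right_of_isUnit_det _ _ (by rwa [Matrix.det_transpose])]
  exact hQ _ k1 k2 (fun i => congrFun hs' i)

theorem pderiv_cF (i : Fin 4) (F : MvPolynomial (Fin 4) ℝ) : pderiv i (cF F) = cF (pderiv i F) := by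
  simp [cF, pderiv_map]

theorem pderiv_comm4 {K : Type*} [CommRing K] (i j : Fin 4) (F : MvPolynomial (Fin 4) K) :
    pderiv i (pderiv j F) = pderiv j (pderiv i F) := by
  have h : ⁅pderiv (R := K) i, pderiv (R := K) j⁆ = 0 := by
    apply MvPolynomial.derivation_ext
    intro k
    rw [Derivation.commutator_apply]
    simp only [pderiv_X, Pi.single_apply]
    split_ifs <;> simp
  have := DFunLike.congr_fun h F
  rw [Derivation.commutator_apply] at this
  exact sub_eq_zero.mp this

theorem node_aff {r s : ℕ} (hF : BH F (r + 1) (s + 1)) (hN : NodeC (cF F)) (x y : ℂ)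
    (h0 : ev x y (deh F) = 0) (h1 : ev x y (dX (deh F)) = 0) (h2 : ev x y (dY (deh F)) = 0) :
    ev x y (dX (dX (deh F))) * ev x y (dY (dY (deh F))) - ev x y (dX (dY (deh F))) ^ 2 ≠ 0 := by
  rw [dX_deh, ev_dehC] at h1
  rw [dY_deh, ev_dehC] at h2
  rw [ev_dehC] at h0
  rw [dX_deh, dY_deh, dX_deh, dX_deh, dY_deh, ev_dehC, ev_dehC, ev_dehC]
  have hQ : BH (cF F) (r + 1) (s + 1) := hF.map _
  rw [← pderiv_cF] at h1 h2
  simp only [← pderiv_cF]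
  generalize cF F = Q at *
  set v : Fin 4 → ℂ := ![1, x, 1, y]
  have e1 := hQ.euler1 v
  have e2 := hQ.euler2 v
  simp only [h0, h1, h2, mul_zero, add_zero] at e1 e2
  have h3 : eval v (pderiv 0 Q) = 0 := by simpa [v] using e1
  have h4 : eval v (pderiv 2 Q) = 0 := by simpa [v] using e2
  have hs : ∀ i, eval v (pderiv i Q) = 0 := by
    intro i; fin_cases i
    exacts [h3, h1, h4, h2]
  have hr := hN v (by simp [v]) (by simp [v]) hs
  have a0 := hQ.pderiv0.euler1 v
  have a1 := hQ.pderiv1.euler1 v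
  have a2 := hQ.pderiv2.euler1 v
  have a3 := hQ.pderiv3.euler1 v
  have b0 := hQ.pderiv0.euler2 v
  have b1 := hQ.pderiv1.euler2 v
  have b2 := hQ.pderiv2.euler2 v
  have b3 := hQ.pderiv3.euler2 v
  have v0 : v 0 = 1 := rfl
  have v1 : v 1 = x := rfl
  have v2 : v 2 = 1 := rfl
  have v3 : v 3 = y := rfl
  simp only [h1, h2, h3, h4, mul_zero, v0, v1, v2, v3, one_mul] at a0 a1 a2 a3 b0 b1 b2 b3
  rw [pderiv_comm4 1 0 Q] at a0
  rw [pderiv_comm4 2 0 Q, pderiv_comm4 3 0 Q] at b0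
  rw [pderiv_comm4 2 1 Q, pderiv_comm4 3 1 Q] at b1
  rw [pderiv_comm4 3 2 Q] at b2
  let h : Matrix (Fin 2) (Fin 2) ℂ :=
    !![eval v (pderiv 1 (pderiv 1 Q)), eval v (pderiv 1 (pderiv 3 Q));
       eval v (pderiv 1 (pderiv 3 Q)), eval v (pderiv 3 (pderiv 3 Q))]
  let P : Matrix (Fin 2) (Fin 4) ℂ := !![-x, 1, 0, 0; 0, 0, -y, 1]
  have key : hess Q v = P.transpose * h * P := by
    ext i j
    fin_cases i <;> fin_cases j <;>
      simp [hess, P, h, Matrix.mul_apply, Fin.sum_univ_two, pderiv_comm4 1 0 Q, pderiv_comm4 2 0 Q,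
        pderiv_comm4 3 0 Q, pderiv_comm4 2 1 Q, pderiv_comm4 3 1 Q, pderiv_comm4 3 2 Q] <;>
      first
        | linear_combination a0 - x * a1
        | linear_combination a1
        | linear_combination a2 - x * b1
        | linear_combination a3
        | linear_combination b1
        | linear_combination b2 - y * b3
        | linear_combination b3
  intro hdet
  have hh : h.det = 0 := by
    rw [Matrix.det_fin_two]
    simp [h]
    linear_combination hdet
  have hle : (hess Q v).rank ≤ h.rank := by
    rw [key]
    exact (Matrix.rank_mul_le_left _ _).trans (Matrix.rank_mul_le_right _ _)
  have hlt : h.rank < 2 := by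
    by_contra hc
    have h2 : h.rank = 2 := le_antisymm (by simpa using h.rank_le_card_width) (by omega)
    have hu : IsUnit h := by
      rw [← Matrix.mulVec_surjective_iff_isUnit]
      have : LinearMap.range h.mulVecLin = ⊤ := by
        apply Submodule.eq_top_of_finrank_eq
        rw [show Module.finrank ℂ (LinearMap.range h.mulVecLin) = 2 from h2]
        simp
      exact LinearMap.range_eq_top.mp this
    exact ((Matrix.isUnit_iff_isUnit_det _).mp hu).ne_zero hh
  omega

end deh


section elim
open Polynomial nonZeroDivisors

theorem elim_gen {R : Type*} [CommRing R] [IsDomain R] [NormalizedGCDMonoid R]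
    (f g : Polynomial R) (hf : f ≠ 0) :
    (∃ A B : Polynomial R, ∃ d : R, d ≠ 0 ∧ A * f + B * g = Polynomial.C d) ∨
    ∃ p : Polynomial R, Irreducible p ∧ 0 < p.natDegree ∧ p ∣ f ∧ p ∣ g := by
  classical
  let K := FractionRing R
  have hinj : Function.Injective (algebraMap R K) := IsFractionRing.injective R K
  by_cases hc : IsCoprime (f.map (algebraMap R K)) (g.map (algebraMap R K))
  · left
    obtain ⟨a, b, hab⟩ := hc
    obtain ⟨s, hs, hs'⟩ := IsLocalization.integerNormalization_spec (S := K) R⁰ a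
    obtain ⟨t, ht, ht'⟩ := IsLocalization.integerNormalization_spec (S := K) R⁰ b
    refine ⟨Polynomial.C t * IsLocalization.integerNormalization R⁰ a,
      Polynomial.C s * IsLocalization.integerNormalization R⁰ b, s * t,
      mul_ne_zero (nonZeroDivisors.ne_zero hs) (nonZeroDivisors.ne_zero ht), ?_⟩
    apply Polynomial.map_injective _ hinj
    rw [Algebra.smul_def, Polynomial.algebraMap_apply] at hs' ht'
    simp only [Polynomial.map_add, Polynomial.map_mul, Polynomial.map_C, hs', ht', map_mul]
    linear_combination (Polynomial.C (algebraMap R K s) * Polynomial.C (algebraMap R K t)) * hab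
  · right
    have h1 : ∃ z, Irreducible z ∧ z ∣ f.map (algebraMap R K) ∧ z ∣ g.map (algebraMap R K) := by
      by_contra hcon
      push Not at hcon
      apply hc
      apply isCoprime_of_irreducible_dvd
      · rintro ⟨h, -⟩
        exact hf ((Polynomial.map_eq_zero_iff hinj).mp h)
      · exact hcon
    obtain ⟨k, hk, hkf, hkg⟩ := h1
    obtain ⟨s, hs, hs'⟩ := IsLocalization.integerNormalization_spec (S := K) R⁰ k
    rw [Algebra.smul_def, Polynomial.algebraMap_apply] at hs'
    set q := IsLocalization.integerNormalization R⁰ k with hq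
    have hs0 : algebraMap R K s ≠ 0 := by
      intro h
      exact nonZeroDivisors.ne_zero hs (hinj (by rw [h, map_zero]))
    have hq0 : q ≠ 0 := by
      intro h
      rw [h, Polynomial.map_zero] at hs'
      rcases mul_eq_zero.mp hs'.symm with h | h
      · exact hs0 (by simpa using h)
      · exact hk.ne_zero h
    have hc0 : algebraMap R K q.content ≠ 0 := by
      intro h
      exact hq0 (Polynomial.content_eq_zero_iff.mp (hinj (by rw [h, map_zero])))
    have hqe := congrArg (Polynomial.map (algebraMap R K)) q.eq_C_content_mul_primPart
    rw [hs', Polynomial.map_mul, Polynomial.map_C] at hqe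
    have hass : Associated (q.primPart.map (algebraMap R K)) k := by
      have e1 : Associated (Polynomial.C (algebraMap R K q.content) * q.primPart.map (algebraMap R K))
          (q.primPart.map (algebraMap R K)) := 
        associated_unit_mul_left _ _ (Polynomial.isUnit_C.mpr (isUnit_iff_ne_zero.mpr hc0))
      have e2 : Associated (Polynomial.C (algebraMap R K s) * k) k := 
        associated_unit_mul_left _ _ (Polynomial.isUnit_C.mpr (isUnit_iff_ne_zero.mpr hs0))
      have e3 := hqe ▸ e2
      exact e1.symm.trans e3
    have hprim := q.isPrimitive_primPart
    refine ⟨q.primPart, ?_, ?_, ?_, ?_⟩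
    · rw [hprim.irreducible_iff_irreducible_map_fraction_map (K := K)]
      exact (hass.irreducible_iff).mpr hk
    · rw [← Polynomial.natDegree_map_eq_of_injective hinj]
      have := Polynomial.natDegree_pos_iff_degree_pos.mpr (Polynomial.degree_pos_of_irreducible hk)
      obtain ⟨u, hu⟩ := hass
      rw [← hu, Polynomial.natDegree_mul (by
        intro h; apply hk.ne_zero; rw [← hu, h, zero_mul]) u.ne_zero,
        Polynomial.natDegree_eq_zero_of_isUnit u.isUnit] at this
      simpa using this
    · exact hprim.dvd_of_fraction_map_dvd_fraction_map (K := K) (hass.dvd.trans hkf)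
    · exact hprim.dvd_of_fraction_map_dvd_fraction_map (K := K) (hass.dvd.trans hkg)

end elim

section fin
variable {P Q F : MvPolynomial (Fin 4) ℝ} {r s r' s' : ℕ}

theorem elim_BP (f g : BP) (hf : f ≠ 0) :
    (∃ A B : BP, ∃ d : Polynomial ℝ, d ≠ 0 ∧ A * f + B * g = Polynomial.C d) ∨
    ∃ p : BP, Irreducible p ∧ 0 < p.natDegree ∧ p ∣ f ∧ p ∣ g := by
  let _ : NormalizationMonoid (Polynomial ℝ) := Classical.choice inferInstance
  let _ : NormalizedGCDMonoid (Polynomial ℝ) := UniqueFactorizationMonoid.toNormalizedGCDMonoid _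
  exact elim_gen f g hf

theorem fin_roots {d : Polynomial ℝ} (hd : d ≠ 0) : {x : ℂ | Polynomial.aeval x d = 0}.Finite := by
  apply (d.rootSet_finite ℂ).subset
  intro x hx
  exact (Polynomial.mem_rootSet).mpr ⟨hd, hx⟩

theorem exists_ev_root (p : BP) (hp : 0 < p.natDegree) (x : ℂ)
    (hx : Polynomial.aeval x p.leadingCoeff ≠ 0) : ∃ y : ℂ, ev x y p = 0 := by
  let φ : Polynomial ℝ →+* ℂ := (Polynomial.aeval x : Polynomial ℝ →ₐ[ℝ] ℂ).toRingHom
  have hl : φ p.leadingCoeff ≠ 0 := hx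
  have hdeg : (p.map φ).natDegree = p.natDegree :=
    Polynomial.natDegree_map_of_leadingCoeff_ne_zero φ hl
  obtain ⟨y, hy⟩ := IsAlgClosed.exists_root (p.map φ) (by
    intro h
    have := Polynomial.natDegree_eq_zero_iff_degree_le_zero.mpr (le_of_eq h)
    omega)
  refine ⟨y, ?_⟩
  rw [ev_eq]
  rw [Polynomial.IsRoot, Polynomial.eval_map] at hy
  exact hy

theorem hz_one (hP : BH P r s) (x y0 y1 : ℂ) (h0 : y0 ≠ 0)
    (h : eval ![1, x, y0, y1] (cF P) = 0) : ev x (y1 / y0) (deh P) = 0 := by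
  rw [ev_dehC]
  have := (hP.map (algebraMap ℝ ℂ)).eval_smul 1 y0 ![1, x, 1, y1 / y0]
  simp only [Matrix.cons_val_zero, Matrix.cons_val_one, Matrix.cons_val, mul_one, one_mul] at this
  rw [mul_div_cancel₀ _ h0] at this
  rw [show MvPolynomial.map (algebraMap ℝ ℂ) P = cF P from rfl, h] at this
  rcases mul_eq_zero.mp this.symm with h1 | h1
  · exact absurd h1 (by simp [h0])
  · exact h1

theorem hz_top (hP : BH P r s) (x y1 : ℂ) (h1 : y1 ≠ 0)
    (h : eval ![1, x, 0, y1] (cF P) = 0) : Polynomial.aeval x ((deh P).coeff s) = 0 := by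
  rw [← hz_yinf (r := r) (s := s) (deh_mem hP), hz_deh hP]
  have := (hP.map (algebraMap ℝ ℂ)).eval_smul 1 y1 ![1, x, 0, 1]
  simp only [Matrix.cons_val_zero, Matrix.cons_val_one, Matrix.cons_val, mul_one, one_mul, mul_zero] at this
  rw [show MvPolynomial.map (algebraMap ℝ ℂ) P = cF P from rfl, h] at this
  rcases mul_eq_zero.mp this.symm with h2 | h2
  · exact absurd h2 (by simp [h1])
  · exact h2

theorem fin_bad (hP : BH P r s) (hQ : BH Q r' s') {A B : BP} {d q : Polynomial ℝ} (hd : d ≠ 0)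
    (hAB : A * deh P + B * deh Q = Polynomial.C d) (hq0 : q ≠ 0)
    (hq : q = (deh P).coeff s ∨ q = (deh Q).coeff s') :
    {x : ℂ | ∃ y0 y1 : ℂ, (y0 ≠ 0 ∨ y1 ≠ 0) ∧ eval ![1, x, y0, y1] (cF P) = 0 ∧
      eval ![1, x, y0, y1] (cF Q) = 0}.Finite := by
  apply ((fin_roots hd).union (fin_roots hq0)).subset
  rintro x ⟨y0, y1, hy, h1, h2⟩
  by_cases h0 : y0 = 0
  · right
    subst h0
    have hy1 : y1 ≠ 0 := by simpa using hy
    rcases hq with rfl | rfl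
    · exact hz_top hP x y1 hy1 h1
    · exact hz_top hQ x y1 hy1 h2
  · left
    have e1 := hz_one hP x y0 y1 h0 h1
    have e2 := hz_one hQ x y0 y1 h0 h2
    have := congrArg (ev x (y1 / y0)) hAB
    rw [map_add, map_mul, map_mul, e1, e2, ev_C] at this
    simpa using this.symm

theorem no_sq (hF : BH F (r + 1) (s + 1)) (hN : NodeC (cF F)) (p h : BP) (hp : 0 < p.natDegree)
    (hf : deh F = p * p * h) : False := by
  have hl : p.leadingCoeff ≠ 0 := by
    intro h
    rw [Polynomial.leadingCoeff_eq_zero] at h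
    rw [h] at hp; simp at hp
  obtain ⟨x, hx⟩ := (fin_roots hl).infinite_compl.nonempty
  obtain ⟨y, hy⟩ := exists_ev_root p hp x hx
  apply node_aff hF hN x y
  · rw [hf]; simp [hy]
  · rw [hf]; simp [dX_mul, hy]
  · rw [hf]; simp [dY_mul, hy]
  · rw [hf]; simp [dX_mul, dY_mul, dX_add, dY_add, hy]; ring

theorem fin_A (hF : BH F (r + 1) (s + 1)) (hN : NodeC (cF F)) (h0 : (deh F).coeff (s + 1) ≠ 0) :
    {x : ℂ | ∃ y0 y1 : ℂ, (y0 ≠ 0 ∨ y1 ≠ 0) ∧ eval ![1, x, y0, y1] (pderiv 2 (cF F)) = 0 ∧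
      eval ![1, x, y0, y1] (pderiv 3 (cF F)) = 0}.Finite := by
  have hf0 : deh F ≠ 0 := by
    intro h; rw [h] at h0; simp at h0
  rcases elim_BP (deh F) (dY (deh F)) hf0 with ⟨A, B, d, hd, hAB⟩ | ⟨p, hp, hpd, ⟨h, h1⟩, h2⟩
  · rw [dY_deh] at hAB
    apply (fin_bad hF hF.pderiv3 hd hAB h0 (Or.inl rfl)).subset
    rintro x ⟨y0, y1, hy, e2, e3⟩
    refine ⟨y0, y1, hy, ?_, ?_⟩
    · have := (hF.map (algebraMap ℝ ℂ)).euler2 ![1, x, y0, y1]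
      simp only [Matrix.cons_val] at this
      change y0 * eval ![1, x, y0, y1] (pderiv 2 (cF F)) + y1 * eval ![1, x, y0, y1] (pderiv 3 (cF F))
        = _ at this
      rw [e2, e3, mul_zero, mul_zero, add_zero] at this
      rcases mul_eq_zero.mp this.symm with h | h
      · exfalso; norm_cast at h
      · exact h
    · rw [← pderiv_cF]; exact e3
  · exfalso
    rw [h1, dY_mul] at h2
    have h3 : p ∣ dY p * h := (dvd_add_left (dvd_mul_right p _)).mp h2
    rcases hp.prime.dvd_or_dvd h3 with h4 | ⟨k, h4⟩
    · have h5 : dY p ≠ 0 := by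
        intro h
        have := Polynomial.derivative_eq_zero.mp h
        omega
      have h6 := Polynomial.natDegree_le_of_dvd h4 h5
      have h7 := Polynomial.natDegree_derivative_lt (p := p) (by omega)
      have : (dY p).natDegree = (Polynomial.derivative p).natDegree := rfl
      omega
    · exact no_sq hF hN p k hpd (by rw [h1, h4, mul_assoc])

theorem fin_C (hP : BH P r s) (hQ : BH Q r s)
    (hi : ∀ y0 y1 : ℂ, (y0 ≠ 0 ∨ y1 ≠ 0) → eval ![1, Complex.I, y0, y1] (cF P) = 0 →
      eval ![1, Complex.I, y0, y1] (cF Q) ≠ 0) :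
    {x : ℂ | ∃ y0 y1 : ℂ, (y0 ≠ 0 ∨ y1 ≠ 0) ∧ eval ![1, x, y0, y1] (cF P) = 0 ∧
      eval ![1, x, y0, y1] (cF Q) = 0}.Finite := by
  have key : ∀ {P Q : MvPolynomial (Fin 4) ℝ}, BH P r s → BH Q r s → 
    (∀ y0 y1 : ℂ, (y0 ≠ 0 ∨ y1 ≠ 0) → eval ![1, Complex.I, y0, y1] (cF P) = 0 →
      eval ![1, Complex.I, y0, y1] (cF Q) ≠ 0) → eval ![1, Complex.I, 0, 1] (cF P) ≠ 0 →
    {x : ℂ | ∃ y0 y1 : ℂ, (y0 ≠ 0 ∨ y1 ≠ 0) ∧ eval ![1, x, y0, y1] (cF P) = 0 ∧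
      eval ![1, x, y0, y1] (cF Q) = 0}.Finite := by
    intro P Q hP hQ hi h0
    rw [← hz_deh hP, hz_yinf (deh_mem hP)] at h0
    have h1 : (deh P).coeff s ≠ 0 := by
      intro h; rw [h] at h0; simp at h0
    have hdeg : (deh P).natDegree = s :=
      le_antisymm (BD_natDegree (deh_mem hP)) (Polynomial.le_natDegree_of_ne_zero h1)
    have hf0 : deh P ≠ 0 := by
      intro h; rw [h] at h1; simp at h1
    rcases elim_BP (deh P) (deh Q) hf0 with ⟨A, B, d, hd, hAB⟩ | ⟨p, hp, hpd, ⟨h, h2⟩, ⟨k, h3⟩⟩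
    · exact fin_bad hP hQ hd hAB h1 (Or.inl rfl)
    · exfalso
      have hl : Polynomial.aeval Complex.I p.leadingCoeff ≠ 0 := by
        intro hl
        apply h0
        have e : (deh P).coeff s = (deh P).leadingCoeff := by rw [Polynomial.leadingCoeff, hdeg]
        rw [e, h2, Polynomial.leadingCoeff_mul, map_mul, hl, zero_mul]
      obtain ⟨y, hy⟩ := exists_ev_root p hpd _ hl
      apply hi 1 y (Or.inl one_ne_zero)
      · rw [← ev_dehC, h2, map_mul, hy, zero_mul]
      · rw [← ev_dehC, h3, map_mul, hy, zero_mul]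
  by_cases h : eval ![1, Complex.I, 0, 1] (cF P) = 0
  · have h' := hi 0 1 (Or.inr one_ne_zero) h
    apply (key hQ hP (fun y0 y1 hy h1 h2 => hi y0 y1 hy h2 h1) h').subset
    rintro x ⟨y0, y1, hy, h1, h2⟩
    exact ⟨y0, y1, hy, h2, h1⟩
  · exact key hP hQ hi h

end fin


section coords
variable {K : Type*} [CommRing K]

theorem lsub_lsub (G H : Matrix (Fin 4) (Fin 4) K) (F : MvPolynomial (Fin 4) K) :
    lsub G (lsub H F) = lsub (H * G) F := by
  have : (lsub G).comp (lsub H) = lsub (H * G) := by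
    apply MvPolynomial.algHom_ext
    intro j
    rw [AlgHom.comp_apply]
    simp only [lsub, aeval_X, map_sum, map_mul, Matrix.mul_apply, Finset.sum_mul, aeval_C,
      Finset.mul_sum, algebraMap_eq]
    rw [Finset.sum_comm]
    apply Finset.sum_congr rfl
    intro i _
    apply Finset.sum_congr rfl
    intro k _
    ring
  exact DFunLike.congr_fun this F

theorem pd_blk (g h : Matrix (Fin 2) (Fin 2) K) (F : MvPolynomial (Fin 4) K) (v : Fin 4 → K) :
    eval v (pderiv 0 (lsub (blk g h) F)) = g 0 0 * eval ((blk g h).mulVec v) (pderiv 0 F) +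
      g 1 0 * eval ((blk g h).mulVec v) (pderiv 1 F) ∧
    eval v (pderiv 1 (lsub (blk g h) F)) = g 0 1 * eval ((blk g h).mulVec v) (pderiv 0 F) +
      g 1 1 * eval ((blk g h).mulVec v) (pderiv 1 F) ∧
    eval v (pderiv 2 (lsub (blk g h) F)) = h 0 0 * eval ((blk g h).mulVec v) (pderiv 2 F) +
      h 1 0 * eval ((blk g h).mulVec v) (pderiv 3 F) ∧
    eval v (pderiv 3 (lsub (blk g h) F)) = h 0 1 * eval ((blk g h).mulVec v) (pderiv 2 F) +
      h 1 1 * eval ((blk g h).mulVec v) (pderiv 3 F) := by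
  have H := eval_pderiv_lsub (blk g h) v F
  generalize (blk g h).mulVec v = u at *
  refine ⟨?_, ?_, ?_, ?_⟩
  · have := congrFun H 0
    simpa [Matrix.mulVec, dotProduct, Fin.sum_univ_four, blk] using this
  · have := congrFun H 1
    simpa [Matrix.mulVec, dotProduct, Fin.sum_univ_four, blk] using this
  · have := congrFun H 2
    simpa [Matrix.mulVec, dotProduct, Fin.sum_univ_four, blk] using this
  · have := congrFun H 3
    simpa [Matrix.mulVec, dotProduct, Fin.sum_univ_four, blk] using this

theorem pd_swp (F : MvPolynomial (Fin 4) K) (x0 x1 y0 y1 : K) :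
    eval ![x0, x1, y0, y1] (pderiv 0 (lsub swp F)) = eval ![y0, y1, x0, x1] (pderiv 2 F) ∧
    eval ![x0, x1, y0, y1] (pderiv 1 (lsub swp F)) = eval ![y0, y1, x0, x1] (pderiv 3 F) ∧
    eval ![x0, x1, y0, y1] (pderiv 2 (lsub swp F)) = eval ![y0, y1, x0, x1] (pderiv 0 F) ∧
    eval ![x0, x1, y0, y1] (pderiv 3 (lsub swp F)) = eval ![y0, y1, x0, x1] (pderiv 1 F) := by
  have H := eval_pderiv_lsub swp ![x0, x1, y0, y1] F
  have e : (swp : Matrix (Fin 4) (Fin 4) K).mulVec ![x0, x1, y0, y1] = ![y0, y1, x0, x1] := by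
    rw [swp_mulVec]; rfl
  rw [e] at H
  generalize ![y0, y1, x0, x1] = u at *
  refine ⟨?_, ?_, ?_, ?_⟩
  · have := congrFun H 0
    simpa [Matrix.mulVec, dotProduct, Fin.sum_univ_four, swp] using this
  · have := congrFun H 1
    simpa [Matrix.mulVec, dotProduct, Fin.sum_univ_four, swp] using this
  · have := congrFun H 2
    simpa [Matrix.mulVec, dotProduct, Fin.sum_univ_four, swp] using this
  · have := congrFun H 3
    simpa [Matrix.mulVec, dotProduct, Fin.sum_univ_four, swp] using this

theorem eval_swp (F : MvPolynomial (Fin 4) K) (x0 x1 y0 y1 : K) :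
    eval ![x0, x1, y0, y1] (lsub swp F) = eval ![y0, y1, x0, x1] F := by
  rw [eval_lsub, swp_mulVec]; rfl

theorem RU_swp (F : MvPolynomial (Fin 4) K) (x0 x1 y0 y1 : K) :
    eval ![x0, x1, y0, y1] (RU (lsub swp F)) = eval ![y0, y1, x0, x1] (RV F) ∧
    eval ![x0, x1, y0, y1] (RV (lsub swp F)) = eval ![y0, y1, x0, x1] (RU F) := by
  obtain ⟨h0, h1, h2, h3⟩ := pd_swp F x0 x1 y0 y1
  rw [eval_RU, eval_RV, eval_RU, eval_RV, h0, h1, h2, h3]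
  exact ⟨rfl, rfl⟩

theorem blk_map {L : Type*} [CommRing L] (φ : K →+* L) (g h : Matrix (Fin 2) (Fin 2) K) :
    (blk g h).map φ = blk (g.map φ) (h.map φ) := by
  ext i j
  fin_cases i <;> fin_cases j <;> simp [blk]

theorem swp_map {L : Type*} [CommRing L] (φ : K →+* L) :
    (swp : Matrix (Fin 4) (Fin 4) K).map φ = swp := by
  ext i j
  fin_cases i <;> fin_cases j <;> simp [swp]

theorem cF_swp (F : MvPolynomial (Fin 4) ℝ) : cF (lsub swp F) = lsub swp (cF F) := by
  rw [cF, map_lsub, swp_map]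

/-- rotation by rho -/
def rot (ρ : K) : Matrix (Fin 2) (Fin 2) K := !![ρ, 1; -1, ρ]

theorem rot_mulVec (ρ ρ' x0 x1 y0 y1 : K) : (blk (rot ρ) (rot ρ')).mulVec ![x0, x1, y0, y1] =
    ![ρ * x0 + x1, ρ * x1 - x0, ρ' * y0 + y1, ρ' * y1 - y0] := by
  rw [blk_mulVec]
  funext i
  fin_cases i <;> simp [rot] <;> ring

theorem RUV_rot (ρ ρ' : K) (F : MvPolynomial (Fin 4) K) (x0 x1 y0 y1 : K) :
    eval ![x0, x1, y0, y1] (RU (lsub (blk (rot ρ) (rot ρ')) F)) =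
      eval ![ρ * x0 + x1, ρ * x1 - x0, ρ' * y0 + y1, ρ' * y1 - y0] (RU F) ∧
    eval ![x0, x1, y0, y1] (RV (lsub (blk (rot ρ) (rot ρ')) F)) =
      eval ![ρ * x0 + x1, ρ * x1 - x0, ρ' * y0 + y1, ρ' * y1 - y0] (RV F) := by
  obtain ⟨h0, h1, h2, h3⟩ := pd_blk (rot ρ) (rot ρ') F ![x0, x1, y0, y1]
  rw [rot_mulVec] at h0 h1 h2 h3
  rw [eval_RU, eval_RV, eval_RU, eval_RV, h0, h1, h2, h3]
  simp only [rot, Matrix.cons_val, Matrix.of_apply, Matrix.cons_val_zero, Matrix.cons_val_one]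
  constructor <;> ring

theorem rot_map {L : Type*} [CommRing L] (φ : K →+* L) (ρ : K) : (rot ρ).map φ = rot (φ ρ) := by
  ext i j
  fin_cases i <;> fin_cases j <;> simp [rot]

theorem eval_conj (F : MvPolynomial (Fin 4) ℝ) (x0 x1 y0 y1 : ℂ) :
    eval ![star x0, star x1, star y0, star y1] (cF F) = star (eval ![x0, x1, y0, y1] (cF F)) := by
  rw [← aeval_cF, ← aeval_cF]
  have : (Complex.conjAe.toAlgHom).comp (aeval ![x0, x1, y0, y1] : MvPolynomial (Fin 4) ℝ →ₐ[ℝ] ℂ) =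
      aeval ![star x0, star x1, star y0, star y1] := by
    apply MvPolynomial.algHom_ext
    intro i
    rw [AlgHom.comp_apply, aeval_X, aeval_X]
    fin_cases i <;> rfl
  rw [← this]
  rfl

/-- good coordinates -/
structure Good (F : MvPolynomial (Fin 4) ℝ) : Prop where
  p1 : ∀ y0 y1 : ℂ, (y0 ≠ 0 ∨ y1 ≠ 0) → eval ![1, Complex.I, y0, y1] (pderiv 2 (cF F)) = 0 →
    eval ![1, Complex.I, y0, y1] (pderiv 3 (cF F)) ≠ 0
  p2 : ∀ x0 x1 : ℂ, (x0 ≠ 0 ∨ x1 ≠ 0) → eval ![x0, x1, 1, Complex.I] (pderiv 0 (cF F)) = 0 →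
    eval ![x0, x1, 1, Complex.I] (pderiv 1 (cF F)) ≠ 0
  p3 : eval ![1, Complex.I, 1, Complex.I] (cF F) ≠ 0
  p4 : eval ![1, Complex.I, 1, -Complex.I] (cF F) ≠ 0

theorem Good.swp {F : MvPolynomial (Fin 4) ℝ} (hF : Good F) : Good (lsub swp F) := by
  have e := eval_conj F 1 Complex.I 1 (-Complex.I)
  have e' : eval ![1, -Complex.I, 1, Complex.I] (cF F) = star (eval ![1, Complex.I, 1, -Complex.I] (cF F)) := by
    rw [← e]; simp
  constructor
  · intro y0 y1 hy
    rw [cF_swp, (pd_swp _ _ _ _ _).2.2.1, (pd_swp _ _ _ _ _).2.2.2]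
    exact hF.p2 y0 y1 hy
  · intro y0 y1 hy
    rw [cF_swp, (pd_swp _ _ _ _ _).1, (pd_swp _ _ _ _ _).2.1]
    exact hF.p1 y0 y1 hy
  · rw [cF_swp, eval_swp]; exact hF.p3
  · rw [cF_swp, eval_swp, e']
    exact star_ne_zero.mpr hF.p4

theorem Good.pm {F : MvPolynomial (Fin 4) ℝ} (hF : Good F) (ε ε' : ℂ) (h : ε ^ 2 = -1)
    (h' : ε' ^ 2 = -1) : eval ![1, ε, 1, ε'] (cF F) ≠ 0 := by
  have e : ∀ z : ℂ, z ^ 2 = -1 → z = Complex.I ∨ z = -Complex.I := by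
    intro z hz
    rw [← Complex.I_sq] at hz
    exact sq_eq_sq_iff_eq_or_eq_neg.mp hz
  have c1 := eval_conj F 1 Complex.I 1 Complex.I
  have c2 := eval_conj F 1 Complex.I 1 (-Complex.I)
  simp only [star_one, star_neg, Complex.star_def, Complex.conj_I, neg_neg] at c1 c2
  rcases e ε h with rfl | rfl <;> rcases e ε' h' with rfl | rfl
  · exact hF.p3
  · exact hF.p4
  · rw [c2]; exact (map_ne_zero _).mpr hF.p4
  · rw [c1]; exact (map_ne_zero _).mpr hF.p3

theorem Good.noUV {F : MvPolynomial (Fin 4) ℝ} (hG : Good F) {r s : ℕ} (hF : BH F (r + 1) (s + 1))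
    (ε : ℂ) (h : ε ^ 2 = -1) (y0 y1 : ℂ) (hy : y0 ≠ 0 ∨ y1 ≠ 0)
    (hU : eval ![1, ε, y0, y1] (cF (RU F)) = 0) (hV : eval ![1, ε, y0, y1] (cF (RV F)) = 0) :
    False := by
  have hC : BH (cF F) (r + 1) (s + 1) := hF.map _
  rw [cF_RU, eval_RU] at hU
  rw [cF_RV, eval_RV] at hV
  have e1 := hC.euler1 ![1, ε, y0, y1]
  have e2 := hC.euler2 ![1, ε, y0, y1]
  simp only [Matrix.cons_val] at hU hV e1 e2
  have h0 : eval ![1, ε, y0, y1] (cF F) = 0 := by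
    have : ((r + 1 : ℕ) : ℂ) * eval ![1, ε, y0, y1] (cF F) = 0 := by
      rw [← e1]
      linear_combination ε * hU + eval ![1, ε, y0, y1] (pderiv 0 (cF F)) * h
    rcases mul_eq_zero.mp this with h | h
    · exfalso; norm_cast at h
    · exact h
  rw [h0, mul_zero] at e2
  by_cases hq : y0 ^ 2 + y1 ^ 2 = 0
  · have hy0 : y0 ≠ 0 := by
      rintro rfl
      rcases hy with h | h
      · exact h rfl
      · exact h (by simpa using hq)
    have := hC.eval_smul 1 y0 ![1, ε, 1, y1 / y0]
    simp only [Matrix.cons_val_zero, Matrix.cons_val_one, Matrix.cons_val, mul_one, one_mul] at this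
    rw [mul_div_cancel₀ _ hy0, h0] at this
    rcases mul_eq_zero.mp this.symm with h1 | h1
    · exact absurd h1 (by simp [hy0])
    · refine hG.pm ε (y1 / y0) h ?_ h1
      field_simp
      linear_combination hq
  · have f2 : eval ![1, ε, y0, y1] (pderiv 2 (cF F)) = 0 := by
      have : (y0 ^ 2 + y1 ^ 2) * eval ![1, ε, y0, y1] (pderiv 2 (cF F)) = 0 := by
        linear_combination y0 * e2 - y1 * hV
      exact (mul_eq_zero.mp this).resolve_left hq
    have f3 : eval ![1, ε, y0, y1] (pderiv 3 (cF F)) = 0 := by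
      have : (y0 ^ 2 + y1 ^ 2) * eval ![1, ε, y0, y1] (pderiv 3 (cF F)) = 0 := by
        linear_combination y1 * e2 + y0 * hV
      exact (mul_eq_zero.mp this).resolve_left hq
    rw [← Complex.I_sq] at h
    rcases sq_eq_sq_iff_eq_or_eq_neg.mp h with rfl | rfl
    · exact hG.p1 y0 y1 hy f2 f3
    · rw [pderiv_cF] at f2 f3
      refine hG.p1 (star y0) (star y1) ?_ ?_ ?_
      · simpa using hy
      · rw [pderiv_cF]
        have := eval_conj (pderiv 2 F) 1 (-Complex.I) y0 y1
        rw [f2] at this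
        simpa using this
      · rw [pderiv_cF]
        have := eval_conj (pderiv 3 F) 1 (-Complex.I) y0 y1
        rw [f3] at this
        simpa using this

end coords


section coords2

theorem pickR {S : Set ℂ} (hS : S.Finite) : ∃ t : ℝ, (t : ℂ) ∉ S := by
  have : (Complex.ofReal ⁻¹' S).Finite := hS.preimage Complex.ofReal_injective.injOn
  obtain ⟨t, ht⟩ := this.infinite_compl.nonempty
  exact ⟨t, ht⟩

theorem pickI {S : Set ℂ} (hS : S.Finite) : ∃ t : ℝ, t ≠ 0 ∧ Complex.I * t ∉ S := by
  have : ((fun t : ℝ => Complex.I * t) ⁻¹' S).Finite := by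
    apply hS.preimage
    intro x _ y _ h
    have := mul_left_cancel₀ Complex.I_ne_zero h
    exact_mod_cast this
  obtain ⟨t, ht⟩ := (this.union (Set.finite_singleton 0)).infinite_compl.nonempty
  refine ⟨t, ?_, ?_⟩
  · intro h; exact ht (Or.inr h)
  · intro h; exact ht (Or.inl h)

theorem fin_slice (f : BP) (x y' : ℂ) (h : ev x y' f ≠ 0) : {y : ℂ | ev x y f = 0}.Finite := by
  let φ : Polynomial ℝ →+* ℂ := (Polynomial.aeval x : Polynomial ℝ →ₐ[ℝ] ℂ).toRingHom
  have e : ∀ y, ev x y f = (f.map φ).eval y := by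
    intro y
    rw [ev_eq, Polynomial.eval_map]; rfl
  have h0 : f.map φ ≠ 0 := by
    intro h0
    rw [e, h0] at h
    simp at h
  apply ((f.map φ).roots.toFinset.finite_toSet).subset
  intro y hy
  simp only [Set.mem_ofPred_eq, e] at hy
  simp [h0, hy]

variable {F : MvPolynomial (Fin 4) ℝ} {a b : ℕ}

theorem NodeC_blk {Q : MvPolynomial (Fin 4) ℂ} (hQ : NodeC Q) (g h g' h' : Matrix (Fin 2) (Fin 2) ℂ)
    (hg : g' * g = 1) (hh : h' * h = 1) : NodeC (lsub (blk g h) Q) := by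
  apply NodeC.lsub hQ _ (blk g' h') (by rw [blk_mul, hg, hh, blk_one])
  intro v h1 h2
  rw [blk_mulVec]
  have a0 := congrFun (congrFun hg 0) 0
  have a1 := congrFun (congrFun hg 0) 1
  have a2 := congrFun (congrFun hg 1) 0
  have a3 := congrFun (congrFun hg 1) 1
  have b0 := congrFun (congrFun hh 0) 0
  have b1 := congrFun (congrFun hh 0) 1
  have b2 := congrFun (congrFun hh 1) 0
  have b3 := congrFun (congrFun hh 1) 1
  simp [Matrix.mul_apply] at a0 a1 a2 a3 b0 b1 b2 b3
  simp only [Matrix.cons_val_zero, Matrix.cons_val_one, Matrix.cons_val]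
  constructor
  · by_contra hc
    push Not at hc
    obtain ⟨c1, c2⟩ := hc
    rcases h1 with h1 | h1
    · apply h1
      linear_combination (-v 0) * a0 - v 1 * a1 + g' 0 0 * c1 + g' 0 1 * c2
    · apply h1
      linear_combination (-v 0) * a2 - v 1 * a3 + g' 1 0 * c1 + g' 1 1 * c2
  · by_contra hc
    push Not at hc
    obtain ⟨c1, c2⟩ := hc
    rcases h2 with h1 | h1
    · apply h1
      linear_combination (-v 2) * b0 - v 3 * b1 + h' 0 0 * c1 + h' 0 1 * c2
    · apply h1
      linear_combination (-v 2) * b2 - v 3 * b3 + h' 1 0 * c1 + h' 1 1 * c2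

theorem NodeC_swp {Q : MvPolynomial (Fin 4) ℂ} (hQ : NodeC Q) : NodeC (lsub swp Q) := by
  apply NodeC.lsub hQ _ swp swp_mul
  intro v h1 h2
  rw [swp_mulVec]
  exact ⟨h2, h1⟩

theorem Good_exists (hF : BH F (2 * a) (2 * b)) (ha : 1 ≤ a) (hb : 1 ≤ b) (hN : NodeC (cF F))
    (c1 : (deh F).coeff (2 * b) ≠ 0) (c2 : (deh (lsub swp F)).coeff (2 * a) ≠ 0) :
    ∃ t τ : ℝ, t ≠ 0 ∧ τ ≠ 0 ∧ Good (lsub (blk !![1, 0; 0, t] !![1, 0; 0, τ]) F) := by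
  obtain ⟨r, hr⟩ : ∃ r, 2 * a = r + 1 := ⟨2 * a - 1, by omega⟩
  obtain ⟨s, hs⟩ : ∃ s, 2 * b = s + 1 := ⟨2 * b - 1, by omega⟩
  rw [hr, hs] at hF
  rw [hr] at c2
  rw [hs] at c1
  have hN' : NodeC (cF (lsub swp F)) := by
    rw [cF_swp]
    exact NodeC_swp hN
  have fA := fin_A hF hN c1
  have fB := fin_A hF.lsub_swp hN' c2
  obtain ⟨t, ht, htS⟩ := pickI (fA.union (fin_roots c1))
  rw [Set.mem_union, not_or] at htS
  obtain ⟨ht1, ht2⟩ := htS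
  have hy' : ∃ y', ev (Complex.I * t) y' (deh F) ≠ 0 := by
    by_contra hcon
    push Not at hcon
    apply ht2
    show Polynomial.aeval (Complex.I * t) ((deh F).coeff (s + 1)) = 0
    let φ : Polynomial ℝ →+* ℂ := (Polynomial.aeval (Complex.I * t) : Polynomial ℝ →ₐ[ℝ] ℂ).toRingHom
    have : (deh F).map φ = 0 := by
      apply Polynomial.funext
      intro y
      rw [Polynomial.eval_map, Polynomial.eval_zero]
      exact hcon y
    have := congrArg (fun p => Polynomial.coeff p (s + 1)) this
    simpa [φ] using this
  obtain ⟨y', hy'⟩ := hy'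
  have fD := fin_slice (deh F) _ _ hy'
  have fE : (Set.image (fun z : ℂ => -z) {y : ℂ | ev (Complex.I * t) y (deh F) = 0}).Finite := fD.image _
  obtain ⟨τ, hτ, hτS⟩ := pickI (fB.union (fD.union fE))
  rw [Set.mem_union, Set.mem_union, not_or, not_or] at hτS
  obtain ⟨hτ1, hτ2, hτ3⟩ := hτS
  have hτ4 : ev (Complex.I * t) (-(Complex.I * τ)) (deh F) ≠ 0 := by
    intro h
    exact hτ3 ⟨_, h, by simp⟩
  refine ⟨t, τ, ht, hτ, ?_⟩
  have hcF : cF (lsub (blk !![1, 0; 0, t] !![1, 0; 0, τ]) F) =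
      lsub (blk !![1, 0; 0, (t : ℂ)] !![1, 0; 0, (τ : ℂ)]) (cF F) := by
    rw [cF, map_lsub, blk_map]
    have e : ∀ u : ℝ, (!![1, 0; 0, u] : Matrix (Fin 2) (Fin 2) ℝ).map (algebraMap ℝ ℂ) =
        !![1, 0; 0, (u : ℂ)] := by
      intro u
      ext i j; fin_cases i <;> fin_cases j <;> simp
    rw [e, e]
  have hmv : ∀ x0 x1 y0 y1 : ℂ, (blk !![1, 0; 0, (t : ℂ)] !![1, 0; 0, (τ : ℂ)]).mulVec
      ![x0, x1, y0, y1] = ![x0, t * x1, y0, τ * y1] := by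
    intro x0 x1 y0 y1
    rw [blk_mulVec]
    funext i; fin_cases i <;> simp
  have htC : (t : ℂ) ≠ 0 := by exact_mod_cast ht
  have hτC : (τ : ℂ) ≠ 0 := by exact_mod_cast hτ
  constructor
  · intro y0 y1 hy h2 h3
    rw [hcF] at h2 h3
    rw [(pd_blk _ _ _ _).2.2.1, hmv] at h2
    rw [(pd_blk _ _ _ _).2.2.2, hmv] at h3
    simp only [Matrix.of_apply, Matrix.cons_val', Matrix.cons_val_zero, Matrix.cons_val_one, one_mul,
      zero_mul, add_zero, zero_add, Matrix.cons_val_fin_one, mul_eq_zero, hτC, false_or] at h2 h3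
    rw [mul_comm (t : ℂ)] at h2 h3
    apply ht1
    refine ⟨y0, τ * y1, ?_, h2, h3⟩
    rcases hy with h | h
    · exact Or.inl h
    · exact Or.inr (mul_ne_zero hτC h)
  · intro y0 y1 hy h2 h3
    rw [hcF] at h2 h3
    rw [(pd_blk _ _ _ _).1, hmv] at h2
    rw [(pd_blk _ _ _ _).2.1, hmv] at h3
    simp only [Matrix.of_apply, Matrix.cons_val', Matrix.cons_val_zero, Matrix.cons_val_one, one_mul,
      zero_mul, add_zero, zero_add, Matrix.cons_val_fin_one, mul_eq_zero, htC, false_or] at h2 h3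
    rw [mul_comm (τ : ℂ)] at h2 h3
    apply hτ1
    refine ⟨y0, t * y1, ?_, ?_, ?_⟩
    · rcases hy with h | h
      · exact Or.inl h
      · exact Or.inr (mul_ne_zero htC h)
    · rw [cF_swp, (pd_swp _ _ _ _ _).2.2.1]; exact h2
    · rw [cF_swp, (pd_swp _ _ _ _ _).2.2.2]; exact h3
  · rw [hcF, eval_lsub, hmv, ← ev_dehC, mul_comm, mul_comm (τ : ℂ)]
    exact hτ2
  · rw [hcF, eval_lsub, hmv, ← ev_dehC, mul_comm, mul_comm (τ : ℂ), neg_mul]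
    exact hτ4

end coords2


section coords3
variable {F : MvPolynomial (Fin 4) ℝ} {a b : ℕ}

theorem cF_blk (g h : Matrix (Fin 2) (Fin 2) ℝ) : cF (lsub (blk g h) F) =
    lsub (blk (g.map (algebraMap ℝ ℂ)) (h.map (algebraMap ℝ ℂ))) (cF F) := by
  rw [cF, map_lsub, blk_map]

theorem mapC_mul {g' g : Matrix (Fin 2) (Fin 2) ℝ} (h : g' * g = 1) :
    g'.map (algebraMap ℝ ℂ) * g.map (algebraMap ℝ ℂ) = 1 := by
  rw [← Matrix.map_mul, h, Matrix.map_one _ (map_zero _) (map_one _)]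

theorem NodeC_blkR (hN : NodeC (cF F)) (g h g' h' : Matrix (Fin 2) (Fin 2) ℝ)
    (hg : g' * g = 1) (hh : h' * h = 1) : NodeC (cF (lsub (blk g h) F)) := by
  rw [cF_blk]
  exact NodeC_blk hN _ _ _ _ (mapC_mul hg) (mapC_mul hh)

theorem rot_inv (ρ : ℝ) : ∃ g : Matrix (Fin 2) (Fin 2) ℝ, g * rot ρ = 1 := by
  have h : ρ ^ 2 + 1 ≠ 0 := by positivity
  refine ⟨!![ρ / (ρ ^ 2 + 1), -1 / (ρ ^ 2 + 1); 1 / (ρ ^ 2 + 1), ρ / (ρ ^ 2 + 1)], ?_⟩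
  ext i j
  fin_cases i <;> fin_cases j <;> simp [rot, Matrix.mul_apply] <;> field_simp <;> ring

theorem cF_rot (ρ ρ' : ℝ) : cF (lsub (blk (rot ρ) (rot ρ')) F) =
    lsub (blk (rot (ρ : ℂ)) (rot (ρ' : ℂ))) (cF F) := by
  rw [cF_blk, rot_map, rot_map]; rfl

theorem scale1 {Q : MvPolynomial (Fin 4) ℂ} {r s : ℕ} (hQ : BH Q r s) (c x0 x1 y0 y1 : ℂ) :
    eval ![c * x0, c * x1, y0, y1] Q = c ^ r * eval ![x0, x1, y0, y1] Q := by
  have := hQ.eval_smul c 1 ![x0, x1, y0, y1]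
  simpa using this
theorem scale2 {Q : MvPolynomial (Fin 4) ℂ} {r s : ℕ} (hQ : BH Q r s) (c x0 x1 y0 y1 : ℂ) :
    eval ![x0, x1, c * y0, c * y1] Q = c ^ s * eval ![x0, x1, y0, y1] Q := by
  have := hQ.eval_smul 1 c ![x0, x1, y0, y1]
  simpa using this

theorem rot_ne (ρ : ℝ) (x0 x1 : ℂ) (h : x0 ≠ 0 ∨ x1 ≠ 0) :
    ρ * x0 + x1 ≠ 0 ∨ ρ * x1 - x0 ≠ 0 := by
  by_contra hc
  push Not at hc
  obtain ⟨h1, h2⟩ := hc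
  have hp : (ρ : ℂ) ^ 2 + 1 ≠ 0 := by
    have : ρ ^ 2 + 1 ≠ 0 := by positivity
    exact_mod_cast this
  rcases h with h | h
  · apply h
    have : ((ρ : ℂ) ^ 2 + 1) * x0 = 0 := by linear_combination ρ * h1 - h2
    exact (mul_eq_zero.mp this).resolve_left hp
  · apply h
    have : ((ρ : ℂ) ^ 2 + 1) * x1 = 0 := by linear_combination h1 + ρ * h2
    exact (mul_eq_zero.mp this).resolve_left hp

theorem rho_eps (ρ : ℝ) (ε : ℂ) (h : ε ^ 2 = -1) : (ρ : ℂ) + ε ≠ 0 := by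
  intro h1
  have hp : (ρ : ℂ) ^ 2 + 1 ≠ 0 := by
    have : ρ ^ 2 + 1 ≠ 0 := by positivity
    exact_mod_cast this
  apply hp
  linear_combination (ρ - ε) * h1 + h

theorem Good_noUV' (hG : Good F) {r s : ℕ} (hF : BH F (r + 1) (s + 1))
    (ε : ℂ) (h : ε ^ 2 = -1) (x0 x1 : ℂ) (hy : x0 ≠ 0 ∨ x1 ≠ 0)
    (hU : eval ![x0, x1, 1, ε] (cF (RU F)) = 0) (hV : eval ![x0, x1, 1, ε] (cF (RV F)) = 0) :
    False := by
  apply hG.swp.noUV hF.lsub_swp ε h x0 x1 hy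
  · rw [cF_RU, cF_swp, (RU_swp _ _ _ _ _).1, ← cF_RV]; exact hV
  · rw [cF_RV, cF_swp, (RU_swp _ _ _ _ _).2, ← cF_RU]; exact hU

theorem aff_of_good (hG : Good F) (hF : BH F (2 * a) (2 * b)) (ha : 1 ≤ a) (hb : 1 ≤ b)
    (hN : NodeC (cF F)) (hnn : ∀ v, 0 ≤ eval v F) :
    ∃ ρ ρ' : ℝ, AffHyp a b (deh (lsub (blk (rot ρ) (rot ρ')) F)) := by
  obtain ⟨r, hr⟩ : ∃ r, 2 * a = r + 1 := ⟨2 * a - 1, by omega⟩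
  obtain ⟨s, hs⟩ : ∃ s, 2 * b = s + 1 := ⟨2 * b - 1, by omega⟩
  have hF0 : BH F (r + 1) (s + 1) := by rw [← hr, ← hs]; exact hF
  have hUb : BH (RU F) (2 * a) (2 * b) := hF.RU (by omega)
  have hVb : BH (RV F) (2 * a) (2 * b) := hF.RV (by omega)
  have hUc : BH (cF (RU F)) (2 * a) (2 * b) := hUb.map _
  have hVc : BH (cF (RV F)) (2 * a) (2 * b) := hVb.map _
  have hFc : BH (cF F) (2 * a) (2 * b) := hF.map _
  have f1 := fin_C hUb hVb (fun y0 y1 hy h1 h2 => hG.noUV hF0 _ Complex.I_sq y0 y1 hy h1 h2)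
  have f2 := fin_C hUb.lsub_swp hVb.lsub_swp (by
    intro x0 x1 hx h1 h2
    rw [cF_swp, eval_swp] at h1 h2
    exact Good_noUV' hG hF0 _ Complex.I_sq x0 x1 hx h1 h2)
  have f3 := fin_slice (deh F) Complex.I Complex.I (by rw [ev_dehC]; exact hG.p3)
  obtain ⟨ρ, hρ⟩ := pickR f1
  obtain ⟨ρ', hρ'⟩ := pickR (f2.union f3)
  rw [Set.mem_union, not_or] at hρ'
  obtain ⟨hρ2, hρ3⟩ := hρ'
  refine ⟨ρ, ρ', ?_⟩
  set F' := lsub (blk (rot ρ) (rot ρ')) F with hF'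
  have hB : BH F' (2 * a) (2 * b) := hF.lsub_blk _ _
  have hB0 : BH F' (r + 1) (s + 1) := hF0.lsub_blk _ _
  have eU : UU (2 * a) (deh F') = deh (RU F') := UU_deh hB
  have eV : VV (2 * b) (deh F') = deh (RV F') := VV_deh hB
  have hUb' : BH (RU F') (2 * a) (2 * b) := hB.RU (by omega)
  have hVb' : BH (RV F') (2 * a) (2 * b) := hB.RV (by omega)
  have evU : ∀ x0 x1 y0 y1 : ℂ, eval ![x0, x1, y0, y1] (cF (RU F')) =
      eval ![ρ * x0 + x1, ρ * x1 - x0, ρ' * y0 + y1, ρ' * y1 - y0] (cF (RU F)) := by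
    intro x0 x1 y0 y1
    rw [cF_RU, hF', cF_rot, (RUV_rot _ _ _ _ _ _ _).1, cF_RU]
  have evV : ∀ x0 x1 y0 y1 : ℂ, eval ![x0, x1, y0, y1] (cF (RV F')) =
      eval ![ρ * x0 + x1, ρ * x1 - x0, ρ' * y0 + y1, ρ' * y1 - y0] (cF (RV F)) := by
    intro x0 x1 y0 y1
    rw [cF_RV, hF', cF_rot, (RUV_rot _ _ _ _ _ _ _).2, cF_RV]
  have nx : ∀ ε : ℂ, ε ^ 2 = -1 → ∀ y0 y1 : ℂ, (y0 ≠ 0 ∨ y1 ≠ 0) →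
      eval ![1, ε, y0, y1] (cF (RU F')) = 0 → eval ![1, ε, y0, y1] (cF (RV F')) = 0 → False := by
    intro ε hε y0 y1 hy h1 h2
    rw [evU] at h1
    rw [evV] at h2
    have e1 : (ρ : ℂ) * 1 + ε = (ρ + ε) * 1 := by ring
    have e2 : (ρ : ℂ) * ε - 1 = (ρ + ε) * ε := by linear_combination -hε
    rw [e1, e2, scale1 hUc] at h1
    rw [e1, e2, scale1 hVc] at h2
    have hn := pow_ne_zero (2 * a) (rho_eps ρ ε hε)
    exact hG.noUV hF0 ε hε _ _ (rot_ne ρ' y0 y1 hy) ((mul_eq_zero.mp h1).resolve_left hn)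
      ((mul_eq_zero.mp h2).resolve_left hn)
  have ny : ∀ ε : ℂ, ε ^ 2 = -1 → ∀ x0 x1 : ℂ, (x0 ≠ 0 ∨ x1 ≠ 0) →
      eval ![x0, x1, 1, ε] (cF (RU F')) = 0 → eval ![x0, x1, 1, ε] (cF (RV F')) = 0 → False := by
    intro ε hε y0 y1 hy h1 h2
    rw [evU] at h1
    rw [evV] at h2
    have e1 : (ρ' : ℂ) * 1 + ε = (ρ' + ε) * 1 := by ring
    have e2 : (ρ' : ℂ) * ε - 1 = (ρ' + ε) * ε := by linear_combination -hε
    rw [e1, e2, scale2 hUc] at h1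
    rw [e1, e2, scale2 hVc] at h2
    have hn := pow_ne_zero (2 * b) (rho_eps ρ' ε hε)
    exact Good_noUV' hG hF0 ε hε _ _ (rot_ne ρ y0 y1 hy) ((mul_eq_zero.mp h1).resolve_left hn)
      ((mul_eq_zero.mp h2).resolve_left hn)
  have hNF : NodeC (cF F') := by
    obtain ⟨g, hg⟩ := rot_inv ρ
    obtain ⟨h, hh⟩ := rot_inv ρ'
    exact NodeC_blkR hN _ _ g h hg hh
  refine ⟨ha, hb, deh_mem hB, ?_, ?_, ?_, ?_, ?_⟩
  · rw [eU, eV]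
    refine ⟨by omega, by omega, deh_mem hUb', deh_mem hVb', ?_, ?_⟩
    · intro y0 y1 hy
      rw [hz_deh hUb', hz_deh hVb', evU, evV]
      by_contra hc
      push Not at hc
      apply hρ
      refine ⟨_, _, rot_ne ρ' y0 y1 hy, ?_, ?_⟩
      · simpa using hc.1
      · simpa using hc.2
    · intro y0 y1 hy
      rw [hz_deh hUb', hz_deh hVb', evU, evV]
      by_contra hc
      push Not at hc
      apply hρ2
      refine ⟨_, _, rot_ne ρ y0 y1 hy, ?_, ?_⟩
      · rw [cF_swp, eval_swp]
        simpa using hc.1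
      · rw [cF_swp, eval_swp]
        simpa using hc.2
  · intro x y h1 h2
    rw [eU, ev_dehC] at h1
    rw [eV, ev_dehC] at h2
    constructor
    · intro h
      exact nx x (by linear_combination h) 1 y (Or.inl one_ne_zero) h1 h2
    · intro h
      exact ny y (by linear_combination h) 1 x (Or.inl one_ne_zero) h1 h2
  · rw [← hz_yinf (deh_mem hB), hz_deh hB, hF', cF_rot, eval_lsub, rot_mulVec]
    have e1 : (ρ : ℂ) * 1 + Complex.I = (ρ + Complex.I) * 1 := by ring
    have e2 : (ρ : ℂ) * Complex.I - 1 = (ρ + Complex.I) * Complex.I := by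
      linear_combination -Complex.I_sq
    rw [e1, e2, scale1 hFc]
    refine mul_ne_zero (pow_ne_zero _ (rho_eps ρ _ Complex.I_sq)) ?_
    intro h
    apply hρ3
    show ev Complex.I (ρ' : ℂ) (deh F) = 0
    rw [ev_dehC]
    simpa using h
  · exact node_aff hB0 hNF
  · intro x y
    rw [ev_dehR, hF', eval_lsub]
    exact hnn _

theorem good_coords (hF : BH F (2 * a) (2 * b)) (ha : 1 ≤ a) (hb : 1 ≤ b)
    (hN : NodeC (cF F)) (hnn : ∀ v, 0 ≤ eval v F)
    (c1 : (deh F).coeff (2 * b) ≠ 0) (c2 : (deh (lsub swp F)).coeff (2 * a) ≠ 0) :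
    ∃ g h g' h' : Matrix (Fin 2) (Fin 2) ℝ, g' * g = 1 ∧ h' * h = 1 ∧
      AffHyp a b (deh (lsub (blk g h) F)) := by
  obtain ⟨t, τ, ht, hτ, hG⟩ := Good_exists hF ha hb hN c1 c2
  have hi : ∀ u : ℝ, u ≠ 0 → (!![1, 0; 0, u⁻¹] : Matrix (Fin 2) (Fin 2) ℝ) * !![1, 0; 0, u] = 1 := by
    intro u hu
    ext i j
    fin_cases i <;> fin_cases j <;> simp [Matrix.mul_apply, hu]
  obtain ⟨ρ, ρ', H⟩ := aff_of_good hG (hF.lsub_blk _ _) ha hb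
    (NodeC_blkR hN _ _ _ _ (hi t ht) (hi τ hτ)) (by
      intro v
      rw [eval_lsub]; exact hnn _)
  rw [lsub_lsub, blk_mul] at H
  obtain ⟨g, hg⟩ := rot_inv ρ
  obtain ⟨h, hh⟩ := rot_inv ρ'
  refine ⟨_, _, g * !![1, 0; 0, t⁻¹], h * !![1, 0; 0, τ⁻¹], ?_, ?_, H⟩
  · rw [Matrix.mul_assoc, ← Matrix.mul_assoc _ _ (rot ρ), hi t ht, Matrix.one_mul, hg]
  · rw [Matrix.mul_assoc, ← Matrix.mul_assoc _ _ (rot ρ'), hi τ hτ, Matrix.one_mul, hh]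

end coords3


section proj
variable {K : Type*} [Field K]

/-- affine coordinate of a projective point -/
noncomputable def pc (g : Matrix (Fin 2) (Fin 2) K) (p : Projectivization K (Fin 2 → K)) : K :=
  (g.mulVec p.rep) 1 / (g.mulVec p.rep) 0

theorem pc_inj {g g' : Matrix (Fin 2) (Fin 2) K} (h : g * g' = 1)
    {p q : Projectivization K (Fin 2 → K)} (hp : (g'.mulVec p.rep) 0 ≠ 0)
    (hq : (g'.mulVec q.rep) 0 ≠ 0) (e : pc g' p = pc g' q) : p = q := by
  rw [← p.mk_rep, ← q.mk_rep, Projectivization.mk_eq_mk_iff']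
  refine ⟨(g'.mulVec p.rep) 0 / (g'.mulVec q.rep) 0, ?_⟩
  have h1 : g'.mulVec (((g'.mulVec p.rep) 0 / (g'.mulVec q.rep) 0) • q.rep) = g'.mulVec p.rep := by
    rw [Matrix.mulVec_smul]
    unfold pc at e
    generalize g'.mulVec p.rep = u at *
    generalize g'.mulVec q.rep = w at *
    rw [div_eq_div_iff hp hq] at e
    funext i
    fin_cases i
    · simp [hq]
    · simp
      field_simp
      linear_combination -e
  have h2 := congrArg g.mulVec h1
  rwa [Matrix.mulVec_mulVec, Matrix.mulVec_mulVec, h, Matrix.one_mulVec, Matrix.one_mulVec] at h2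

theorem rep_ne (p : Projectivization K (Fin 2 → K)) : p.rep 0 ≠ 0 ∨ p.rep 1 ≠ 0 := by
  by_contra hc
  push Not at hc
  apply p.rep_nonzero
  funext i
  fin_cases i
  · exact hc.1
  · exact hc.2

theorem mulVec_ne {g g' : Matrix (Fin 2) (Fin 2) K} (h : g * g' = 1)
    (p : Projectivization K (Fin 2 → K)) : (g'.mulVec p.rep) 0 ≠ 0 ∨ (g'.mulVec p.rep) 1 ≠ 0 := by
  by_contra hc
  push Not at hc
  apply p.rep_nonzero
  have : g'.mulVec p.rep = 0 := by
    funext i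
    fin_cases i
    · exact hc.1
    · exact hc.2
  have h2 := congrArg g.mulVec this
  rwa [Matrix.mulVec_mulVec, h, Matrix.one_mulVec, Matrix.mulVec_zero] at h2

theorem vec_ne {x0 x1 : K} (h : x0 ≠ 0 ∨ x1 ≠ 0) : (![x0, x1] : Fin 2 → K) ≠ 0 := by
  intro h0
  have a := congrFun h0 0
  have b := congrFun h0 1
  simp at a b
  rcases h with h | h
  · exact h a
  · exact h b

theorem mk_rep2 {x0 x1 : K} (h : x0 ≠ 0 ∨ x1 ≠ 0) : ∃ c : K, c ≠ 0 ∧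
    (Projectivization.mk K ![x0, x1] (vec_ne h)).rep 0 = c * x0 ∧
    (Projectivization.mk K ![x0, x1] (vec_ne h)).rep 1 = c * x1 := by
  obtain ⟨c, hc⟩ := Projectivization.exists_smul_eq_mk_rep K ![x0, x1] (vec_ne h)
  refine ⟨c, c.ne_zero, ?_, ?_⟩
  · rw [← hc]; rfl
  · rw [← hc]; rfl

end proj

section rank

theorem rank_smul' {k : ℂ} (hk : k ≠ 0) (M : Matrix (Fin 4) (Fin 4) ℂ) : (k • M).rank = M.rank := by
  have : k • M = (k • (1 : Matrix (Fin 4) (Fin 4) ℂ)) * M := by simp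
  rw [this, Matrix.rank_mul_eq_right_of_isUnit_det]
  rw [Matrix.det_smul, Matrix.det_one, mul_one]
  exact isUnit_iff_ne_zero.mpr (pow_ne_zero _ hk)

theorem hess_C_mul (k : ℂ) (Q : MvPolynomial (Fin 4) ℂ) (v : Fin 4 → ℂ) :
    hess (C k * Q) v = k • hess Q v := by
  ext i j
  simp [hess]

theorem NodeC.neg {Q : MvPolynomial (Fin 4) ℂ} (h : NodeC Q) : NodeC (-Q) := by
  intro v h1 h2 hs
  have e : -Q = C (-1) * Q := by simp
  rw [e, hess_C_mul, rank_smul' (by norm_num)]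
  apply h v h1 h2
  intro i
  have := hs i
  rw [map_neg, map_neg, neg_eq_zero] at this
  exact this

theorem pd_smul {Q : MvPolynomial (Fin 4) ℂ} {r s : ℕ} (hQ : BH Q (r + 1) (s + 1)) (c d : ℂ)
    (hc : c ≠ 0) (hd : d ≠ 0) (x0 x1 y0 y1 : ℂ) (i : Fin 4) :
    eval ![c * x0, c * x1, d * y0, d * y1] (pderiv i Q) = 0 ↔
      eval ![x0, x1, y0, y1] (pderiv i Q) = 0 := by
  have key : ∀ {P : MvPolynomial (Fin 4) ℂ} {r' s' : ℕ}, BH P r' s' →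
      (eval ![c * x0, c * x1, d * y0, d * y1] P = 0 ↔ eval ![x0, x1, y0, y1] P = 0) := by
    intro P r' s' hP
    have := hP.eval_smul c d ![x0, x1, y0, y1]
    simp only [Matrix.cons_val_zero, Matrix.cons_val_one, Matrix.cons_val] at this
    rw [this, mul_eq_zero, or_iff_right (mul_ne_zero (pow_ne_zero _ hc) (pow_ne_zero _ hd))]
  fin_cases i
  · exact key hQ.pderiv0
  · exact key hQ.pderiv1
  · exact key hQ.pderiv2
  · exact key hQ.pderiv3

theorem nodeC_of {Q : MvPolynomial (Fin 4) ℂ} {r s : ℕ} (hQ : BH Q (r + 1) (s + 1))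
    (h : ∀ p ∈ SingSet2 Q, IsNodeAt2 Q p) : NodeC Q := by
  intro v h1 h2 hs
  have hv : v = ![v 0, v 1, v 2, v 3] := by
    funext i; fin_cases i <;> rfl
  obtain ⟨c, hc, c0, c1⟩ := mk_rep2 h1
  obtain ⟨d, hd, d0, d1⟩ := mk_rep2 h2
  have hm := h (Projectivization.mk ℂ ![v 0, v 1] (vec_ne h1), Projectivization.mk ℂ ![v 2, v 3] (vec_ne h2))
    (by
      intro i
      simp only [c0, c1, d0, d1]
      rw [pd_smul hQ c d hc hd, ← hv]
      exact hs i)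
  unfold IsNodeAt2 at hm
  simp only [c0, c1, d0, d1] at hm
  set D : Matrix (Fin 4) (Fin 4) ℂ := blk !![c, 0; 0, c] !![d, 0; 0, d] with hD
  have hDv : ∀ w : Fin 4 → ℂ, D.mulVec w = ![c * w 0, c * w 1, d * w 2, d * w 3] := by
    intro w
    rw [hD, blk_mulVec]
    funext i; fin_cases i <;> simp
  have hdet : IsUnit D.det := by
    have : D * blk !![c⁻¹, 0; 0, c⁻¹] !![d⁻¹, 0; 0, d⁻¹] = 1 := by
      rw [hD, blk_mul, ← blk_one]
      have e : ∀ z : ℂ, z ≠ 0 → (!![z, 0; 0, z] : Matrix (Fin 2) (Fin 2) ℂ) * !![z⁻¹, 0; 0, z⁻¹] = 1 := by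
        intro z hz
        ext i j; fin_cases i <;> fin_cases j <;> simp [Matrix.mul_apply, hz]
      rw [e c hc, e d hd]
    have := congrArg Matrix.det this
    rw [Matrix.det_mul, Matrix.det_one] at this
    exact IsUnit.of_mul_eq_one _ this
  have hls : lsub D Q = C (c ^ (r + 1) * d ^ (s + 1)) * Q := by
    apply MvPolynomial.funext
    intro w
    rw [eval_lsub, hDv, hQ.eval_smul, map_mul, eval_C]
  have hh := hess_lsub D v Q
  rw [hls, hess_C_mul, hDv] at hh
  have hr := congrArg Matrix.rank hh
  rw [rank_smul' (mul_ne_zero (pow_ne_zero _ hc) (pow_ne_zero _ hd)),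
    Matrix.rank_mul_eq_left_of_isUnit_det _ _ hdet,
    Matrix.rank_mul_eq_right_of_isUnit_det _ _ (by rwa [Matrix.det_transpose])] at hr
  rw [hr]
  exact hm

end rank

section realz
variable {F : MvPolynomial (Fin 4) ℝ} {a b : ℕ}

theorem hasDeriv_line (v : Fin 4 → ℝ) (i : Fin 4) (F : MvPolynomial (Fin 4) ℝ) :
    HasDerivAt (fun t : ℝ => eval (Function.update v i t) F) (eval v (pderiv i F)) (v i) := by
  induction F using MvPolynomial.induction_on with
  | C c =>
    have e : (fun t : ℝ => eval (Function.update v i t) (C c)) = fun _ => c := by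
      funext t; simp
    rw [e, pderiv_C, map_zero]
    exact hasDerivAt_const (v i) c
  | add p q hp hq =>
    have e : (fun t : ℝ => eval (Function.update v i t) (p + q)) =
        (fun t : ℝ => eval (Function.update v i t) p) + fun t : ℝ => eval (Function.update v i t) q := by
      funext t; simp
    rw [e, map_add, map_add]
    exact hp.add hq
  | mul_X p k hp =>
    have hk : HasDerivAt (fun t : ℝ => eval (Function.update v i t) (X k)) (eval v (pderiv i (X k))) (v i) := by
      by_cases h : k = i
      · subst h
        have e : (fun t : ℝ => eval (Function.update v k t) (X k)) = id := by
          funext t; simp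
        rw [e, pderiv_X_self, map_one]
        exact hasDerivAt_id (v k)
      · have e : (fun t : ℝ => eval (Function.update v i t) (X k)) = fun _ => v k := by
          funext t; simp [Function.update_of_ne h]
        rw [e, pderiv_X_of_ne h, map_zero]
        exact hasDerivAt_const (v i) (v k)
    have := hp.mul hk
    have e : (fun t : ℝ => eval (Function.update v i t) (p * X k)) =
        (fun t : ℝ => eval (Function.update v i t) p) * fun t : ℝ => eval (Function.update v i t) (X k) := by
      funext t; simp
    rw [e, pderiv_mul, map_add, map_mul, map_mul]
    rw [Function.update_eq_self] at this
    exact this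

theorem zero_sing (hnn : ∀ v, 0 ≤ eval v F) (v : Fin 4 → ℝ) (h : eval v F = 0) (i : Fin 4) :
    eval v (pderiv i F) = 0 := by
  apply IsLocalMin.hasDerivAt_eq_zero _ (hasDeriv_line v i F)
  apply Filter.Eventually.of_forall
  intro t
  show eval (Function.update v i (v i)) F ≤ eval (Function.update v i t) F
  rw [Function.update_eq_self, h]
  exact hnn _

theorem evalC_ofReal (x0 x1 y0 y1 : ℝ) (F : MvPolynomial (Fin 4) ℝ) :
    eval ![(x0 : ℂ), (x1 : ℂ), (y0 : ℂ), (y1 : ℂ)] (cF F) = ((eval ![x0, x1, y0, y1] F : ℝ) : ℂ) := by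
  rw [← aeval_cF]
  have := aeval_algebraMap_apply ℂ ![x0, x1, y0, y1] F
  rw [aeval_eq_eval] at this
  have e : (algebraMap ℝ ℂ) ∘ ![x0, x1, y0, y1] = ![(x0 : ℂ), (x1 : ℂ), (y0 : ℂ), (y1 : ℂ)] := by
    funext i; fin_cases i <;> rfl
  rw [← e]
  exact this

theorem mem_RZ2 (hF : BH F (2 * a) (2 * b)) {x0 x1 y0 y1 : ℝ} (hx : x0 ≠ 0 ∨ x1 ≠ 0)
    (hy : y0 ≠ 0 ∨ y1 ≠ 0) (h : eval ![x0, x1, y0, y1] F = 0) :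
    (Projectivization.mk ℝ ![x0, x1] (vec_ne hx), Projectivization.mk ℝ ![y0, y1] (vec_ne hy)) ∈
      RZ2 F := by
  obtain ⟨c, hc, c0, c1⟩ := mk_rep2 hx
  obtain ⟨d, hd, d0, d1⟩ := mk_rep2 hy
  show eval _ F = 0
  simp only [c0, c1, d0, d1]
  have := hF.eval_smul c d ![x0, x1, y0, y1]
  simp only [Matrix.cons_val_zero, Matrix.cons_val_one, Matrix.cons_val] at this
  rw [this, h, mul_zero]

theorem mk_one_inj {x y : ℝ} (h : Projectivization.mk ℝ ![1, x] (vec_ne (Or.inl one_ne_zero)) =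
    Projectivization.mk ℝ ![1, y] (vec_ne (Or.inl one_ne_zero))) : x = y := by
  rw [Projectivization.mk_eq_mk_iff'] at h
  obtain ⟨c, hc⟩ := h
  have h0 := congrFun hc 0
  have h1 := congrFun hc 1
  simp at h0 h1
  rw [← h1, h0, one_mul]

theorem coeff_ne1 (hF : BH F (2 * a) (2 * b)) (hfin : (RZ2 F).Finite) :
    (deh F).coeff (2 * b) ≠ 0 := by
  intro h
  have hz : ∀ x : ℝ, eval ![1, x, 0, 1] F = 0 := by
    intro x
    have h1 := hz_deh hF 1 (x : ℂ) 0 1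
    rw [hz_yinf (deh_mem hF), h, map_zero] at h1
    have h2 := evalC_ofReal 1 x 0 1 F
    simp only [Complex.ofReal_one, Complex.ofReal_zero] at h2
    rw [← h1] at h2
    exact_mod_cast h2.symm
  refine (Set.infinite_of_injective_forall_mem (f := fun x : ℝ =>
    (Projectivization.mk ℝ ![1, x] (vec_ne (Or.inl one_ne_zero)),
      Projectivization.mk ℝ ![(0 : ℝ), 1] (vec_ne (Or.inr one_ne_zero)))) ?_ ?_) hfin
  · intro x y hxy
    exact mk_one_inj (Prod.ext_iff.mp hxy).1
  · intro x
    exact mem_RZ2 hF (Or.inl one_ne_zero) (Or.inr one_ne_zero) (hz x)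

theorem coeff_ne2 (hF : BH F (2 * a) (2 * b)) (hfin : (RZ2 F).Finite) :
    (deh (lsub swp F)).coeff (2 * a) ≠ 0 := by
  intro h
  have hz : ∀ x : ℝ, eval ![0, 1, 1, x] F = 0 := by
    intro x
    have h1 := hz_deh hF.lsub_swp 1 (x : ℂ) 0 1
    rw [hz_yinf (deh_mem hF.lsub_swp), h, map_zero, cF_swp, eval_swp] at h1
    have h2 := evalC_ofReal 0 1 1 x F
    simp only [Complex.ofReal_one, Complex.ofReal_zero] at h2
    rw [← h1] at h2
    exact_mod_cast h2.symm
  refine (Set.infinite_of_injective_forall_mem (f := fun x : ℝ =>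
    (Projectivization.mk ℝ ![(0 : ℝ), 1] (vec_ne (Or.inr one_ne_zero)),
      Projectivization.mk ℝ ![1, x] (vec_ne (Or.inl one_ne_zero)))) ?_ ?_) hfin
  · intro x y hxy
    exact mk_one_inj (Prod.ext_iff.mp hxy).2
  · intro x
    exact mem_RZ2 hF (Or.inr one_ne_zero) (Or.inl one_ne_zero) (hz x)

theorem nonneg_ext (hF : BH F (2 * a) (2 * b)) (h : ∀ x y : ℝ, 0 ≤ eval ![1, x, 1, y] F)
    (v : Fin 4 → ℝ) : 0 ≤ eval v F := by
  have h1 : ∀ x0 x1 y0 y1 : ℝ, x0 ≠ 0 → y0 ≠ 0 → 0 ≤ eval ![x0, x1, y0, y1] F := by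
    intro x0 x1 y0 y1 hx hy
    have := hF.eval_smul x0 y0 ![1, x1 / x0, 1, y1 / y0]
    simp only [Matrix.cons_val_zero, Matrix.cons_val_one, Matrix.cons_val, mul_one] at this
    rw [mul_div_cancel₀ _ hx, mul_div_cancel₀ _ hy] at this
    rw [this]
    have := h (x1 / x0) (y1 / y0)
    have e1 : 0 ≤ x0 ^ (2 * a) := (even_two_mul a).pow_nonneg x0
    have e2 : 0 ≤ y0 ^ (2 * b) := (even_two_mul b).pow_nonneg y0
    positivity
  have hc : Continuous (fun t : ℝ => eval ![v 0 + t, v 1, v 2 + t, v 3] F) := by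
    apply (MvPolynomial.continuous_eval F).comp
    apply continuous_pi
    intro i
    fin_cases i <;> simp <;> fun_prop
  have hcl : IsClosed {t : ℝ | 0 ≤ eval ![v 0 + t, v 1, v 2 + t, v 3] F} :=
    isClosed_le continuous_const hc
  have hd : Dense (({-v 0, -v 2} : Set ℝ)ᶜ) := Set.Countable.dense_compl ℝ (Set.to_countable _)
  have hsub : (({-v 0, -v 2} : Set ℝ)ᶜ) ⊆ {t : ℝ | 0 ≤ eval ![v 0 + t, v 1, v 2 + t, v 3] F} := by
    intro t ht
    simp only [Set.mem_compl_iff, Set.mem_insert_iff, Set.mem_singleton_iff, not_or] at ht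
    apply h1
    · intro h; exact ht.1 (by linarith)
    · intro h; exact ht.2 (by linarith)
  have h2 := (hd.mono hsub).closure_eq
  rw [hcl.closure_eq] at h2
  have h3 : (0 : ℝ) ∈ {t : ℝ | 0 ≤ eval ![v 0 + t, v 1, v 2 + t, v 3] F} := by rw [h2]; trivial
  have h4 : 0 ≤ eval ![v 0 + 0, v 1, v 2 + 0, v 3] F := h3
  have hv : v = ![v 0, v 1, v 2, v 3] := by
    funext i; fin_cases i <;> rfl
  rw [add_zero, add_zero, ← hv] at h4
  exact h4

theorem sign_F (hF : BH F (2 * a) (2 * b)) (hfin : (RZ2 F).Finite) :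
    (∀ v, 0 ≤ eval v F) ∨ (∀ v, 0 ≤ eval v (-F)) := by
  let Z : Set (ℝ × ℝ) := {z | eval ![1, z.1, 1, z.2] F = 0}
  have hZ : Z.Finite := by
    apply Set.Finite.of_injOn (t := RZ2 F) (f := fun z : ℝ × ℝ =>
      (Projectivization.mk ℝ ![1, z.1] (vec_ne (Or.inl one_ne_zero)),
        Projectivization.mk ℝ ![1, z.2] (vec_ne (Or.inl one_ne_zero)))) _ _ hfin
    · intro z hz
      exact mem_RZ2 hF (Or.inl one_ne_zero) (Or.inl one_ne_zero) hz
    · intro z _ w _ h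
      have h' := Prod.ext_iff.mp h
      exact Prod.ext (mk_one_inj h'.1) (mk_one_inj h'.2)
  have hconn : IsPreconnected Zᶜ :=
    (Set.Countable.isPathConnected_compl_of_one_lt_rank (by
      rw [rank_prod', Module.rank_self]; norm_num) hZ.countable).isConnected.isPreconnected
  have hc : Continuous (fun z : ℝ × ℝ => eval ![1, z.1, 1, z.2] F) := by
    apply (MvPolynomial.continuous_eval F).comp
    apply continuous_pi
    intro i
    fin_cases i <;> simp <;> fun_prop
  by_cases hpos : ∀ x y : ℝ, 0 ≤ eval ![1, x, 1, y] F
  · exact Or.inl (nonneg_ext hF hpos)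
  · right
    apply nonneg_ext hF.neg
    push Not at hpos
    obtain ⟨x, y, hxy⟩ := hpos
    intro x' y'
    by_contra hneg
    push Not at hneg
    rw [map_neg] at hneg
    have := hconn.intermediate_value (a := (x, y)) (b := (x', y')) (by
      intro h; exact hxy.ne h) (by
      intro h
      have : eval ![1, x', 1, y'] F = 0 := h
      linarith) hc.continuousOn
    obtain ⟨z, hz, hz0⟩ := this (show (0 : ℝ) ∈ _ from ⟨hxy.le, by
      show 0 ≤ eval ![1, x', 1, y'] F
      linarith⟩)
    exact hz hz0

end realz


section final
variable {F : MvPolynomial (Fin 4) ℝ} {a b : ℕ}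

theorem sing_aff (hF : BH F (2 * a) (2 * b)) (H : AffHyp a b (deh F)) (u0 u1 u2 u3 : ℂ)
    (h1 : u0 ≠ 0 ∨ u1 ≠ 0) (h2 : u2 ≠ 0 ∨ u3 ≠ 0)
    (hs : ∀ i, eval ![u0, u1, u2, u3] (pderiv i (cF F)) = 0) :
    u0 ≠ 0 ∧ u2 ≠ 0 ∧ ev (u1 / u0) (u3 / u2) (deh F) = 0 ∧
      ev (u1 / u0) (u3 / u2) (dX (deh F)) = 0 ∧ ev (u1 / u0) (u3 / u2) (dY (deh F)) = 0 := by
  have ha := H.ha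
  have hb := H.hb
  have hUb : BH (RU F) (2 * a) (2 * b) := hF.RU (by omega)
  have hVb : BH (RV F) (2 * a) (2 * b) := hF.RV (by omega)
  have hUc : BH (cF (RU F)) (2 * a) (2 * b) := hUb.map _
  have hVc : BH (cF (RV F)) (2 * a) (2 * b) := hVb.map _
  have hI := H.inf
  rw [UU_deh hF, VV_deh hF] at hI
  have hU : eval ![u0, u1, u2, u3] (cF (RU F)) = 0 := by
    rw [cF_RU, eval_RU, hs, hs]; simp
  have hV : eval ![u0, u1, u2, u3] (cF (RV F)) = 0 := by
    rw [cF_RV, eval_RV, hs, hs]; simp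
  have n0 : u0 ≠ 0 := by
    rintro rfl
    have hu1 : u1 ≠ 0 := by simpa using h1
    have hn := pow_ne_zero (2 * a) hu1
    have e1 := scale1 hUc u1 0 1 u2 u3
    have e2 := scale1 hVc u1 0 1 u2 u3
    rw [mul_zero, mul_one] at e1 e2
    rw [hU] at e1
    rw [hV] at e2
    rcases hI.infx u2 u3 h2 with h | h
    · rw [hz_deh hUb] at h
      exact h ((mul_eq_zero.mp e1.symm).resolve_left hn)
    · rw [hz_deh hVb] at h
      exact h ((mul_eq_zero.mp e2.symm).resolve_left hn)
  have n2 : u2 ≠ 0 := by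
    rintro rfl
    have hu1 : u3 ≠ 0 := by simpa using h2
    have hn := pow_ne_zero (2 * b) hu1
    have e1 := scale2 hUc u3 u0 u1 0 1
    have e2 := scale2 hVc u3 u0 u1 0 1
    rw [mul_zero, mul_one] at e1 e2
    rw [hU] at e1
    rw [hV] at e2
    rcases hI.infy u0 u1 h1 with h | h
    · rw [hz_deh hUb] at h
      exact h ((mul_eq_zero.mp e1.symm).resolve_left hn)
    · rw [hz_deh hVb] at h
      exact h ((mul_eq_zero.mp e2.symm).resolve_left hn)
  obtain ⟨r, hr⟩ : ∃ r, 2 * a = r + 1 := ⟨2 * a - 1, by omega⟩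
  obtain ⟨s, hs'⟩ : ∃ s, 2 * b = s + 1 := ⟨2 * b - 1, by omega⟩
  have hC : BH (cF F) (r + 1) (s + 1) := by rw [← hr, ← hs']; exact hF.map _
  have hsc : ∀ i, eval ![1, u1 / u0, 1, u3 / u2] (pderiv i (cF F)) = 0 := by
    intro i
    rw [← pd_smul hC u0 u2 n0 n2, mul_one, mul_one, mul_div_cancel₀ _ n0, mul_div_cancel₀ _ n2]
    exact hs i
  refine ⟨n0, n2, ?_, ?_, ?_⟩
  · rw [ev_dehC]
    have := hC.euler1 ![1, u1 / u0, 1, u3 / u2]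
    rw [hsc, hsc, mul_zero, mul_zero, add_zero] at this
    rcases mul_eq_zero.mp this.symm with h | h
    · exfalso; norm_cast at h
    · exact h
  · rw [dX_deh, ev_dehC, ← pderiv_cF]; exact hsc 1
  · rw [dY_deh, ev_dehC, ← pderiv_cF]; exact hsc 3

theorem sing_trans {K : Type*} [CommRing K] (Q : MvPolynomial (Fin 4) K)
    {g h g' h' : Matrix (Fin 2) (Fin 2) K} (hg : g * g' = 1) (hh : h * h' = 1)
    (v w : Fin 2 → K) (hs : ∀ i, eval ![v 0, v 1, w 0, w 1] (pderiv i Q) = 0) (i : Fin 4) :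
    eval ![(g'.mulVec v) 0, (g'.mulVec v) 1, (h'.mulVec w) 0, (h'.mulVec w) 1]
      (pderiv i (lsub (blk g h) Q)) = 0 := by
  have e : ![(g'.mulVec v) 0, (g'.mulVec v) 1, (h'.mulVec w) 0, (h'.mulVec w) 1] =
      (blk g' h').mulVec ![v 0, v 1, w 0, w 1] := by
    rw [blk_mulVec]
    funext i
    fin_cases i <;> simp [Matrix.mulVec, dotProduct]
  rw [e]
  have H := congrFun (eval_pderiv_lsub (blk g h) ((blk g' h').mulVec ![v 0, v 1, w 0, w 1]) Q) i
  rw [Matrix.mulVec_mulVec, blk_mul, hg, hh, blk_one, Matrix.one_mulVec] at H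
  have h0 : (fun i => eval ![v 0, v 1, w 0, w 1] (pderiv i Q)) = 0 := funext hs
  rw [h0, Matrix.mulVec_zero] at H
  exact H

theorem core (hF : BH F (2 * a) (2 * b)) (ha : 1 ≤ a) (hb : 1 ≤ b)
    (hN : NodeC (cF F)) (hnn : ∀ v, 0 ≤ eval v F) (hfin : (RZ2 F).Finite) :
    (RZ2 F).ncard + (SingSet2 (cF F)).ncard + 2 * ((a + 1) * (b + 1)) ≤ 2 * (4 * a * b + 2) := by
  classical
  obtain ⟨g, h, g', h', hg0, hh0, H⟩ :=
    good_coords hF ha hb hN hnn (coeff_ne1 hF hfin) (coeff_ne2 hF hfin)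
  have hg : g * g' = 1 := mul_eq_one_comm.mp hg0
  have hh : h * h' = 1 := mul_eq_one_comm.mp hh0
  have hF' : BH (lsub (blk g h) F) (2 * a) (2 * b) := hF.lsub_blk g h
  let f := deh (lsub (blk g h) F)
  let S : Set (ℂ × ℂ) := {z | ev z.1 z.2 f = 0 ∧ ev z.1 z.2 (dX f) = 0 ∧ ev z.1 z.2 (dY f) = 0}
  have hS : S.Finite := by
    by_contra hinf
    obtain ⟨t, ht, htc⟩ := Set.Infinite.exists_subset_card_eq hinf (2 * (4 * a * b + 2) + 1)
    have := H.bound_all t (fun z hz => ht hz) 0 (Nat.zero_le _)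
    omega
  have hgC := mapC_mul hg
  have hhC := mapC_mul hh
  -- complex singular points
  have hsing : ∀ p ∈ SingSet2 (cF F),
      ((g'.map (algebraMap ℝ ℂ)).mulVec p.1.rep) 0 ≠ 0 ∧
      ((h'.map (algebraMap ℝ ℂ)).mulVec p.2.rep) 0 ≠ 0 ∧
      (pc (g'.map (algebraMap ℝ ℂ)) p.1, pc (h'.map (algebraMap ℝ ℂ)) p.2) ∈ S := by
    intro p hp
    have e := sing_trans (cF F) hgC hhC p.1.rep p.2.rep hp
    rw [← cF_blk] at e
    obtain ⟨k0, k1, k2⟩ := sing_aff hF' H _ _ _ _ (mulVec_ne hgC p.1) (mulVec_ne hhC p.2) e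
    exact ⟨k0, k1, k2⟩
  have c1 : (SingSet2 (cF F)).ncard ≤ hS.toFinset.card := by
    rw [← Set.ncard_eq_toFinset_card S hS]
    apply Set.ncard_le_ncard_of_injOn
      (fun p => (pc (g'.map (algebraMap ℝ ℂ)) p.1, pc (h'.map (algebraMap ℝ ℂ)) p.2)) _ _ hS
    · intro p hp
      exact (hsing p hp).2.2
    · intro p hp q hq hpq
      have e := Prod.ext_iff.mp hpq
      exact Prod.ext (pc_inj hgC (hsing p hp).1 (hsing q hq).1 e.1)
        (pc_inj hhC (hsing p hp).2.1 (hsing q hq).2.1 e.2)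
  have hreal : ∀ p ∈ RZ2 F, (g'.mulVec p.1.rep) 0 ≠ 0 ∧ (h'.mulVec p.2.rep) 0 ≠ 0 ∧
      (((pc g' p.1 : ℝ) : ℂ), ((pc h' p.2 : ℝ) : ℂ)) ∈ S := by
    intro p hp
    have e := sing_trans F hg hh p.1.rep p.2.rep (zero_sing hnn _ hp)
    have n1 := mulVec_ne hg p.1
    have n2 := mulVec_ne hh p.2
    obtain ⟨k0, k1, k2⟩ := sing_aff hF' H ((g'.mulVec p.1.rep) 0 : ℝ) ((g'.mulVec p.1.rep) 1 : ℝ)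
      ((h'.mulVec p.2.rep) 0 : ℝ) ((h'.mulVec p.2.rep) 1 : ℝ) (by exact_mod_cast n1)
      (by exact_mod_cast n2) (by
        intro i
        rw [pderiv_cF, evalC_ofReal, e i, Complex.ofReal_zero])
    refine ⟨by exact_mod_cast k0, by exact_mod_cast k1, ?_⟩
    unfold pc
    rw [Complex.ofReal_div, Complex.ofReal_div]
    exact k2
  have c2 : (RZ2 F).ncard ≤ (hS.toFinset.filter (fun z => z.1.im = 0 ∧ z.2.im = 0)).card := by
    rw [← Set.ncard_coe_finset]
    apply Set.ncard_le_ncard_of_injOn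
      (fun p : Projectivization ℝ (Fin 2 → ℝ) × Projectivization ℝ (Fin 2 → ℝ) => (((pc g' p.1 : ℝ) : ℂ), ((pc h' p.2 : ℝ) : ℂ))) _ _ (Finset.finite_toSet _)
    · intro p hp
      rw [Finset.mem_coe, Finset.mem_filter, Set.Finite.mem_toFinset]
      exact ⟨(hreal p hp).2.2, Complex.ofReal_im _, Complex.ofReal_im _⟩
    · intro p hp q hq hpq
      have e := Prod.ext_iff.mp hpq
      exact Prod.ext (pc_inj hg (hreal p hp).1 (hreal q hq).1 (Complex.ofReal_injective e.1))
        (pc_inj hh (hreal p hp).2.1 (hreal q hq).2.1 (Complex.ofReal_injective e.2))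
  have := H.bound_all hS.toFinset (fun z hz => (Set.Finite.mem_toFinset hS).mp hz) _ c2
  omega

theorem final_nat (ha : 1 ≤ a) (hb : 1 ≤ b) (hbi : Bihomogeneous F (2 * a) (2 * b))
    (hnodal : ∀ p ∈ SingSet2 (cF F), IsNodeAt2 (cF F) p) (hfin : (RZ2 F).Finite) :
    (RZ2 F).ncard + (SingSet2 (cF F)).ncard + 2 * ((a + 1) * (b + 1)) ≤ 2 * (4 * a * b + 2) := by
  have hF : BH F (2 * a) (2 * b) := BH_iff.mpr hbi
  obtain ⟨r, hr⟩ : ∃ r, 2 * a = r + 1 := ⟨2 * a - 1, by omega⟩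
  obtain ⟨s, hs⟩ : ∃ s, 2 * b = s + 1 := ⟨2 * b - 1, by omega⟩
  have hC : BH (cF F) (r + 1) (s + 1) := by rw [← hr, ← hs]; exact hF.map _
  have hN : NodeC (cF F) := nodeC_of hC hnodal
  rcases sign_F hF hfin with h | h
  · exact core hF ha hb hN h hfin
  · have e1 : RZ2 (-F) = RZ2 F := by
      ext p; simp [RZ2]
    have e0 : cF (-F) = -cF F := by simp [cF]
    have e2 : SingSet2 (cF (-F)) = SingSet2 (cF F) := by
      rw [e0]
      ext p; simp [SingSet2]
    have := core hF.neg ha hb (by rw [e0]; exact hN.neg) h (by rw [e1]; exact hfin)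
    rwa [e1, e2] at this

end final

theorem stmt_17 (a b δ : ℕ) (ha : 1 ≤ a) (hb : 1 ≤ b)
    (F : MvPolynomial (Fin 4) ℝ) (hF : F ≠ 0)
    (hbi : Bihomogeneous F (2 * a) (2 * b))
    (hsf : Squarefree (MvPolynomial.map (algebraMap ℝ ℂ) F))
    (hnodal : ∀ p ∈ SingSet2 (MvPolynomial.map (algebraMap ℝ ℂ) F),
      IsNodeAt2 (MvPolynomial.map (algebraMap ℝ ℂ) F) p)
    (hδ : (SingSet2 (MvPolynomial.map (algebraMap ℝ ℂ) F)).ncard = δ)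
    (hfin : (RZ2 F).Finite) :
    ((RZ2 F).ncard : ℤ) ≤ 2 * (a : ℤ) * (b : ℤ) +
      ((2 * (a : ℤ) - 1) * (2 * (b : ℤ) - 1) - (δ : ℤ)) + 1 := by
  have h := final_nat (F := F) ha hb hbi hnodal hfin
  rw [show (SingSet2 (cF F)).ncard = δ from hδ] at h
  have h' : (((RZ2 F).ncard + δ + 2 * ((a + 1) * (b + 1)) : ℕ) : ℤ) ≤ ((2 * (4 * a * b + 2) : ℕ) : ℤ) := by exact_mod_cast h
  push_cast at h'
  nlinarith
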